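/- Let k ≥ 3 be an integer and let D = {DF(β) : β ∈ (k−1, k)}, a metric space under the Hausdorff metric on nonempty compact subsets of Δ. Then D contains a dense G_δ subset each of whose elements is of the form DF(n) for some n ∈ ℕ^ℕ such that Φ^{-1}(n) = {α} is a singleton and α is completely irrational, i.e. there are no integers m_0,…,m_{k−1}, not all zero, with m_0α_0 + ⋯ + m_{k−1}α_{k−1} = 0. -/

import Mathlib

open Filter Topology
open scoped Classical

namespace BetaDF

/-- Digit sequences (elements of `Σ = {0,…,k−1}^ℕ` when all entries are `< k`). -/
abbrev Seq : Type := ℕ → ℕ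

/-- Lexicographic (strict) order on digit sequences. -/
def seqLt (v w : Seq) : Prop := ∃ r, (∀ s, s < r → v s = w s) ∧ v r < w r

/-- Lexicographic order on digit sequences. -/
def seqLe (v w : Seq) : Prop := seqLt v w ∨ v = w

/-- The shift map `σ`. -/
def shift (w : Seq) : Seq := fun r => w (r + 1)

/-- Membership in `Σ = {0,…,k−1}^ℕ`. -/
def InSigma (k : ℕ) (w : Seq) : Prop := ∀ r, w r < k

/-- A sequence is maximal if it is `≥` every element of its shift orbit. -/
def IsMaximal (w : Seq) : Prop := ∀ r, seqLe (shift^[r] w) w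

/-- Number of occurrences of the digit `i` among the first `r` entries of `w`. -/
def digitCount (w : Seq) (i r : ℕ) : ℕ := ((Finset.range r).filter fun s => w s = i).card

/-- The ambient Euclidean space `ℝ^k`. -/
abbrev E (k : ℕ) : Type := EuclideanSpace ℝ (Fin k)

/-- The `i`-th coordinate (with junk value `0` for `i ≥ k`). -/
def proj {k : ℕ} (α : E k) (i : ℕ) : ℝ := if h : i < k then α ⟨i, h⟩ else 0

/-- `w` has digit frequency vector `α`. -/
def HasDigitFreq (k : ℕ) (w : Seq) (α : E k) : Prop :=
  ∀ i, i < k →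
    Tendsto (fun r => (digitCount w i r : ℝ) / (r : ℝ)) atTop (𝓝 (proj α i))

/-- The standard `(k−1)`-simplex `Δ`. -/
def simplex (k : ℕ) : Set (E k) := {α | (∀ i : Fin k, 0 ≤ α i) ∧ ∑ i, α i = 1}

/-- The face `F = {α ∈ Δ : α_{k−1} = 0}`. -/
def faceF (k : ℕ) : Set (E k) := {α ∈ simplex k | proj α (k - 1) = 0}

/-- `Δ' = Δ ∖ F`. -/
def simplex' (k : ℕ) : Set (E k) := simplex k \ faceF k

/-- `J(α) = ⌊α₀/α_{k−1}⌋`. -/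
noncomputable def Jfun {k : ℕ} (α : E k) : ℕ := ⌊proj α 0 / proj α (k - 1)⌋₊

/-- The map `K_n`. -/
noncomputable def Kmap {k : ℕ} (n : ℕ) (α : E k) : E k :=
  (WithLp.equiv 2 (Fin k → ℝ)).symm fun i =>
    if (i : ℕ) + 2 < k then proj α ((i : ℕ) + 1) / (1 - proj α 0)
    else if (i : ℕ) + 2 = k then (proj α 0 - n * proj α (k - 1)) / (1 - proj α 0)
    else ((n + 1) * proj α (k - 1) - proj α 0) / (1 - proj α 0)

/-- The continued-fraction map `K : Δ' → Δ'`, `K(α) = K_{J(α)}(α)`. -/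
noncomputable def Kstep {k : ℕ} (α : E k) : E k := Kmap (Jfun α) α

/-- The itinerary map `Φ(α)_r = J(K^r(α))`. -/
noncomputable def Phi {k : ℕ} (α : E k) : ℕ → ℕ := fun r => Jfun (Kstep^[r] α)

/-- The projective embedding `K_n^{-1} : Δ → Δ`. -/
noncomputable def Kinv {k : ℕ} (n : ℕ) (α : E k) : E k :=
  (WithLp.equiv 2 (Fin k → ℝ)).symm fun i =>
    (if (i : ℕ) = 0 then (n + 1) * proj α (k - 2) + n * proj α (k - 1)
      else if (i : ℕ) + 1 = k then proj α (k - 2) + proj α (k - 1)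
      else proj α ((i : ℕ) - 1)) /
      ((n + 1) * proj α (k - 2) + n * proj α (k - 1) + 1)

/-- `Υ_{n,r} = K_{n₀}^{-1} ∘ ⋯ ∘ K_{n_r}^{-1}`. -/
noncomputable def Ups {k : ℕ} (n : ℕ → ℕ) : ℕ → E k → E k
  | 0 => Kinv (n 0)
  | r + 1 => fun α => Ups n r (Kinv (n (r + 1)) α)

/-- `A_{n,r} = Υ_{n,r}(Δ)`. -/
noncomputable def Anr (k : ℕ) (n : ℕ → ℕ) (r : ℕ) : Set (E k) := Ups n r '' simplex k

/-- `F_{n,r} = Υ_{n,r}(F)`. -/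
noncomputable def Fnr (k : ℕ) (n : ℕ → ℕ) (r : ℕ) : Set (E k) := Ups n r '' faceF k

/-- Reverse-lexicographic strict order on `ℕ^ℕ`: `a < b` iff `a` exceeds `b`
at the first index where they differ. -/
def revLexLt (a b : ℕ → ℕ) : Prop := ∃ r, (∀ s, s < r → a s = b s) ∧ b r < a r

/-- The word to which the substitution `Λ_n` sends the digit `i`. -/
def lamWord (k n i : ℕ) : List ℕ :=
  if i + 2 < k then [i + 1]
  else if i + 2 = k then (k - 1) :: List.replicate (n + 1) 0
  else (k - 1) :: List.replicate n 0

/-- The substitution `Λ_n : Σ → Σ`. -/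
def lamSub (k n : ℕ) (w : Seq) : Seq := fun m =>
  (((List.range (m + 1)).map fun r => lamWord k n (w r)).flatten).getD m 0

/-- `Λ_{n,r} = Λ_{n₀} ∘ ⋯ ∘ Λ_{n_r}`. -/
def lamChain (k : ℕ) (n : ℕ → ℕ) : ℕ → Seq → Seq
  | 0 => lamSub k (n 0)
  | r + 1 => fun w => lamChain k n r (lamSub k (n (r + 1)) w)

/-- `Λ_{n₀} ∘ ⋯ ∘ Λ_{n_{R−1}}` for a finite list of indices. -/
def lamList (k : ℕ) : List ℕ → Seq → Seq
  | [], w => w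
  | a :: t, w => lamSub k a (lamList k t w)

/-- The constant sequence `(k−1)(k−1)(k−1)…`. -/
def topSeq (k : ℕ) : Seq := fun _ => k - 1

/-- The sequence `(k−1)000…`. -/
def baseSeq (k : ℕ) : Seq := fun m => if m = 0 then k - 1 else 0

/-- `S(n) = lim_{r→∞} Λ_{n,r}((k−1)(k−1)(k−1)…)` (limit in the product topology). -/
noncomputable def Sseq (k : ℕ) (n : ℕ → ℕ) : Seq :=
  limUnder atTop fun r => lamChain k n r (topSeq k)

/-- The compactified itinerary space `N`: sequences with values in `ℕ∞` such that
all entries from the first `∞` onwards equal `∞`.  Elements with no `∞` entry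
correspond to `ℕ^ℕ`; the others are the finite type elements `n₀…n_{R−1}∞`. -/
def NN : Type := {m : ℕ → ℕ∞ // ∀ r, m r = ⊤ → m (r + 1) = ⊤}

/-- Reverse-lexicographic strict order on `N` (`∞` counts as larger than every natural). -/
def nnLt (m n : NN) : Prop := ∃ r, (∀ s, s < r → m.1 s = n.1 s) ∧ n.1 r < m.1 r

/-- Reverse-lexicographic order on `N`. -/
def nnLe (m n : NN) : Prop := nnLt m n ∨ m = n

/-- The element of `N` determined by an element of `ℕ^ℕ`. -/
def toNN (g : ℕ → ℕ) : NN := ⟨fun r => (g r : ℕ∞), fun r h => absurd h (by simp)⟩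

/-- The itinerary `n₀ … n_{R−1} (n_R + 1) 0 0 0 …` (of rational type). -/
def ratSeq (f : ℕ → ℕ) (R : ℕ) : ℕ → ℕ := fun r =>
  if r < R then f r else if r = R then f R + 1 else 0

/-- The finite type element `n₀ … n_{R−1} n_R ∞` of `N`. -/
def finNN (f : ℕ → ℕ) (R : ℕ) : NN :=
  ⟨fun r => if r ≤ R then (f r : ℕ∞) else ⊤, by
    intro r h
    show (if r + 1 ≤ R then ((f (r + 1) : ℕ∞)) else ⊤) = ⊤
    have h' : (if r ≤ R then ((f r : ℕ∞)) else ⊤) = ⊤ := h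
    by_cases h1 : r ≤ R
    · rw [if_pos h1] at h'
      exact absurd h' (by simp)
    · rw [if_neg (by omega : ¬ r + 1 ≤ R)]⟩

/-- The extension of `S` to `N`. -/
noncomputable def SN (k : ℕ) (m : NN) : Seq :=
  if h : ∃ R, m.1 R = ⊤ then
    lamList k ((List.range (Nat.find h)).map fun r => (m.1 r).toNat) (baseSeq k)
  else Sseq k fun r => (m.1 r).toNat

/-- The metric `d(m,n) = 2^{−X(m,n)}` on `N`, where
`X(m,n) = r + min(m₀+⋯+m_r, n₀+⋯+n_r)` and `r` is the first index where `m,n` differ. -/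
noncomputable def dN (m n : NN) : ℝ :=
  if h : m = n then 0
  else
    have hex : ∃ r, m.1 r ≠ n.1 r := by
      by_contra hc
      push_neg at hc
      exact h (Subtype.ext (funext hc))
    (2 : ℝ) ^ (-(((Nat.find hex : ℕ) : ℤ) +
      ((min (∑ s ∈ Finset.range (Nat.find hex + 1), m.1 s)
            (∑ s ∈ Finset.range (Nat.find hex + 1), n.1 s)).toNat : ℤ)))

/-- The symbolic β-shift `X(w)`. -/
def Xset (k : ℕ) (w : Seq) : Set Seq :=
  {v | InSigma k v ∧ ∀ r, seqLe (shift^[r] v) w}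

/-- The digit frequency set `DF(w)` of the symbolic β-shift `X(w)`. -/
def DFw (k : ℕ) (w : Seq) : Set (E k) :=
  {α | α ∈ simplex k ∧ ∃ v ∈ Xset k w, HasDigitFreq k v α}

/-- `DF(n) = DF(S(n))` for `n ∈ ℕ^ℕ`. -/
noncomputable def DFn (k : ℕ) (n : ℕ → ℕ) : Set (E k) := DFw k (Sseq k n)

/-- `DF(n) = DF(S(n))` for `n ∈ N`. -/
noncomputable def DFN (k : ℕ) (m : NN) : Set (E k) := DFw k (SN k m)

/-- The infimax map `I = S ∘ Φ` on `Δ'`, extended by `I(α) = (k−1)000…` on `F`. -/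
noncomputable def Ifun (k : ℕ) (α : E k) : Seq :=
  if α ∈ simplex' k then Sseq k (Phi α) else baseSeq k

/-- The simplex `T_m = {α ∈ Δ : (m+1)α_{k−1} ≤ α₀}`. -/
def Tset (k m : ℕ) : Set (E k) :=
  {α ∈ simplex k | ((m : ℝ) + 1) * proj α (k - 1) ≤ proj α 0}

/-- The standard basis vector `e_i`. -/
noncomputable def evec (k i : ℕ) : E k :=
  (WithLp.equiv 2 (Fin k → ℝ)).symm fun j => if (j : ℕ) = i then 1 else 0

/-- The rational extreme points
`FE(n) = {Υ_{n,s}(e_{k−2}) : n_{s+t} ≠ 0 for some 1 ≤ t ≤ k−2}`. -/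
noncomputable def FEset (k : ℕ) (n : ℕ → ℕ) : Set (E k) :=
  {α | ∃ s, (∃ t, 1 ≤ t ∧ t ≤ k - 2 ∧ n (s + t) ≠ 0) ∧ α = Ups n s (evec k (k - 2))}

/-- The set `E(n)` of non-trivial extreme points of `DF(n)`:
extreme points other than `e₀,…,e_{k−2}`. -/
noncomputable def Eset (k : ℕ) (n : ℕ → ℕ) : Set (E k) :=
  Set.extremePoints ℝ (DFn k n) \ {α | ∃ i, i ≤ k - 2 ∧ α = evec k i}

/-- The fiber `Φ^{-1}(n) ⊆ Δ'`. -/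
noncomputable def PhiFiber (k : ℕ) (n : ℕ → ℕ) : Set (E k) :=
  {α ∈ simplex' k | Phi α = n}

/-- `f_β(x) = βx mod 1`. -/
noncomputable def fbeta (β x : ℝ) : ℝ := Int.fract (β * x)

/-- The digit sequence of the greedy β-expansion of `x`: `d_β(x)_r = ⌊β f_β^r(x)⌋`. -/
noncomputable def dbeta (β : ℝ) (x : ℝ) : Seq := fun r => ⌊β * (fbeta β)^[r] x⌋₊

/-- The digit frequency set `DF(β)` of β-expansions of points of `[0,1]`. -/
noncomputable def DFbeta (k : ℕ) (β : ℝ) : Set (E k) :=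
  {α | α ∈ simplex k ∧ ∃ x ∈ Set.Icc (0 : ℝ) 1, HasDigitFreq k (dbeta β x) α}

/-- The sequence `w_β`: if `d_β(1) = d₁…d_{r−1}d_r000…` with `d_r > 0` then `w_β`
is the infinite repetition of `d₁…d_{r−1}(d_r − 1)`; otherwise `w_β = d_β(1)`. -/
noncomputable def wbeta (β : ℝ) : Seq :=
  if h : ∃ r, dbeta β 1 r ≠ 0 ∧ ∀ s, r < s → dbeta β 1 s = 0 then
    fun m =>
      if m % (Nat.find h + 1) = Nat.find h then dbeta β 1 (Nat.find h) - 1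
      else dbeta β 1 (m % (Nat.find h + 1))
  else dbeta β 1

/-- `DF` extended to `[k−1,k]` by `DF(k−1) = F` and `DF(k) = Δ`. -/
noncomputable def DFext (k : ℕ) (β : ℝ) : Set (E k) :=
  if β ≤ (k : ℝ) - 1 then faceF k
  else if (k : ℝ) ≤ β then simplex k
  else DFbeta k β

/-- The mode-locking interval `I_{n₀…n_R}` determined by the word `f 0, …, f R`. -/
noncomputable def Iint (k : ℕ) (f : ℕ → ℕ) (R : ℕ) : Set ℝ :=
  {β | (k : ℝ) - 1 < β ∧ β < k ∧
    seqLe (Sseq k (ratSeq f R)) (wbeta β) ∧ seqLe (wbeta β) (SN k (finNN f R))}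

/-- The frequency vector of the first `s` digits of `w`. -/
noncomputable def freqVec (k : ℕ) (w : Seq) (s : ℕ) : E k :=
  (WithLp.equiv 2 (Fin k → ℝ)).symm fun i => (digitCount w (i : ℕ) s : ℝ) / (s : ℝ)


/-- The collection `D = {DF(β) : β ∈ (k−1,k)}`, as a subspace of the nonempty compact
subsets of `Δ` with the Hausdorff metric. -/
noncomputable def Dopen (k : ℕ) : Set (TopologicalSpace.NonemptyCompacts (E k)) :=
  {C | ∃ β : ℝ, (k : ℝ) - 1 < β ∧ β < k ∧ (C : Set (E k)) = DFbeta k β}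

/-! ### Lexicographic order -/

lemma seqLt_irrefl (v : Seq) : ¬ seqLt v v := by
  rintro ⟨r, _, h⟩; omega

lemma seq_tri (v w : Seq) : seqLt v w ∨ v = w ∨ seqLt w v := by
  by_cases h : v = w
  · exact Or.inr (Or.inl h)
  · have hex : ∃ r, v r ≠ w r := by
      by_contra hc
      exact h (funext fun r => by_contra fun hr => hc ⟨r, hr⟩)
    have h1 := Nat.find_spec hex
    have h2 : ∀ s, s < Nat.find hex → v s = w s := fun s hs => by
      by_contra hc
      exact Nat.find_min hex hs hc
    rcases lt_or_gt_of_ne h1 with h3 | h3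
    · exact Or.inl ⟨_, h2, h3⟩
    · exact Or.inr (Or.inr ⟨_, fun s hs => (h2 s hs).symm, h3⟩)

lemma seqLe_iff {v w : Seq} : seqLe v w ↔ ∀ q, (∀ i, i < q → v i = w i) → v q ≤ w q := by
  constructor
  · rintro (⟨r, h1, h2⟩ | rfl) q hq
    · rcases lt_trichotomy q r with h | h | h
      · exact (h1 q h).le
      · subst h; exact h2.le
      · have := hq r h; omega
    · exact le_rfl
  · intro h
    rcases seq_tri v w with h1 | h1 | ⟨r, h1, h2⟩
    · exact Or.inl h1
    · exact Or.inr h1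
    · have := h r (fun i hi => (h1 i hi).symm); omega

lemma seqLt_trans {u v w : Seq} (h1 : seqLt u v) (h2 : seqLt v w) : seqLt u w := by
  obtain ⟨r, a1, a2⟩ := h1
  obtain ⟨s, b1, b2⟩ := h2
  refine ⟨min r s, fun t ht => ?_, ?_⟩
  · rw [a1 t (by omega), b1 t (by omega)]
  · rcases lt_trichotomy r s with h | h | h
    · rw [min_eq_left h.le, ← b1 r h]; exact a2
    · subst h; simp; omega
    · rw [min_eq_right h.le, a1 s h]; exact b2

lemma seqLe_trans {u v w : Seq} (h1 : seqLe u v) (h2 : seqLe v w) : seqLe u w := by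
  rcases h1 with h1 | rfl
  · rcases h2 with h2 | rfl
    · exact Or.inl (seqLt_trans h1 h2)
    · exact Or.inl h1
  · exact h2

lemma seqLe_refl (u : Seq) : seqLe u u := Or.inr rfl

lemma seqLe_of_not_lt {u v : Seq} (h : ¬ seqLt u v) : seqLe v u := by
  rcases seq_tri u v with h1 | h1 | h1
  · exact absurd h1 h
  · exact Or.inr h1.symm
  · exact Or.inl h1

lemma not_lt_of_seqLe {u v : Seq} (h : seqLe u v) : ¬ seqLt v u := by
  intro h2
  rcases h with h | rfl
  · exact seqLt_irrefl _ (seqLt_trans h h2)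
  · exact seqLt_irrefl _ h2

lemma seqLt_of_le_of_lt {u v w : Seq} (h1 : seqLe u v) (h2 : seqLt v w) : seqLt u w := by
  rcases h1 with h1 | rfl
  · exact seqLt_trans h1 h2
  · exact h2

lemma seqLt_of_lt_of_le {u v w : Seq} (h1 : seqLt u v) (h2 : seqLe v w) : seqLt u w := by
  rcases h2 with h2 | rfl
  · exact seqLt_trans h1 h2
  · exact h1

lemma seqLe_antisymm {u v : Seq} (h1 : seqLe u v) (h2 : seqLe v u) : u = v := by
  rcases h1 with h1 | h1
  · exact absurd h1 (not_lt_of_seqLe h2)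
  · exact h1

lemma shift_iter (w : Seq) (r t : ℕ) : (shift^[r] w) t = w (t + r) := by
  induction r generalizing w with
  | zero => rfl
  | succ r ih =>
    rw [Function.iterate_succ_apply, ih]
    simp only [shift]
    congr 1

lemma shift_iter_eq (w : Seq) (r : ℕ) : (shift^[r] w) = fun t => w (t + r) :=
  funext fun t => shift_iter w r t

lemma shift_iter_add (w : Seq) (r s : ℕ) : shift^[s] (shift^[r] w) = shift^[r + s] w := by
  rw [add_comm, Function.iterate_add_apply]

/-! ### Infinite concatenation -/

/-- Infinite concatenation of words. -/
def cc (r : ℕ → List ℕ) : Seq := fun m =>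
  (((List.range (m + 1)).map r).flatten).getD m 0

/-- Cumulative length. -/
def cl (r : ℕ → List ℕ) (j : ℕ) : ℕ := ∑ i ∈ Finset.range j, (r i).length

lemma lamSub_eq (k n : ℕ) (w : Seq) : lamSub k n w = cc (fun r => lamWord k n (w r)) := rfl

lemma cl_zero (r : ℕ → List ℕ) : cl r 0 = 0 := rfl
lemma cl_succ (r : ℕ → List ℕ) (j : ℕ) : cl r (j+1) = cl r j + (r j).length := by
  simp [cl, Finset.sum_range_succ]

lemma cl_add (r : ℕ → List ℕ) (j i : ℕ) : cl r (j+i) = cl r j + cl (fun t => r (j+t)) i := by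
  simp [cl, Finset.sum_range_add]

lemma cl_congr {r r' : ℕ → List ℕ} {m : ℕ} (h : ∀ i, i < m → r i = r' i) : cl r m = cl r' m := by
  unfold cl
  exact Finset.sum_congr rfl fun i hi => by rw [h i (Finset.mem_range.1 hi)]

lemma length_flat (r : ℕ → List ℕ) (j : ℕ) :
    (((List.range j).map r).flatten).length = cl r j := by
  induction j with
  | zero => simp [cl]
  | succ j ih =>
    rw [List.range_succ, List.map_append, List.flatten_append, List.length_append, ih, cl_succ]
    simp

lemma le_cl {r : ℕ → List ℕ} (hr : ∀ i, r i ≠ []) (j : ℕ) : j ≤ cl r j := by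
  induction j with
  | zero => simp
  | succ j ih =>
    have := List.length_pos_iff.2 (hr j)
    rw [cl_succ]; omega

lemma cl_strictMono {r : ℕ → List ℕ} (hr : ∀ i, r i ≠ []) : StrictMono (cl r) := by
  refine strictMono_nat_of_lt_succ fun j => ?_
  have := List.length_pos_iff.2 (hr j)
  rw [cl_succ]; omega

lemma flat_getD (r : ℕ → List ℕ) (j s i : ℕ) (hs : s < (r j).length) (hi : j < i) :
    (((List.range i).map r).flatten).getD (cl r j + s) 0 = (r j).getD s 0 := by
  induction i with
  | zero => omega
  | succ i ih =>
    rw [List.range_succ, List.map_append, List.flatten_append]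
    rcases Nat.lt_or_ge j i with h | h
    · rw [List.getD_append, ih h]
      rw [length_flat]
      calc cl r j + s < cl r j + (r j).length := by omega
        _ = cl r (j+1) := (cl_succ _ _).symm
        _ ≤ cl r i := by
          unfold cl
          exact Finset.sum_le_sum_of_subset (Finset.range_mono h)
    · have : i = j := by omega
      subst this
      rw [List.getD_append_right, length_flat]
      · simp
      · rw [length_flat]; omega

lemma cc_spec {r : ℕ → List ℕ} (hr : ∀ i, r i ≠ []) (j s : ℕ) (hs : s < (r j).length) :
    cc r (cl r j + s) = (r j).getD s 0 := by
  unfold cc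
  apply flat_getD _ _ _ _ hs
  have := le_cl hr j
  omega

lemma exists_block {r : ℕ → List ℕ} (hr : ∀ i, r i ≠ []) (t : ℕ) :
    ∃ j s, s < (r j).length ∧ t = cl r j + s := by
  induction t with
  | zero => exact ⟨0, 0, List.length_pos_iff.2 (hr 0), by simp [cl]⟩
  | succ t ih =>
    obtain ⟨j, s, h1, h2⟩ := ih
    by_cases h : s + 1 < (r j).length
    · exact ⟨j, s+1, h, by omega⟩
    · exact ⟨j+1, 0, List.length_pos_iff.2 (hr _), by rw [cl_succ]; omega⟩

lemma cc_unique {r : ℕ → List ℕ} (hr : ∀ i, r i ≠ []) {v : Seq}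
    (h : ∀ j s, s < (r j).length → v (cl r j + s) = (r j).getD s 0) : v = cc r := by
  funext t
  obtain ⟨j, s, h1, rfl⟩ := exists_block hr t
  rw [h j s h1, cc_spec hr j s h1]

lemma cc_shift {r : ℕ → List ℕ} (hr : ∀ i, r i ≠ []) (j : ℕ) :
    shift^[cl r j] (cc r) = cc (fun i => r (j + i)) := by
  refine cc_unique (fun i => hr _) fun i s hs => ?_
  rw [shift_iter, ← cc_spec hr (j+i) s hs, cl_add]
  congr 1; omega

lemma cc_pfx {r r' : ℕ → List ℕ} (hr : ∀ i, r i ≠ []) (hr' : ∀ i, r' i ≠ []) {m : ℕ}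
    (h : ∀ i, i < m → r i = r' i) (t : ℕ) (ht : t < cl r m) : cc r t = cc r' t := by
  obtain ⟨j, s, h1, rfl⟩ := exists_block hr t
  have hj : j < m := by
    by_contra hc
    have := (cl_strictMono hr).monotone (not_lt.1 hc)
    omega
  rw [cc_spec hr j s h1, cl_congr (fun i hi => h i (hi.trans hj)),
    cc_spec hr' j s (by rw [← h j hj]; exact h1), h j hj]

/-- A code word: nonzero digit followed by zeros. -/
def cw (x z : ℕ) : List ℕ := x :: List.replicate z 0

lemma cw_ne (x z : ℕ) : cw x z ≠ [] := by simp [cw]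
lemma cw_length (x z : ℕ) : (cw x z).length = z + 1 := by simp [cw]
lemma cw_zero (x z : ℕ) : (cw x z).getD 0 0 = x := by simp [cw]
lemma cw_succ (x z s : ℕ) : (cw x z).getD (s+1) 0 = 0 := by
  simp [cw, List.getElem?_replicate]
  split_ifs <;> simp
lemma cw_pos (x z s : ℕ) (hs : 0 < s) : (cw x z).getD s 0 = 0 := by
  obtain ⟨s, rfl⟩ : ∃ t, s = t + 1 := ⟨s - 1, by omega⟩
  exact cw_succ x z s

lemma cc_head {r : ℕ → List ℕ} (hr : ∀ i, r i ≠ []) (j : ℕ) :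
    cc r (cl r j) = (r j).getD 0 0 := by
  have := cc_spec hr j 0 (List.length_pos_iff.2 (hr j))
  simpa using this

/-- Order comparison of concatenations of code words. -/
lemma cc_lt {x z x' z' : ℕ → ℕ} (hx' : ∀ i, 0 < x' i) {l : ℕ}
    (h : ∀ i, i < l → x i = x' i ∧ z i = z' i)
    (hl : x l < x' l ∨ (x l = x' l ∧ z' l < z l)) :
    seqLt (cc fun i => cw (x i) (z i)) (cc fun i => cw (x' i) (z' i)) := by
  set r := fun i => cw (x i) (z i) with hr
  set r' := fun i => cw (x' i) (z' i) with hr'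
  have n1 : ∀ i, r i ≠ [] := fun i => cw_ne _ _
  have n2 : ∀ i, r' i ≠ [] := fun i => cw_ne _ _
  have heq : ∀ i, i < l → r i = r' i := fun i hi => by simp [hr, hr', h i hi]
  have hcl := cl_congr heq
  rcases hl with hl | ⟨hl1, hl2⟩
  · refine ⟨cl r l, fun s hs => cc_pfx n1 n2 heq s hs, ?_⟩
    rw [cc_head n1, hcl, cc_head n2]
    simp only [hr, hr', cw_zero]; exact hl
  · refine ⟨cl r l + (z' l + 1), fun s hs => ?_, ?_⟩
    · rcases Nat.lt_or_ge s (cl r l) with h1 | h1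
      · exact cc_pfx n1 n2 heq s h1
      · obtain ⟨q, rfl⟩ := Nat.exists_eq_add_of_le h1
        rw [cc_spec n1 l q (by simp only [hr, cw_length]; omega), hcl,
          cc_spec n2 l q (by simp only [hr', cw_length]; omega)]
        rcases Nat.eq_zero_or_pos q with rfl | hq
        · simp only [hr, hr', cw_zero]; exact hl1
        · simp only [hr, hr', cw_pos _ _ _ hq]
    · rw [cc_spec n1 l _ (by simp only [hr, cw_length]; omega), hcl]
      have : cl r' l + (z' l + 1) = cl r' (l+1) := by
        rw [cl_succ]; simp only [hr', cw_length]
      rw [this, cc_head n2]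
      simp only [hr, hr', cw_succ, cw_zero]
      exact hx' _

/-! ### digit counts -/

lemma dc_succ (w : Seq) (i t : ℕ) :
    digitCount w i (t+1) = digitCount w i t + if w t = i then 1 else 0 := by
  unfold digitCount
  rw [Finset.range_add_one, Finset.filter_insert]
  split_ifs with h
  · rw [Finset.card_insert_of_notMem (by simp)]
  · simp

lemma dc_zero (w : Seq) (i : ℕ) : digitCount w i 0 = 0 := by simp [digitCount]

lemma dc_add (w : Seq) (i s t : ℕ) :
    digitCount w i (s+t) = digitCount w i s + digitCount (shift^[s] w) i t := by
  induction t with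
  | zero => simp [dc_zero]
  | succ t ih =>
    rw [← add_assoc, dc_succ, dc_succ, ih, shift_iter, add_comm t s]
    omega

lemma dc_mono (w : Seq) (i : ℕ) : Monotone (digitCount w i) :=
  monotone_nat_of_le_succ fun t => by rw [dc_succ]; omega

lemma dc_le (w : Seq) (i t : ℕ) : digitCount w i t ≤ t := by
  induction t with
  | zero => simp [dc_zero]
  | succ t ih => rw [dc_succ]; split_ifs <;> omega

lemma dc_sum {k : ℕ} {w : Seq} (hw : InSigma k w) (t : ℕ) :
    ∑ i ∈ Finset.range k, digitCount w i t = t := by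
  induction t with
  | zero => simp [dc_zero]
  | succ t ih =>
    simp only [dc_succ, Finset.sum_add_distrib, ih]
    rw [Finset.sum_ite_eq]
    simp [hw t]

lemma dc_list (l : List ℕ) (w : Seq) (i : ℕ) (h : ∀ s, s < l.length → w s = l.getD s 0) :
    digitCount w i l.length = l.count i := by
  induction l using List.reverseRecOn with
  | nil => simp [dc_zero]
  | append_singleton l a ih =>
    rw [List.length_append, List.length_singleton, dc_succ, List.count_append, ih]
    · rw [h l.length (by simp)]
      rw [List.count_singleton]; simp
    · intro s hs
      rw [h s (by simp; omega), List.getD_append _ _ _ _ hs]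

lemma dc_cc {r : ℕ → List ℕ} (hr : ∀ i, r i ≠ []) (b j : ℕ) :
    digitCount (cc r) b (cl r j) = ∑ i ∈ Finset.range j, (r i).count b := by
  induction j with
  | zero => simp [cl_zero, dc_zero]
  | succ j ih =>
    rw [cl_succ, dc_add, ih, Finset.sum_range_succ, dc_list]
    intro s hs
    rw [shift_iter, add_comm, cc_spec hr j s hs]

lemma freq_cc {r : ℕ → List ℕ} (hr : ∀ i, r i ≠ []) (b : ℕ) (a : ℝ)
    (h1 : Tendsto (fun j => (digitCount (cc r) b (cl r j) : ℝ) / (cl r j : ℝ)) atTop (𝓝 a))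
    (h2 : Tendsto (fun j => ((r j).length : ℝ) / (cl r j : ℝ)) atTop (𝓝 0)) :
    Tendsto (fun t => (digitCount (cc r) b t : ℝ) / (t : ℝ)) atTop (𝓝 a) := by
  choose J S hS hJ using exists_block hr
  have hJtop : Tendsto J atTop atTop := by
    rw [tendsto_atTop]
    intro N
    filter_upwards [eventually_ge_atTop (cl r N)] with t ht
    by_contra hc
    have h3 := (cl_strictMono hr).monotone (show J t + 1 ≤ N by omega)
    rw [cl_succ] at h3
    have := hS t; have := hJ t
    omega
  have hq : Tendsto (fun j => (cl r (j+1) : ℝ) / (cl r j : ℝ)) atTop (𝓝 1) := by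
    have h3 : Tendsto (fun j => 1 + ((r j).length : ℝ) / (cl r j : ℝ)) atTop (𝓝 (1 + 0)) :=
      h2.const_add 1
    rw [add_zero] at h3
    refine h3.congr' ?_
    filter_upwards [eventually_ge_atTop 1] with j hj
    have : (0:ℝ) < cl r j := by
      have := le_cl hr j
      exact_mod_cast (by omega : 0 < cl r j)
    rw [cl_succ]; push_cast; field_simp
  have hq' : Tendsto (fun j => (cl r j : ℝ) / (cl r (j+1) : ℝ)) atTop (𝓝 1) := by
    have := hq.inv₀ one_ne_zero
    rw [inv_one] at this
    refine this.congr fun j => ?_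
    rw [inv_div]
  have hlow := (h1.mul hq').comp hJtop
  have hup := ((h1.comp (tendsto_add_atTop_nat 1)).mul hq).comp hJtop
  rw [mul_one] at hlow hup
  refine tendsto_of_tendsto_of_tendsto_of_le_of_le' hlow hup ?_ ?_
  · filter_upwards [hJtop.eventually_ge_atTop 1] with t ht
    have hp : (0:ℝ) < cl r (J t) := by
      have := le_cl hr (J t)
      exact_mod_cast (by omega : 0 < cl r (J t))
    have e1 : cl r (J t) ≤ t := by have := hJ t; omega
    have e2 : t ≤ cl r (J t + 1) := by rw [cl_succ]; have := hJ t; have := hS t; omega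
    have htp : (0:ℝ) < t := lt_of_lt_of_le hp (by exact_mod_cast e1)
    have hp2 : (0:ℝ) < cl r (J t + 1) := lt_of_lt_of_le htp (by exact_mod_cast e2)
    simp only [Function.comp]
    rw [div_mul_div_cancel₀ hp.ne']
    exact div_le_div₀ (by positivity) (by exact_mod_cast dc_mono _ _ e1) htp (by exact_mod_cast e2)
  · filter_upwards [hJtop.eventually_ge_atTop 1] with t ht
    have hp : (0:ℝ) < cl r (J t) := by
      have := le_cl hr (J t)
      exact_mod_cast (by omega : 0 < cl r (J t))
    have e1 : cl r (J t) ≤ t := by have := hJ t; omega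
    have e2 : t ≤ cl r (J t + 1) := by rw [cl_succ]; have := hJ t; have := hS t; omega
    have htp : (0:ℝ) < t := lt_of_lt_of_le hp (by exact_mod_cast e1)
    have hp2 : (0:ℝ) < cl r (J t + 1) := lt_of_lt_of_le htp (by exact_mod_cast e2)
    simp only [Function.comp]
    rw [div_mul_div_cancel₀ hp2.ne']
    exact div_le_div₀ (by positivity) (by exact_mod_cast dc_mono _ _ e2) hp (by exact_mod_cast e1)

lemma sum_by_digit {k : ℕ} {u : Seq} (hu : InSigma k u) (g : ℕ → ℕ) (j : ℕ) :
    ∑ l ∈ Finset.range j, g (u l) = ∑ i ∈ Finset.range k, digitCount u i j * g i := by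
  induction j with
  | zero => simp [dc_zero]
  | succ j ih =>
    rw [Finset.sum_range_succ, ih]
    simp only [dc_succ, add_mul, Finset.sum_add_distrib]
    congr 1
    rw [Finset.sum_eq_single (u j)]
    · simp
    · intro b _ hb
      rw [if_neg (Ne.symm hb), zero_mul]
    · intro h
      exact absurd (Finset.mem_range.2 (hu j)) h

/-- Frequencies of a substitution image. -/
lemma freq_subst {k : ℕ} {u : Seq} (hu : InSigma k u) (y : ℕ → ℝ)
    (hy : ∀ i, i < k → Tendsto (fun t => (digitCount u i t : ℝ) / (t : ℝ)) atTop (𝓝 (y i)))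
    (hsum : ∑ i ∈ Finset.range k, y i = 1) (W : ℕ → List ℕ) (hW : ∀ i, W i ≠ []) (b : ℕ) :
    Tendsto (fun t => (digitCount (cc fun l => W (u l)) b t : ℝ) / (t : ℝ)) atTop
      (𝓝 ((∑ i ∈ Finset.range k, y i * (W i).count b) /
        (∑ i ∈ Finset.range k, y i * (W i).length))) := by
  have hy0 : ∀ i, i < k → 0 ≤ y i := fun i hi =>
    ge_of_tendsto' (hy i hi) fun t => by positivity
  have hD : 1 ≤ ∑ i ∈ Finset.range k, y i * (W i).length := by
    rw [← hsum]
    refine Finset.sum_le_sum fun i hi => ?_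
    have : (1:ℝ) ≤ (W i).length := by exact_mod_cast List.length_pos_iff.2 (hW i)
    nlinarith [hy0 i (Finset.mem_range.1 hi)]
  have key : ∀ g : ℕ → ℕ, Tendsto (fun j => ((∑ l ∈ Finset.range j, g (u l) : ℕ) : ℝ) / (j:ℝ)) atTop
      (𝓝 (∑ i ∈ Finset.range k, y i * g i)) := by
    intro g
    have : Tendsto (fun j => ∑ i ∈ Finset.range k, (digitCount u i j : ℝ) / (j:ℝ) * g i) atTop
      (𝓝 (∑ i ∈ Finset.range k, y i * g i)) :=
      tendsto_finsetSum _ fun i hi => (hy i (Finset.mem_range.1 hi)).mul_const _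
    refine this.congr fun j => ?_
    rw [sum_by_digit hu]
    push_cast
    rw [Finset.sum_div]
    exact Finset.sum_congr rfl fun i _ => by ring
  have hlen : Tendsto (fun j => (cl (fun l => W (u l)) j : ℝ) / (j:ℝ)) atTop
      (𝓝 (∑ i ∈ Finset.range k, y i * (W i).length)) := key (fun i => (W i).length)
  have hcnt := key (fun i => (W i).count b)
  refine freq_cc (fun l => hW _) b _ ?_ ?_
  · refine (hcnt.div hlen (by linarith)).congr' ?_
    filter_upwards [eventually_ge_atTop 1] with j hj
    have : (0:ℝ) < j := by exact_mod_cast hj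
    rw [dc_cc (fun l => hW _), Pi.div_apply, div_div_div_cancel_right₀ this.ne']
  · have hB : ∃ B : ℕ, ∀ l, (W (u l)).length ≤ B := by
      refine ⟨∑ i ∈ Finset.range k, (W i).length, fun l => ?_⟩
      exact Finset.single_le_sum (f := fun i => (W i).length) (fun i _ => Nat.zero_le _)
        (Finset.mem_range.2 (hu l))
    obtain ⟨B, hB⟩ := hB
    refine squeeze_zero' (g := fun j : ℕ => (B:ℝ) / (j:ℝ)) (Eventually.of_forall fun j => by positivity) ?_
      (tendsto_const_div_atTop_nhds_zero_nat _)
    filter_upwards [eventually_ge_atTop 1] with j hj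
    have : (0:ℝ) < j := by exact_mod_cast hj
    exact div_le_div₀ (by positivity) (by exact_mod_cast hB j) this
      (by exact_mod_cast le_cl (fun l => hW _) j)

lemma exists_slow (c : ℕ → ℕ) : ∃ φ : ℕ → ℕ, Tendsto φ atTop atTop ∧
    ∀ i, φ i * c (φ i) ≤ i := by
  refine ⟨fun i => Nat.findGreatest (fun j => ∀ j' ≤ j, j' * c j' ≤ i) i, ?_, ?_⟩
  · rw [tendsto_atTop]
    intro N
    have : ∃ M, N ≤ M ∧ ∀ j' ≤ N, j' * c j' ≤ M := by
      refine ⟨N + ∑ j ∈ Finset.range (N+1), j * c j, by omega, fun j' hj' => ?_⟩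
      have := Finset.single_le_sum (f := fun j => j * c j) (s := Finset.range (N+1))
        (fun i _ => Nat.zero_le _) (Finset.mem_range.2 (show j' < N + 1 by omega))
      omega
    obtain ⟨M, hM, hM'⟩ := this
    filter_upwards [eventually_ge_atTop M] with i hi
    exact Nat.le_findGreatest (by omega) fun j' hj' => (hM' j' hj').trans hi
  · intro i
    have := Nat.findGreatest_spec (P := fun j => ∀ j' ≤ j, j' * c j' ≤ i) (Nat.zero_le i)
      (by intro j' hj'; obtain rfl : j' = 0 := by omega
          simp)
    exact this _ le_rfl

/-- Concatenating words whose frequencies converge. -/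
lemma freq_conc (p : ℕ → List ℕ) (hp : ∀ j, p j ≠ []) : ∃ φ : ℕ → ℕ, ∀ (b : ℕ) (a : ℝ),
    Tendsto (fun j => ((p j).count b : ℝ) / ((p j).length : ℝ)) atTop (𝓝 a) →
    Tendsto (fun t => (digitCount (cc fun i => p (φ i)) b t : ℝ) / (t:ℝ)) atTop (𝓝 a) := by
  obtain ⟨φ, hφ, hφ2⟩ := exists_slow fun j => (p j).length
  refine ⟨φ, fun b a hab => ?_⟩
  set r : ℕ → List ℕ := fun i => p (φ i) with hrdef
  have hr : ∀ i, r i ≠ [] := fun i => hp _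
  have hlpos : ∀ i, (0:ℝ) < (r i).length := fun i => by exact_mod_cast List.length_pos_iff.2 (hr i)
  have hclt : Tendsto (fun j => ∑ i ∈ Finset.range j, ((r i).length : ℝ)) atTop atTop := by
    refine tendsto_atTop_mono (fun j => ?_) tendsto_natCast_atTop_atTop
    have := le_cl hr j
    unfold cl at this
    exact_mod_cast this
  have hcl : ∀ j, ∑ i ∈ Finset.range j, ((r i).length : ℝ) = cl r j := fun j => by
    unfold cl; push_cast; rfl
  refine freq_cc hr b a ?_ ?_
  · have h1 : (fun i => ((r i).count b : ℝ) - a * (r i).length) =o[atTop] fun i => ((r i).length : ℝ) := by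
      rw [Asymptotics.isLittleO_iff_tendsto (fun i h => absurd h (hlpos i).ne')]
      have := (hab.comp hφ).sub_const a
      rw [sub_self] at this
      refine this.congr fun i => ?_
      have := hlpos i
      simp only [Function.comp]
      rw [sub_div, mul_div_cancel_right₀ _ this.ne']
    have h2 := h1.sum_range (fun i => (hlpos i).le) hclt
    rw [Asymptotics.isLittleO_iff_tendsto'] at h2
    · have h3 := h2.add_const a
      rw [zero_add] at h3
      refine h3.congr' ?_
      filter_upwards [eventually_ge_atTop 1] with j hj
      have : (0:ℝ) < cl r j := by
        have := le_cl hr j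
        exact_mod_cast (by omega : 0 < cl r j)
      rw [hcl, dc_cc hr, Finset.sum_sub_distrib, ← Finset.mul_sum, hcl]
      push_cast
      field_simp
      ring
    · filter_upwards [hclt.eventually_gt_atTop 0] with j hj h0
      exact absurd h0 hj.ne'
  · have hb : ∀ᶠ i in atTop, ((r i).length : ℝ) / (cl r i : ℝ) ≤ 1 / (φ i : ℝ) := by
      filter_upwards [hφ.eventually_ge_atTop 1, eventually_ge_atTop 1] with i h1 h2
      have e1 : (0:ℝ) < φ i := by exact_mod_cast h1
      have e0 : (i:ℝ) ≤ cl r i := by exact_mod_cast le_cl hr i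
      have e2 : (0:ℝ) < cl r i := lt_of_lt_of_le (by exact_mod_cast h2) e0
      rw [div_le_div_iff₀ e2 e1]
      have e3 : ((φ i * (p (φ i)).length : ℕ) : ℝ) ≤ i := by exact_mod_cast hφ2 i
      push_cast at e3
      simp only [hrdef] at *
      nlinarith
    refine squeeze_zero' (Eventually.of_forall fun j => by positivity) hb ?_
    simp only [one_div]
    exact (tendsto_inv_atTop_zero.comp tendsto_natCast_atTop_atTop).comp hφ

/-! ### Basic properties of the substitutions -/

def lx (k i : ℕ) : ℕ := if i + 2 < k then i + 1 else k - 1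
def lz (k n i : ℕ) : ℕ := if i + 2 < k then 0 else if i + 2 = k then n + 1 else n

lemma lamWord_cw (k n i : ℕ) : lamWord k n i = cw (lx k i) (lz k n i) := by
  unfold lamWord lx lz cw
  split_ifs <;> simp

lemma lamSub_cw (k n : ℕ) (w : Seq) :
    lamSub k n w = cc fun r => cw (lx k (w r)) (lz k n (w r)) := by
  rw [lamSub_eq]; simp only [lamWord_cw]

lemma lamWord_ne (k n i : ℕ) : lamWord k n i ≠ [] := by rw [lamWord_cw]; exact cw_ne _ _

lemma lx_pos {k : ℕ} (hk : 3 ≤ k) (i : ℕ) : 0 < lx k i := by unfold lx; split_ifs <;> omega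
lemma lx_lt {k : ℕ} (hk : 3 ≤ k) (i : ℕ) : lx k i < k := by unfold lx; split_ifs <;> omega
lemma lz_le (k n i : ℕ) : lz k n i ≤ n + 1 := by unfold lz; split_ifs <;> omega

lemma lam_lt {k : ℕ} (hk : 3 ≤ k) (n : ℕ) {u u' : Seq} (hu' : InSigma k u')
    (h : seqLt u u') : seqLt (lamSub k n u) (lamSub k n u') := by
  obtain ⟨r, h1, h2⟩ := h
  rw [lamSub_cw, lamSub_cw]
  refine cc_lt (fun i => lx_pos hk _) (l := r) (fun i hi => by rw [h1 i hi]; simp) ?_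
  have := hu' r
  unfold lx lz
  split_ifs <;> omega

lemma lam_le {k : ℕ} (hk : 3 ≤ k) (n : ℕ) {u u' : Seq} (hu' : InSigma k u')
    (h : seqLe u u') : seqLe (lamSub k n u) (lamSub k n u') := by
  rcases h with h | rfl
  · exact Or.inl (lam_lt hk n hu' h)
  · exact seqLe_refl _

lemma lam_lt_rev {k : ℕ} (hk : 3 ≤ k) {n : ℕ} {u u' : Seq} (hu : InSigma k u)
    (h : seqLt (lamSub k n u) (lamSub k n u')) : seqLt u u' := by
  rcases seq_tri u u' with h1 | rfl | h1
  · exact h1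
  · exact absurd h (seqLt_irrefl _)
  · exact absurd (lam_lt hk n hu h1) (not_lt_of_seqLe (Or.inl h))

lemma lam_le_rev {k : ℕ} (hk : 3 ≤ k) {n : ℕ} {u u' : Seq} (hu : InSigma k u)
    (h : seqLe (lamSub k n u) (lamSub k n u')) : seqLe u u' :=
  seqLe_of_not_lt fun h1 => not_lt_of_seqLe h (lam_lt hk n hu h1)

lemma lam_inj {k : ℕ} (hk : 3 ≤ k) {n : ℕ} {u u' : Seq} (hu : InSigma k u) (hu' : InSigma k u')
    (h : lamSub k n u = lamSub k n u') : u = u' :=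
  seqLe_antisymm (lam_le_rev hk hu (Or.inr h)) (lam_le_rev hk hu' (Or.inr h.symm))

lemma lam_lt_index {k : ℕ} (hk : 3 ≤ k) {a b : ℕ} (hab : a < b) {u u' : Seq}
    (hu : u 0 = k - 1) (hu' : u' 0 = k - 1) : seqLt (lamSub k b u') (lamSub k a u) := by
  rw [lamSub_cw, lamSub_cw]
  refine cc_lt (fun i => lx_pos hk _) (l := 0) (fun i hi => by omega) ?_
  rw [hu, hu']
  unfold lx lz
  split_ifs <;> omega

lemma lam_head {k : ℕ} (hk : 3 ≤ k) (n : ℕ) {u : Seq} (hu : u 0 = k - 1) :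
    lamSub k n u 0 = k - 1 := by
  have := cc_head (r := fun r => lamWord k n (u r)) (fun i => lamWord_ne _ _ _) 0
  rw [cl_zero, ← lamSub_eq] at this
  rw [this, hu, lamWord_cw, cw_zero]
  unfold lx; rw [if_neg (by omega)]

lemma lam_sigma {k : ℕ} (hk : 3 ≤ k) (n : ℕ) (u : Seq) : InSigma k (lamSub k n u) := by
  intro t
  have hne : ∀ i, (fun r => lamWord k n (u r)) i ≠ [] := fun i => lamWord_ne _ _ _
  obtain ⟨j, s, h1, rfl⟩ := exists_block hne t
  rw [lamSub_eq, cc_spec hne j s h1, lamWord_cw]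
  rcases s with _ | s
  · rw [cw_zero]; exact lx_lt hk _
  · rw [cw_succ]; omega

/-- each nonzero digit appears within any `n+2` consecutive positions -/
lemma lam_nozeros {k : ℕ} (hk : 3 ≤ k) (n : ℕ) (u : Seq) (t : ℕ) :
    ∃ s, s ≤ n + 1 ∧ lamSub k n u (t + s) ≠ 0 := by
  have hne : ∀ i, (fun r => lamWord k n (u r)) i ≠ [] := fun i => lamWord_ne _ _ _
  have hh : ∀ j, lamSub k n u (cl (fun r => lamWord k n (u r)) j) ≠ 0 := by
    intro j
    rw [lamSub_eq, cc_head hne]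
    rw [lamWord_cw, cw_zero]
    exact (lx_pos hk _).ne'
  obtain ⟨j, s, h1, rfl⟩ := exists_block hne t
  rcases Nat.eq_zero_or_pos s with rfl | hs
  · exact ⟨0, by omega, hh j⟩
  · refine ⟨(lamWord k n (u j)).length - s, ?_, ?_⟩
    · have := lz_le k n (u j)
      rw [lamWord_cw, cw_length]; omega
    · have h2 := hh (j+1)
      rw [cl_succ] at h2
      convert h2 using 2
      omega

lemma lam_shift (k n : ℕ) (u : Seq) (j : ℕ) :
    shift^[cl (fun r => lamWord k n (u r)) j] (lamSub k n u) = lamSub k n (shift^[j] u) := by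
  rw [lamSub_eq, cc_shift (fun i => lamWord_ne _ _ _), lamSub_eq]
  simp only [shift_iter, add_comm]

lemma lam_top {k : ℕ} (hk : 3 ≤ k) : lamSub k 0 (topSeq k) = topSeq k := by
  rw [lamSub_cw]
  symm
  refine cc_unique (fun i => cw_ne _ _) fun j s hs => ?_
  have h1 : lz k 0 (topSeq k j) = 0 := by
    unfold lz topSeq; rw [if_neg (by omega), if_neg (by omega)]
  have h2 : lx k (topSeq k j) = k - 1 := by
    unfold lx topSeq; rw [if_neg (by omega)]
  simp only [cw_length, h1] at hs
  obtain rfl : s = 0 := by omega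
  simp only [h1, h2, cw_zero]
  rfl

lemma top_sigma {k : ℕ} (hk : 3 ≤ k) : InSigma k (topSeq k) := fun r => by unfold topSeq; omega
lemma base_sigma {k : ℕ} (hk : 3 ≤ k) : InSigma k (baseSeq k) := fun r => by
  unfold baseSeq; split_ifs <;> omega
lemma le_top {k : ℕ} {w : Seq} (hw : InSigma k w) : seqLe w (topSeq k) := by
  rw [seqLe_iff]; intro q _; have := hw q; unfold topSeq; omega
lemma base_le {k : ℕ} {w : Seq} (hw : w 0 = k - 1) : seqLe (baseSeq k) w := by
  rw [seqLe_iff]; intro q _; unfold baseSeq; split_ifs with h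
  · rw [h, hw]
  · omega

lemma sigma_shift {k : ℕ} {w : Seq} (hw : InSigma k w) (r : ℕ) : InSigma k (shift^[r] w) :=
  fun t => by rw [shift_iter]; exact hw _

lemma seqLe_of_head_lt {u v : Seq} (h : u 0 < v 0) : seqLe u v :=
  Or.inl ⟨0, fun s hs => by omega, h⟩

lemma X_lam {k : ℕ} (hk : 3 ≤ k) (n : ℕ) {u w : Seq} (hu : InSigma k u) (hw : InSigma k w)
    (hw0 : w 0 = k - 1) :
    (∀ r, seqLe (shift^[r] (lamSub k n u)) (lamSub k n w)) ↔ ∀ r, seqLe (shift^[r] u) w := by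
  have hne : ∀ i, (fun r => lamWord k n (u r)) i ≠ [] := fun i => lamWord_ne _ _ _
  constructor
  · intro h r
    have := h (cl (fun r => lamWord k n (u r)) r)
    rw [lam_shift] at this
    exact lam_le_rev hk (sigma_shift hu r) this
  · intro h t
    obtain ⟨j, s, h1, rfl⟩ := exists_block hne t
    rcases Nat.eq_zero_or_pos s with rfl | hs
    · rw [add_zero, lam_shift]
      exact lam_le hk n hw (h j)
    · apply seqLe_of_head_lt
      rw [shift_iter, lam_head hk n hw0, zero_add, lamSub_eq, cc_spec hne j s h1, lamWord_cw,
        cw_pos _ _ _ hs]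
      omega

lemma lam_max {k : ℕ} (hk : 3 ≤ k) (n : ℕ) {w : Seq} (hw : InSigma k w)
    (hw0 : w 0 = k - 1) (hm : IsMaximal w) : IsMaximal (lamSub k n w) :=
  (X_lam hk n hw hw hw0).2 hm

/-! ### Lists of substitutions -/

lemma lamList_append (k : ℕ) (g h : List ℕ) (w : Seq) :
    lamList k (g ++ h) w = lamList k g (lamList k h w) := by
  induction g with
  | nil => rfl
  | cons a g ih => simp [lamList, ih]

lemma ll_sigma {k : ℕ} (hk : 3 ≤ k) (g : List ℕ) {w : Seq} (hw : InSigma k w) :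
    InSigma k (lamList k g w) := by
  cases g with
  | nil => exact hw
  | cons a g => exact lam_sigma hk _ _

lemma ll_head {k : ℕ} (hk : 3 ≤ k) (g : List ℕ) {w : Seq} (hw : w 0 = k - 1) :
    lamList k g w 0 = k - 1 := by
  induction g with
  | nil => exact hw
  | cons a g ih => exact lam_head hk _ ih

lemma ll_lt {k : ℕ} (hk : 3 ≤ k) (g : List ℕ) {u w : Seq} (hw : InSigma k w) (h : seqLt u w) :
    seqLt (lamList k g u) (lamList k g w) := by
  induction g with
  | nil => exact h
  | cons a g ih => exact lam_lt hk a (ll_sigma hk g hw) ih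

lemma ll_le {k : ℕ} (hk : 3 ≤ k) (g : List ℕ) {u w : Seq} (hw : InSigma k w) (h : seqLe u w) :
    seqLe (lamList k g u) (lamList k g w) := by
  rcases h with h | rfl
  · exact Or.inl (ll_lt hk g hw h)
  · exact seqLe_refl _

lemma ll_max {k : ℕ} (hk : 3 ≤ k) (g : List ℕ) {w : Seq} (hw : InSigma k w)
    (hw0 : w 0 = k - 1) (hm : IsMaximal w) : IsMaximal (lamList k g w) := by
  induction g with
  | nil => exact hm
  | cons a g ih => exact lam_max hk a (ll_sigma hk g hw) (ll_head hk g hw0) ih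

lemma top_max (k : ℕ) : IsMaximal (topSeq k) := fun r => Or.inr (by
  funext t; rw [shift_iter]; rfl)

lemma base_max {k : ℕ} (hk : 3 ≤ k) : IsMaximal (baseSeq k) := by
  intro r
  rcases Nat.eq_zero_or_pos r with rfl | hr
  · exact seqLe_refl _
  · apply seqLe_of_head_lt
    rw [shift_iter]; unfold baseSeq; rw [if_neg (by omega), if_pos rfl]; omega

/-! ### Agreement -/

def Ag (k : ℕ) (u u' : Seq) (P : ℕ) : Prop :=
  ∃ m c, (∀ i, i < m → u i = u' i) ∧ c ≤ u m ∧ c ≤ u' m ∧ P ≤ k * m + c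

lemma ag_lam {k : ℕ} (hk : 3 ≤ k) (n : ℕ) {u u' : Seq} (hu : InSigma k u) (hu' : InSigma k u')
    {P : ℕ} (h : Ag k u u' P) : Ag k (lamSub k n u) (lamSub k n u') (P + 1) := by
  obtain ⟨m, c, h1, h2, h3, h4⟩ := h
  have hne : ∀ u : Seq, ∀ i, (fun r => lamWord k n (u r)) i ≠ [] := fun u i => lamWord_ne _ _ _
  have hh : ∀ u : Seq, ∀ j, lamSub k n u (cl (fun r => lamWord k n (u r)) j) = lx k (u j) := by
    intro u j
    rw [lamSub_eq, cc_head (hne u)]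
    rw [lamWord_cw, cw_zero]
  have key : ∀ m, (∀ i, i < m → u i = u' i) → ∃ M, m ≤ M ∧
      (∀ i, i < M → lamSub k n u i = lamSub k n u' i) ∧ lamSub k n u M = lx k (u m) ∧
      lamSub k n u' M = lx k (u' m) := by
    intro m hm
    refine ⟨cl (fun r => lamWord k n (u r)) m, le_cl (hne u) m, fun i hi => ?_, hh u m, ?_⟩
    · rw [lamSub_eq, lamSub_eq]
      exact cc_pfx (hne u) (hne u') (m := m) (fun i hi => by simp only [hm i hi]) i hi
    · rw [← hh u' m]; congr 1
      exact cl_congr fun i hi => by simp only [hm i hi]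
  have hkm : ∀ M, m ≤ M → k * m ≤ k * M := fun M hM => Nat.mul_le_mul_left k hM
  have := hu m; have := hu' m
  by_cases hc : c + 1 < k
  · obtain ⟨M, hM, hM1, hM2, hM3⟩ := key m h1
    refine ⟨M, c + 1, hM1, ?_, ?_, ?_⟩
    · rw [hM2]; unfold lx; split_ifs <;> omega
    · rw [hM3]; unfold lx; split_ifs <;> omega
    · have := hkm M hM; omega
  · obtain ⟨M, hM, hM1, hM2, hM3⟩ := key (m+1) (fun i hi => by
      rcases Nat.lt_succ_iff_lt_or_eq.1 hi with h | rfl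
      · exact h1 i h
      · omega)
    refine ⟨M, 0, hM1, Nat.zero_le _, Nat.zero_le _, ?_⟩
    have := Nat.mul_le_mul_left k hM
    rw [mul_add] at this
    omega

lemma ag_list {k : ℕ} (hk : 3 ≤ k) (g : List ℕ) {u u' : Seq} (hu : InSigma k u)
    (hu' : InSigma k u') {P : ℕ} (h : Ag k u u' P) :
    Ag k (lamList k g u) (lamList k g u') (P + g.length) := by
  induction g with
  | nil => exact h
  | cons a g ih =>
    exact ag_lam hk a (ll_sigma hk g hu) (ll_sigma hk g hu') ih

lemma ll_agree {k : ℕ} (hk : 3 ≤ k) {g : List ℕ} {u u' : Seq} (hu : InSigma k u)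
    (hu' : InSigma k u') (h0 : u 0 = k - 1) (h0' : u' 0 = k - 1) {i : ℕ}
    (hi : k * i + 1 ≤ g.length) : lamList k g u i = lamList k g u' i := by
  obtain ⟨m, c, h1, h2, h3, h4⟩ := ag_list hk g hu hu' (P := k - 1)
    ⟨0, k - 1, fun i hi => by omega, h0.ge, h0'.ge, by omega⟩
  apply h1
  have := ll_sigma hk g hu m
  by_contra hc
  have := Nat.mul_le_mul_left k (not_lt.1 hc)
  omega

def pre (n : ℕ → ℕ) (r : ℕ) : List ℕ := (List.range r).map n

lemma pre_length (n : ℕ → ℕ) (r : ℕ) : (pre n r).length = r := by simp [pre]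
lemma pre_succ (n : ℕ → ℕ) (r : ℕ) : pre n (r+1) = pre n r ++ [n r] := by
  simp [pre, List.range_succ]
lemma pre_succ' (n : ℕ → ℕ) (r : ℕ) : pre n (r+1) = n 0 :: pre (fun i => n (i+1)) r := by
  simp [pre, List.range_succ_eq_map, Function.comp_def]
lemma pre_add (n : ℕ → ℕ) (r s : ℕ) : pre n (r+s) = pre n r ++ pre (fun i => n (r+i)) s := by
  simp [pre, List.range_add, Function.comp_def]
lemma pre_congr {n n' : ℕ → ℕ} {r : ℕ} (h : ∀ i, i < r → n i = n' i) : pre n r = pre n' r := by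
  unfold pre
  exact List.map_congr_left fun i hi => h i (List.mem_range.1 hi)

lemma lamChain_eq (k : ℕ) (n : ℕ → ℕ) (r : ℕ) (w : Seq) :
    lamChain k n r w = lamList k (pre n (r+1)) w := by
  induction r generalizing w with
  | zero => rfl
  | succ r ih => rw [pre_succ, lamList_append, ← ih]; rfl

lemma S_agree {k : ℕ} (hk : 3 ≤ k) (n : ℕ → ℕ) {w : Seq} (hw : InSigma k w) (hw0 : w 0 = k - 1)
    {r i : ℕ} (hr : k * i + 1 ≤ r) : Sseq k n i = lamList k (pre n r) w i := by
  have main : ∀ i r, k * i + 1 ≤ r → ∀ w, InSigma k w → w 0 = k - 1 →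
      lamList k (pre n r) w i = lamList k (pre n (k * i + 1)) (topSeq k) i := by
    intro i r hr w hw hw0
    obtain ⟨s, rfl⟩ := Nat.exists_eq_add_of_le hr
    rw [pre_add, lamList_append]
    exact ll_agree hk (ll_sigma hk _ hw) (top_sigma hk) (ll_head hk _ hw0) rfl
      (by rw [pre_length])
  have ht : Tendsto (fun r => lamChain k n r (topSeq k)) atTop
      (𝓝 fun i => lamList k (pre n (k * i + 1)) (topSeq k) i) := by
    rw [tendsto_pi_nhds]
    intro i
    apply tendsto_const_nhds.congr'
    filter_upwards [eventually_ge_atTop (k * i + 1)] with r hr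
    rw [lamChain_eq]
    exact (main i (r+1) (by omega) _ (top_sigma hk) rfl).symm
  unfold Sseq
  rw [ht.limUnder_eq, main i r hr w hw hw0]

lemma S_head {k : ℕ} (hk : 3 ≤ k) (n : ℕ → ℕ) : Sseq k n 0 = k - 1 := by
  rw [S_agree hk n (top_sigma hk) rfl (r := 1) (by omega)]
  exact ll_head hk _ rfl

lemma S_sigma {k : ℕ} (hk : 3 ≤ k) (n : ℕ → ℕ) : InSigma k (Sseq k n) := fun i => by
  rw [S_agree hk n (top_sigma hk) rfl le_rfl]
  exact ll_sigma hk _ (top_sigma hk) i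

lemma lam_pfx {k n : ℕ} {u u' : Seq} {m : ℕ} (h : ∀ i, i < m → u i = u' i) :
    ∀ i, i < m → lamSub k n u i = lamSub k n u' i := by
  intro i hi
  have hne : ∀ u : Seq, ∀ i, (fun r => lamWord k n (u r)) i ≠ [] := fun u i => lamWord_ne _ _ _
  exact cc_pfx (hne u) (hne u') (m := m) (fun i hi => by simp only [h i hi]) i
    (hi.trans_le (le_cl (hne u) m))

lemma S_succ {k : ℕ} (hk : 3 ≤ k) (n : ℕ → ℕ) :
    Sseq k n = lamSub k (n 0) (Sseq k fun i => n (i+1)) := by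
  funext i
  rw [S_agree hk n (top_sigma hk) rfl (r := k * i + 1 + 1) (by omega), pre_succ']
  refine lam_pfx (m := i + 1) (fun j hj => ?_) i (by omega)
  rw [S_agree hk _ (top_sigma hk) rfl (r := k * i + 1)]
  have := Nat.mul_le_mul_left k (show j ≤ i by omega)
  omega

lemma S_add {k : ℕ} (hk : 3 ≤ k) (n : ℕ → ℕ) (r : ℕ) :
    Sseq k n = lamList k (pre n r) (Sseq k fun i => n (r+i)) := by
  induction r with
  | zero => simp [pre, lamList]
  | succ r ih =>
    rw [pre_succ, lamList_append, ih]
    congr 1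
    rw [S_succ hk]
    simp only [lamList, add_zero]
    congr 2
    funext i; congr 1; omega

lemma S_max {k : ℕ} (hk : 3 ≤ k) (n : ℕ → ℕ) : IsMaximal (Sseq k n) := by
  intro r
  rw [seqLe_iff]
  intro q hq
  have hm := seqLe_iff.1 (ll_max hk (pre n (k * (q + r) + 1)) (top_sigma hk) rfl (top_max k) r) q
  have e : ∀ i, i ≤ q + r →
      Sseq k n i = lamList k (pre n (k * (q + r) + 1)) (topSeq k) i := fun i hi =>
    S_agree hk n (top_sigma hk) rfl (by have := Nat.mul_le_mul_left k hi; omega)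
  rw [shift_iter, e _ le_rfl, e q (by omega)]
  rw [shift_iter] at hm
  apply hm
  intro i hi
  have := hq i hi
  rw [shift_iter, e _ (by omega), e i (by omega)] at this
  rw [shift_iter, this]

lemma S_le {k : ℕ} (hk : 3 ≤ k) (n : ℕ → ℕ) (r : ℕ) :
    seqLe (Sseq k n) (lamList k (pre n r) (topSeq k)) := by
  rw [S_add hk n r]
  exact ll_le hk _ (top_sigma hk) (le_top (S_sigma hk _))

lemma le_S {k : ℕ} (hk : 3 ≤ k) (n : ℕ → ℕ) (r : ℕ) :
    seqLe (lamList k (pre n r) (baseSeq k)) (Sseq k n) := by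
  rw [S_add hk n r]
  exact ll_le hk _ (S_sigma hk _) (base_le (S_head hk _))

/-! ### Coordinates -/

lemma proj_mk {k : ℕ} (f : Fin k → ℝ) {i : ℕ} (hi : i < k) :
    proj ((WithLp.equiv 2 (Fin k → ℝ)).symm f : E k) i = f ⟨i, hi⟩ := by
  unfold proj; rw [dif_pos hi]; rfl

lemma proj_fin {k : ℕ} (α : E k) (i : Fin k) : proj α i = α i := by
  unfold proj; rw [dif_pos i.2]

lemma proj_ext {k : ℕ} {α β : E k} (h : ∀ i, i < k → proj α i = proj β i) : α = β := by
  ext i; rw [← proj_fin, ← proj_fin, h i i.2]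

lemma proj_nonneg {k : ℕ} {α : E k} (h : α ∈ simplex k) (i : ℕ) : 0 ≤ proj α i := by
  unfold proj; split_ifs with hi
  · exact h.1 _
  · exact le_rfl

lemma proj_sum {k : ℕ} (α : E k) : ∑ i ∈ Finset.range k, proj α i = ∑ i, α i := by
  rw [Finset.sum_range]
  exact Finset.sum_congr rfl fun i _ => proj_fin α i

lemma simplex_iff {k : ℕ} {α : E k} : α ∈ simplex k ↔
    (∀ i, i < k → 0 ≤ proj α i) ∧ ∑ i ∈ Finset.range k, proj α i = 1 := by
  rw [proj_sum]
  constructor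
  · intro h; exact ⟨fun i _ => proj_nonneg h i, h.2⟩
  · intro h; exact ⟨fun i => by rw [← proj_fin]; exact h.1 i i.2, h.2⟩

lemma freq_simplex {k : ℕ} {v : Seq} (hv : InSigma k v) {α : E k} (h : HasDigitFreq k v α) :
    α ∈ simplex k := by
  rw [simplex_iff]
  refine ⟨fun i hi => ge_of_tendsto' (h i hi) fun t => by positivity, ?_⟩
  have h1 := tendsto_finsetSum (Finset.range k) fun i hi => h i (Finset.mem_range.1 hi)
  refine tendsto_nhds_unique h1 (tendsto_const_nhds.congr' ?_)
  filter_upwards [eventually_gt_atTop 0] with t ht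
  rw [← Finset.sum_div, ← Nat.cast_sum, dc_sum hv, div_self]
  exact_mod_cast ht.ne'

lemma mem_DFw {k : ℕ} {w : Seq} {α : E k} :
    α ∈ DFw k w ↔ ∃ v ∈ Xset k w, HasDigitFreq k v α :=
  ⟨fun h => h.2, fun h => ⟨by obtain ⟨v, hv, h2⟩ := h; exact freq_simplex hv.1 h2, h⟩⟩

lemma DFw_mono {k : ℕ} {w w' : Seq} (h : seqLe w w') : DFw k w ⊆ DFw k w' := by
  intro α hα
  rw [mem_DFw] at hα ⊢
  obtain ⟨v, hv, h2⟩ := hα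
  exact ⟨v, ⟨hv.1, fun r => seqLe_trans (hv.2 r) h⟩, h2⟩

/-- denominators -/
noncomputable def kden {k : ℕ} (n : ℕ) (α : E k) : ℝ :=
  (n + 1) * proj α (k - 2) + n * proj α (k - 1) + 1

lemma kden_pos {k : ℕ} (n : ℕ) {α : E k} (h : α ∈ simplex k) : 1 ≤ kden n α := by
  unfold kden
  have := proj_nonneg h (k-2); have := proj_nonneg h (k-1)
  have : 0 ≤ ((n:ℝ)+1) * proj α (k-2) + n * proj α (k-1) := by positivity
  linarith

lemma Kinv_zero {k : ℕ} (hk : 3 ≤ k) (n : ℕ) (α : E k) :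
    proj (Kinv n α) 0 = ((n + 1) * proj α (k - 2) + n * proj α (k - 1)) / kden n α := by
  unfold Kinv kden; rw [proj_mk _ (by omega)]; simp
lemma Kinv_last {k : ℕ} (hk : 3 ≤ k) (n : ℕ) (α : E k) :
    proj (Kinv n α) (k-1) = (proj α (k - 2) + proj α (k - 1)) / kden n α := by
  unfold Kinv kden; rw [proj_mk _ (by omega)]; simp only
  rw [if_neg (by omega), if_pos (by omega)]
lemma Kinv_mid {k : ℕ} (n : ℕ) (α : E k) {i : ℕ} (hi : i + 2 < k) :
    proj (Kinv n α) (i+1) = proj α i / kden n α := by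
  unfold Kinv kden; rw [proj_mk _ (by omega)]; simp only
  rw [if_neg (by omega), if_neg (by omega)]; simp

lemma Kmap_mid {k : ℕ} (n : ℕ) (α : E k) {i : ℕ} (hi : i + 2 < k) :
    proj (Kmap n α) i = proj α (i+1) / (1 - proj α 0) := by
  unfold Kmap; rw [proj_mk _ (by omega)]; simp only
  rw [if_pos hi]
lemma Kmap_pen {k : ℕ} (hk : 3 ≤ k) (n : ℕ) (α : E k) :
    proj (Kmap n α) (k-2) = (proj α 0 - n * proj α (k - 1)) / (1 - proj α 0) := by
  unfold Kmap; rw [proj_mk _ (by omega)]; simp only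
  rw [if_neg (by omega), if_pos (by omega)]
lemma Kmap_last {k : ℕ} (hk : 3 ≤ k) (n : ℕ) (α : E k) :
    proj (Kmap n α) (k-1) = ((n+1) * proj α (k - 1) - proj α 0) / (1 - proj α 0) := by
  unfold Kmap; rw [proj_mk _ (by omega)]; simp only
  rw [if_neg (by omega), if_neg (by omega)]

/-- every index is `0`, in the middle, or last -/
lemma idx_cases {k : ℕ} (hk : 3 ≤ k) {b : ℕ} (hb : b < k) :
    b = 0 ∨ (∃ i, i + 2 < k ∧ b = i + 1) ∨ b = k - 1 := by
  rcases Nat.eq_zero_or_pos b with h | h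
  · exact Or.inl h
  · by_cases h2 : b = k - 1
    · exact Or.inr (Or.inr h2)
    · exact Or.inr (Or.inl ⟨b - 1, by omega, by omega⟩)

lemma idx_cases2 {k : ℕ} {b : ℕ} (hb : b < k) :
    b + 2 < k ∨ b = k - 2 ∨ b = k - 1 := by omega

lemma sum_split_last {k : ℕ} (hk : 3 ≤ k) (f : ℕ → ℝ) : ∑ i ∈ Finset.range k, f i =
    ∑ i ∈ Finset.range (k-2), f i + f (k-2) + f (k-1) := by
  obtain ⟨m, rfl⟩ : ∃ m, k = m + 2 := ⟨k - 2, by omega⟩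
  rw [Finset.sum_range_succ, Finset.sum_range_succ]
  rfl

lemma sum_split_ends {k : ℕ} (hk : 3 ≤ k) (f : ℕ → ℝ) : ∑ i ∈ Finset.range k, f i =
    f 0 + ∑ i ∈ Finset.range (k-2), f (i+1) + f (k-1) := by
  obtain ⟨m, rfl⟩ : ∃ m, k = m + 2 := ⟨k - 2, by omega⟩
  rw [Finset.sum_range_succ, Finset.sum_range_succ']
  simp; ring

lemma Kinv_simplex {k : ℕ} (hk : 3 ≤ k) (n : ℕ) {α : E k} (h : α ∈ simplex k) :
    Kinv n α ∈ simplex k := by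
  have hd := kden_pos n h
  have hd0 : (0:ℝ) < kden n α := by linarith
  have h0 := proj_nonneg h
  rw [simplex_iff]
  constructor
  · intro b hb
    rcases idx_cases hk hb with rfl | ⟨i, hi, rfl⟩ | rfl
    · rw [Kinv_zero hk]; have := h0 (k-2); have := h0 (k-1); positivity
    · rw [Kinv_mid n α hi]; have := h0 i; positivity
    · rw [Kinv_last hk]; have := h0 (k-2); have := h0 (k-1); positivity
  · rw [sum_split_ends hk, Kinv_zero hk, Kinv_last hk,
      Finset.sum_congr rfl (fun i hi => Kinv_mid n α (by have := Finset.mem_range.1 hi; omega)),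
      ← Finset.sum_div, ← add_div, ← add_div, div_eq_one_iff_eq hd0.ne']
    have := (simplex_iff.1 h).2
    rw [sum_split_last hk] at this
    unfold kden
    linarith

lemma cw_count (x z b : ℕ) : (x :: List.replicate z 0).count b =
    (if b = x then 1 else 0) + (if b = 0 then z else 0) := by
  rw [List.count_cons, List.count_replicate, add_comm]
  congr 1
  · simp only [beq_iff_eq]; simp only [eq_comm]
  · simp only [beq_iff_eq]; simp only [eq_comm]

lemma map_range_sum (f : ℕ → ℕ) (k : ℕ) :
    ((List.range k).map f).sum = ∑ i ∈ Finset.range k, f i := by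
  induction k with
  | zero => simp
  | succ k ih => simp [List.range_succ, Finset.sum_range_succ, ih]

lemma lw_count_mid {k : ℕ} (hk : 3 ≤ k) (n i b : ℕ) (hi : i + 2 < k) :
    (lamWord k n i).count b = if b = i + 1 then 1 else 0 := by
  unfold lamWord; rw [if_pos hi]
  by_cases h : b = i + 1
  · simp [h]
  · rw [if_neg h, List.count_eq_zero]; simpa using h
lemma lw_count_pen {k : ℕ} (hk : 3 ≤ k) (n b : ℕ) :
    (lamWord k n (k-2)).count b =
      (if b = k-1 then 1 else 0) + (if b = 0 then n+1 else 0) := by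
  unfold lamWord; rw [if_neg (by omega), if_pos (by omega)]
  exact cw_count _ _ _
lemma lw_count_last {k : ℕ} (hk : 3 ≤ k) (n b : ℕ) :
    (lamWord k n (k-1)).count b =
      (if b = k-1 then 1 else 0) + (if b = 0 then n else 0) := by
  unfold lamWord; rw [if_neg (by omega), if_neg (by omega)]
  exact cw_count _ _ _
lemma lw_len_mid {k : ℕ} (n i : ℕ) (hi : i + 2 < k) : (lamWord k n i).length = 1 := by
  unfold lamWord; rw [if_pos hi]; rfl
lemma lw_len_pen {k : ℕ} (hk : 3 ≤ k) (n : ℕ) : (lamWord k n (k-2)).length = n+2 := by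
  unfold lamWord; rw [if_neg (by omega), if_pos (by omega)]; simp
lemma lw_len_last {k : ℕ} (hk : 3 ≤ k) (n : ℕ) : (lamWord k n (k-1)).length = n+1 := by
  unfold lamWord; rw [if_neg (by omega), if_neg (by omega)]; simp

/-- (S) -/
lemma freq_lam {k : ℕ} (hk : 3 ≤ k) (n : ℕ) {u : Seq} (hu : InSigma k u) {y : E k}
    (h : HasDigitFreq k u y) : HasDigitFreq k (lamSub k n u) (Kinv n y) := by
  have hs := freq_simplex hu h
  intro b hb
  have h1 := freq_subst hu (proj y) h (simplex_iff.1 hs).2 (lamWord k n)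
    (fun i => lamWord_ne _ _ _) b
  have hden : ∑ i ∈ Finset.range k, proj y i * (lamWord k n i).length = kden n y := by
    rw [sum_split_last hk, Finset.sum_congr rfl (g := fun i => proj y i)
      (fun i hi => by rw [lw_len_mid n i (by have := Finset.mem_range.1 hi; omega)]; simp),
      lw_len_pen hk, lw_len_last hk]
    have := (simplex_iff.1 hs).2
    rw [sum_split_last hk] at this
    unfold kden; push_cast; linarith
  rw [hden] at h1
  rw [lamSub_eq]
  convert h1 using 2
  rw [sum_split_last hk, lw_count_pen hk, lw_count_last hk]
  rcases idx_cases hk hb with rfl | ⟨i, hi, rfl⟩ | rfl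
  · rw [Finset.sum_eq_zero (fun i hi => by
      rw [lw_count_mid hk n i 0 (by have := Finset.mem_range.1 hi; omega), if_neg (by omega)]; simp)]
    rw [if_neg (by omega), Kinv_zero hk]; simp; ring
  · rw [Finset.sum_eq_single i (fun j hj hj2 => by
      rw [lw_count_mid hk n j _ (by have := Finset.mem_range.1 hj; omega), if_neg (by omega)]; simp)
      (fun h => absurd (Finset.mem_range.2 (by omega)) h)]
    rw [Kinv_mid n y hi, lw_count_mid hk n i _ hi, if_neg (by omega : ¬ i + 1 = k-1)]; simp
  · rw [Finset.sum_eq_zero (fun i hi => by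
      rw [lw_count_mid hk n i _ (by have := Finset.mem_range.1 hi; omega),
        if_neg (by have := Finset.mem_range.1 hi; omega)]; simp)]
    rw [Kinv_last hk, if_neg (by omega : ¬ k - 1 = 0), if_neg (by omega : ¬ k - 1 = 0)]; simp

lemma DF_S {k : ℕ} (hk : 3 ≤ k) (n : ℕ) {w : Seq} (hw : InSigma k w) (hw0 : w 0 = k - 1)
    {y : E k} (h : y ∈ DFw k w) : Kinv n y ∈ DFw k (lamSub k n w) := by
  rw [mem_DFw] at h ⊢
  obtain ⟨v, hv, h2⟩ := h
  exact ⟨lamSub k n v, ⟨lam_sigma hk n v, (X_lam hk n hv.1 hw hw0).2 hv.2⟩,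
    freq_lam hk n hv.1 h2⟩

lemma exists_freq {k : ℕ} (hk : 3 ≤ k) (y : ℕ → ℝ) (hy : ∀ i, i < k → 0 ≤ y i)
    (hs : ∑ i ∈ Finset.range k, y i = 1) : ∃ u, InSigma k u ∧ ∀ i, i < k →
      Tendsto (fun t => (digitCount u i t : ℝ) / (t : ℝ)) atTop (𝓝 (y i)) := by
  let p : ℕ → List ℕ := fun N =>
    0 :: ((List.range k).map fun i => List.replicate ⌊(N:ℝ) * y i⌋₊ i).flatten
  have hp : ∀ N, p N ≠ [] := fun N => by simp [p]
  obtain ⟨φ, hφ⟩ := freq_conc p hp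
  refine ⟨cc fun i => p (φ i), ?_, fun b hb => hφ b _ ?_⟩
  · intro t
    obtain ⟨j, s, h1, rfl⟩ := exists_block (r := fun i => p (φ i)) (fun i => hp _) t
    rw [cc_spec (fun i => hp _) j s h1]
    have hmem : (p (φ j)).getD s 0 ∈ p (φ j) := by
      rw [List.getD_eq_getElem _ _ h1]; exact List.getElem_mem h1
    simp only [p, List.mem_cons, List.mem_flatten, List.mem_map, List.mem_range] at hmem
    rcases hmem with h | ⟨l, ⟨a, ha, rfl⟩, h⟩
    · simp only [p]; omega
    · have := List.eq_of_mem_replicate h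
      simp only [p]; omega
  · have hcount : ∀ N, ((p N).count b : ℝ) = ⌊(N:ℝ) * y b⌋₊ + if b = 0 then 1 else 0 := by
      intro N
      simp only [p, List.count_cons, List.count_flatten, List.map_map]
      have : (List.map (List.count b ∘ fun i => List.replicate ⌊(N:ℝ) * y i⌋₊ i)
          (List.range k)).sum = ⌊(N:ℝ) * y b⌋₊ := by
        rw [map_range_sum, Finset.sum_eq_single b]
        · simp
        · intro i _ hi; simp [List.count_replicate, hi]
        · intro h; exact absurd (Finset.mem_range.2 hb) h
      rw [this]; push_cast; congr 1
      by_cases h : b = 0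
      · simp [h]
      · rw [if_neg h, if_neg (by simpa using Ne.symm h)]
    have hlen : ∀ N, ((p N).length : ℝ) = 1 + ∑ i ∈ Finset.range k, (⌊(N:ℝ) * y i⌋₊ : ℝ) := by
      intro N
      simp only [p, List.length_cons, List.length_flatten, List.map_map]
      rw [map_range_sum]; simp [add_comm]
    have hfl : ∀ i, i < k → Tendsto (fun N : ℕ => (⌊(N:ℝ) * y i⌋₊ : ℝ) / N) atTop (𝓝 (y i)) := by
      intro i hi
      have := (tendsto_nat_floor_mul_div_atTop (hy i hi)).comp
        (tendsto_natCast_atTop_atTop (R := ℝ))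
      refine this.congr fun N => ?_
      simp [mul_comm]
    have h1N : ∀ c : ℝ, Tendsto (fun N : ℕ => c / (N:ℝ)) atTop (𝓝 0) := fun c =>
      tendsto_const_div_atTop_nhds_zero_nat c
    have hA : Tendsto (fun N : ℕ => ((p N).count b : ℝ) / N) atTop (𝓝 (y b)) := by
      have := (hfl b hb).add (h1N (if b = 0 then 1 else 0))
      rw [add_zero] at this
      refine this.congr fun N => ?_
      rw [hcount]; push_cast; ring
    have hB : Tendsto (fun N : ℕ => ((p N).length : ℝ) / N) atTop (𝓝 1) := by
      have := (h1N 1).add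
        (tendsto_finsetSum (Finset.range k) fun i hi => hfl i (Finset.mem_range.1 hi))
      rw [zero_add, hs] at this
      refine this.congr fun N => ?_
      rw [hlen, ← Finset.sum_div]; ring
    have := hA.div hB one_ne_zero
    rw [div_one] at this
    refine this.congr' ?_
    filter_upwards [eventually_gt_atTop 0] with N hN
    have : (N:ℝ) ≠ 0 := by exact_mod_cast hN.ne'
    simp only [Pi.div_apply]
    rw [div_div_div_cancel_right₀ this]

lemma lam_digits {k : ℕ} (hk : 3 ≤ k) (n : ℕ) {w : Seq} (hw0 : w 0 = k - 1) :
    (∀ i, 1 ≤ i → i ≤ n → lamSub k n w i = 0) ∧ lamSub k n w (n+1) ≠ 0 := by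
  have hne : ∀ i, (fun r => lamWord k n (w r)) i ≠ [] := fun i => lamWord_ne _ _ _
  have hl : (lamWord k n (w 0)).length = n + 1 := by rw [hw0, lw_len_last hk]
  constructor
  · intro i h1 h2
    have := cc_spec hne 0 i (by simp only [hl]; omega)
    rw [cl_zero, zero_add, ← lamSub_eq] at this
    rw [this, lamWord_cw, cw_pos _ _ _ h1]
  · have := cc_head hne 1
    rw [cl_succ, cl_zero, zero_add, hl, ← lamSub_eq] at this
    rw [this, lamWord_cw, cw_zero]
    exact (lx_pos hk _).ne'

/-- (T) -/
lemma DF_T {k : ℕ} (hk : 3 ≤ k) (n : ℕ) {w : Seq} (hw0 : w 0 = k - 1)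
    {α : E k} (hα : α ∈ simplex k) (h : ((n:ℝ)+1) * proj α (k-1) ≤ proj α 0) :
    α ∈ DFw k (lamSub k n w) := by
  set c := proj α (k-1) with hc
  have h0 := proj_nonneg hα
  have hsum := (simplex_iff.1 hα).2
  rw [sum_split_ends hk] at hsum
  set R := ∑ i ∈ Finset.range (k-2), proj α (i+1) with hR
  have hR0 : 0 ≤ R := Finset.sum_nonneg fun i _ => h0 _
  set Z : ℝ := 1 - (n+1) * c with hZ
  have hc0 : 0 ≤ c := h0 _
  have hZ0 : 0 < Z := by
    have : 0 ≤ (n:ℝ) * c := by positivity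
    by_contra hcon
    have h2 : c = 0 := by nlinarith
    rw [h2] at hZ
    simp at hZ; linarith
  let y : ℕ → ℝ := fun i => if i = 0 then (proj α 0 - (n+1) * c) / Z else proj α i / Z
  have hysum : ∑ i ∈ Finset.range k, y i = 1 := by
    rw [sum_split_ends hk]
    simp only [y, if_true, if_neg (show ¬ k - 1 = 0 by omega)]
    rw [Finset.sum_congr rfl (g := fun i => proj α (i+1) / Z) (fun i _ => by
      rw [if_neg (by omega)]), ← Finset.sum_div, ← hR, ← hc, ← add_div, ← add_div,
      div_eq_one_iff_eq hZ0.ne']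
    rw [hZ]; linarith
  obtain ⟨u, hu, hfu⟩ := exists_freq hk y (fun i _ => by
    simp only [y]; split_ifs
    · apply div_nonneg _ hZ0.le; linarith
    · exact div_nonneg (h0 _) hZ0.le) hysum
  let W : ℕ → List ℕ := fun i => cw i (if i = k-1 then n+1 else 0)
  have hW : ∀ i, W i ≠ [] := fun i => cw_ne _ _
  rw [mem_DFw]
  refine ⟨cc fun l => W (u l), ⟨fun t => ?_, fun t => ?_⟩, fun b hb => ?_⟩
  · obtain ⟨j, s, h1, rfl⟩ := exists_block (r := fun l => W (u l)) (fun i => hW _) t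
    rw [cc_spec (fun i => hW _) j s h1]
    rcases s with _ | s
    · simp only [W]; rw [cw_zero]; exact hu _
    · simp only [W]; rw [cw_succ]; omega
  · have hWs : ∀ i s, (W i).getD (s+1) 0 = 0 := fun i s => cw_succ _ _ _
    have hW0 : ∀ i, (W i).getD 0 0 = i := fun i => cw_zero _ _
    have hl1 := lam_digits hk n hw0
    obtain ⟨j, s, h1, rfl⟩ := exists_block (r := fun l => W (u l)) (fun i => hW _) t
    rcases s with _ | s
    · by_cases huj : u j = k - 1
      · left
        have hlen : (W (u j)).length = n + 2 := by simp only [W, huj, if_true, cw_length]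
        have e : ∀ i, 1 ≤ i → i ≤ n + 1 →
            (shift^[cl (fun l => W (u l)) j + 0] (cc fun l => W (u l))) i = 0 := by
          intro i hi1 hi2
          obtain ⟨i, rfl⟩ : ∃ i', i = i' + 1 := ⟨i - 1, by omega⟩
          rw [shift_iter, add_zero, add_comm, cc_spec (fun i => hW _) j (i+1) (by omega), hWs]
        refine ⟨n+1, fun i hi => ?_, ?_⟩
        · rcases Nat.eq_zero_or_pos i with rfl | hi0
          · rw [shift_iter, zero_add, cc_spec (fun i => hW _) j 0 h1, hW0, huj, lam_head hk n hw0]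
          · rw [e i hi0 (by omega), hl1.1 i hi0 (by omega)]
        · rw [e (n+1) (by omega) le_rfl]; have := hl1.2; omega
      · apply seqLe_of_head_lt
        rw [shift_iter, zero_add, cc_spec (fun i => hW _) j 0 h1, hW0, lam_head hk n hw0]
        have := hu j; omega
    · apply seqLe_of_head_lt
      rw [shift_iter, zero_add, cc_spec (fun i => hW _) j (s+1) h1, hWs, lam_head hk n hw0]
      omega
  · have h1 := freq_subst hu y hfu hysum W hW b
    have hden : ∑ i ∈ Finset.range k, y i * (W i).length = 1 / Z := by
      have : ∀ i, y i * (W i).length = y i + if i = k-1 then y i * (n+1) else 0 := by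
        intro i; simp only [W, cw_length]; split_ifs <;> push_cast <;> ring
      simp only [this, Finset.sum_add_distrib, hysum]
      rw [Finset.sum_ite_eq' , if_pos (Finset.mem_range.2 (by omega))]
      simp only [y, if_neg (show ¬ k - 1 = 0 by omega), ← hc]
      field_simp; rw [hZ]; ring
    rw [hden] at h1
    convert h1 using 2
    have hcnt : ∀ i, ((W i).count b : ℝ) = (if i = b then 1 else 0) +
        if i = k-1 then (if b = 0 then (n:ℝ)+1 else 0) else 0 := by
      intro i; simp only [W, cw, List.count_cons, List.count_replicate]
      rcases Nat.eq_zero_or_pos b with rfl | hb0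
      · by_cases hi : i = k - 1 <;> simp [hi]
        ring
      · rw [if_neg (by simp; omega)]
        simp [hb0.ne']
    simp only [hcnt, mul_add, Finset.sum_add_distrib, mul_ite, mul_one, mul_zero]
    rw [Finset.sum_ite_eq', if_pos (Finset.mem_range.2 hb), Finset.sum_ite_eq',
      if_pos (Finset.mem_range.2 (by omega))]
    simp only [y, if_neg (show ¬ k - 1 = 0 by omega), ← hc]
    rcases Nat.eq_zero_or_pos b with rfl | hb0
    · simp only [if_true]; field_simp; ring
    · rw [if_neg hb0.ne', if_neg hb0.ne']; field_simp; ring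

/-! ### Desubstitution -/

lemma block_decomp {v : Seq} (hv0 : v 0 ≠ 0) (hinf : ∀ t, ∃ s, t < s ∧ v s ≠ 0) :
    ∃ x z : ℕ → ℕ, (∀ j, x j ≠ 0) ∧ v = cc fun j => cw (x j) (z j) := by
  have hmin : ∀ t, ∃ s, t < s ∧ v s ≠ 0 ∧ ∀ s', t < s' → s' < s → v s' = 0 := by
    intro t
    refine ⟨Nat.find (hinf t), (Nat.find_spec (hinf t)).1, (Nat.find_spec (hinf t)).2, ?_⟩
    intro s' h1 h2
    by_contra hc
    exact Nat.find_min (hinf t) h2 ⟨h1, hc⟩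
  choose nx h1 h2 h3 using hmin
  let P : ℕ → ℕ := fun j => nx^[j] 0
  have hP : ∀ j, P (j+1) = nx (P j) := fun j => Function.iterate_succ_apply' nx j 0
  have hPn : ∀ j, v (P j) ≠ 0 := by
    intro j
    cases j with
    | zero => exact hv0
    | succ j => rw [hP]; exact h2 _
  refine ⟨fun j => v (P j), fun j => P (j+1) - P j - 1, hPn, ?_⟩
  have hcl : ∀ j, cl (fun j => cw (v (P j)) (P (j+1) - P j - 1)) j = P j := by
    intro j
    induction j with
    | zero => rfl
    | succ j ih =>
      rw [cl_succ, ih, cw_length]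
      have := h1 (P j)
      rw [← hP] at this; omega
  refine cc_unique (fun i => cw_ne _ _) fun j s hs => ?_
  rw [hcl]
  simp only [cw_length] at hs
  rcases s with _ | s
  · rw [cw_zero]; rfl
  · rw [cw_succ]
    apply h3 (P j) _ (by omega)
    rw [← hP]; omega

lemma freq_shift {k : ℕ} {v : Seq} {α : E k} (h : HasDigitFreq k v α) (s : ℕ) :
    HasDigitFreq k (shift^[s] v) α := by
  intro i hi
  have h1 : Tendsto (fun t : ℕ => (digitCount v i (t + s) : ℝ) / ((t + s : ℕ) : ℝ)) atTop
      (𝓝 (proj α i)) := (h i hi).comp (tendsto_add_atTop_nat s)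
  have h2 : Tendsto (fun t : ℕ => (((t + s : ℕ) : ℝ)) / (t : ℝ)) atTop (𝓝 1) := by
    have := (tendsto_const_div_atTop_nhds_zero_nat (s:ℝ)).const_add 1
    rw [add_zero] at this
    refine this.congr' ?_
    filter_upwards [eventually_gt_atTop 0] with t ht
    have : (t:ℝ) ≠ 0 := by exact_mod_cast ht.ne'
    push_cast; field_simp
  have h3 := (h1.mul h2).sub (tendsto_const_div_atTop_nhds_zero_nat (digitCount v i s : ℝ))
  rw [mul_one, sub_zero] at h3
  refine h3.congr' ?_
  filter_upwards [eventually_gt_atTop 0] with t ht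
  have : (t:ℝ) ≠ 0 := by exact_mod_cast ht.ne'
  have : ((t + s : ℕ):ℝ) ≠ 0 := by exact_mod_cast (by omega)
  have e := dc_add v i s t
  rw [add_comm s t] at e
  rw [e]
  push_cast at *
  field_simp
  ring

lemma R_core {k : ℕ} (hk : 3 ≤ k) (n : ℕ) {w : Seq} (hw : InSigma k w)
    (hw0 : w 0 = k - 1) (x z : ℕ → ℕ) (hx : ∀ j, x j ≠ 0) {α : E k}
    (hX : (cc fun j => cw (x j) (z j)) ∈ Xset k (lamSub k n w))
    (hα : HasDigitFreq k (cc fun j => cw (x j) (z j)) α)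
    (h : proj α 0 < ((n:ℝ)+1) * proj α (k-1)) : Kmap n α ∈ DFw k w := by
  set r : ℕ → List ℕ := fun j => cw (x j) (z j) with hr
  have hne : ∀ i, r i ≠ [] := fun i => cw_ne _ _
  set v := cc r with hv
  set P := cl r with hP
  have hPs : ∀ j, P (j+1) = P j + (z j + 1) := fun j => by
    rw [hP, cl_succ]; simp only [hr, cw_length]
  have hPm : StrictMono P := cl_strictMono hne
  have hPt : Tendsto P atTop atTop := hPm.tendsto_atTop
  have hvP : ∀ j, v (P j) = x j := fun j => by rw [hv, cc_head hne]; exact cw_zero _ _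
  have hxk : ∀ j, x j < k := fun j => by rw [← hvP]; exact hX.1 _
  have hαs := freq_simplex hX.1 hα
  have h0 := proj_nonneg hαs
  have hα0 : proj α 0 < 1 := by
    have hs := (simplex_iff.1 hαs).2
    rw [sum_split_ends hk] at hs
    have : 0 ≤ ∑ i ∈ Finset.range (k-2), proj α (i+1) := Finset.sum_nonneg fun i _ => h0 _
    by_contra hc
    have h2 : proj α (k-1) ≤ 0 := by linarith
    have : ((n:ℝ)+1) * proj α (k-1) ≤ 0 := mul_nonpos_of_nonneg_of_nonpos (by positivity) h2
    linarith
  -- each `k-1` is followed by at least `n` zeros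
  have hz : ∀ j, x j = k - 1 → n ≤ z j := by
    intro j hj
    by_contra hc
    push Not at hc
    have h1 := seqLe_iff.1 (hX.2 (P j)) (z j + 1) ?_
    · rw [shift_iter, add_comm, ← hPs, hvP, (lam_digits hk n hw0).1 _ (by omega) (by omega)] at h1
      exact hx _ (Nat.le_zero.1 h1)
    · intro i hi
      rw [shift_iter, add_comm]
      rcases Nat.eq_zero_or_pos i with rfl | hi0
      · rw [add_zero, hvP, hj, lam_head hk n hw0]
      · rw [(lam_digits hk n hw0).1 i hi0 (by omega), hv, hP, cc_spec hne j i (by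
          simp only [hr, cw_length]; omega)]
        exact cw_pos _ _ _ hi0
  -- counts
  let a : ℕ → ℤ := fun j => if x j = k - 1 then 1 else 0
  let D : ℕ → ℤ := fun j => ∑ i ∈ Finset.range j, ((n+1) * a i - z i)
  have hDs : ∀ j, D (j+1) = D j + ((n+1) * a j - z j) := fun j => Finset.sum_range_succ _ _
  have hdc : ∀ b j, digitCount v b (P j) = ∑ i ∈ Finset.range j,
      ((if b = x i then 1 else 0) + (if b = 0 then z i else 0)) := by
    intro b j
    rw [hv, hP, dc_cc hne]
    exact Finset.sum_congr rfl fun i _ => cw_count _ _ _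
  have hdcpos : ∀ b, b ≠ 0 → ∀ j, digitCount v b (P j) = ∑ i ∈ Finset.range j,
      (if b = x i then 1 else 0) := by
    intro b hb j
    rw [hdc]; exact Finset.sum_congr rfl fun i _ => by rw [if_neg hb, add_zero]
  have hdc0 : ∀ j, digitCount v 0 (P j) = ∑ i ∈ Finset.range j, z i := by
    intro j
    rw [hdc]; exact Finset.sum_congr rfl fun i _ => by
      rw [if_neg (Ne.symm (hx i)), if_pos rfl, zero_add]
  have hA : ∀ j, ((digitCount v (k-1) (P j) : ℕ) : ℤ) = ∑ i ∈ Finset.range j, a i := by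
    intro j
    rw [hdcpos _ (by omega)]; push_cast
    exact Finset.sum_congr rfl fun i _ => by simp only [a, eq_comm]
  have hDD : ∀ j, D j = (n+1) * (digitCount v (k-1) (P j) : ℤ) - (digitCount v 0 (P j) : ℤ) := by
    intro j
    rw [hA, hdc0]; simp only [D, Finset.sum_sub_distrib, Finset.mul_sum]; push_cast; rfl
  have hPj : ∀ j, P j = j + digitCount v 0 (P j) := by
    intro j
    rw [hdc0]
    induction j with
    | zero => rfl
    | succ j ih => rw [hPs, Finset.sum_range_succ]; omega
  set γ := ((n:ℝ)+1) * proj α (k-1) - proj α 0 with hγ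
  have hγ0 : 0 < γ := by rw [hγ]; linarith
  have hfP : ∀ b, b < k → Tendsto (fun j => (digitCount v b (P j) : ℝ) / (P j : ℝ)) atTop
      (𝓝 (proj α b)) := fun b hb => (hα b hb).comp hPt
  have hDP : Tendsto (fun j => (D j : ℝ) / (P j : ℝ)) atTop (𝓝 γ) := by
    have := ((hfP (k-1) (by omega)).const_mul ((n:ℝ)+1)).sub (hfP 0 (by omega))
    refine this.congr fun j => ?_
    rw [hDD]; push_cast; ring
  have hPR : Tendsto (fun j => (P j : ℝ)) atTop atTop := tendsto_natCast_atTop_atTop.comp hPt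
  have hPne : ∀ᶠ j in atTop, 0 < (P j : ℝ) := hPR.eventually_gt_atTop 0
  have hDtop : Tendsto D atTop atTop := by
    have h1 : Tendsto (fun j => (D j : ℝ)) atTop atTop := by
      refine (hDP.pos_mul_atTop hγ0 hPR).congr' ?_
      filter_upwards [hPne] with j hj
      field_simp
    exact tendsto_intCast_atTop_iff.1 h1
  have hmin : ∀ N, ∃ m, N ≤ m ∧ ∀ l, N ≤ l → D m ≤ D l := by
    intro N
    have : Tendsto (fun l => D (N + l)) atTop atTop :=
      hDtop.comp (tendsto_atTop_mono (fun l => Nat.le_add_left l N) tendsto_id)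
    have h2 : Tendsto (fun l => D (N + l)) cofinite atTop := by
      rw [Nat.cofinite_eq_atTop]; exact this
    obtain ⟨l, hl⟩ := h2.exists_forall_le
    refine ⟨N + l, by omega, fun l' hl' => ?_⟩
    obtain ⟨q, rfl⟩ := Nat.exists_eq_add_of_le hl'
    exact hl q
  choose m hm1 hm2 using hmin
  let I : ℕ → ℤ := fun N => D (m N)
  have hID : ∀ N l, N ≤ l → I N ≤ D l := hm2
  let U : ℕ → Prop := fun N => ∀ l, N < l → D N < D l
  have hIU : ∀ N, U N → I N = D N := by
    intro N hU
    rcases eq_or_lt_of_le (hm1 N) with h1 | h1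
    · simp only [I]; rw [← h1]
    · have := hU _ h1
      have := hID N N le_rfl
      simp only [I] at *; omega
  have hDstep : ∀ N, D (N+1) ≤ D N + a N := by
    intro N
    rw [hDs]
    have : (n:ℤ) * a N ≤ z N := by
      simp only [a]; split_ifs with hxN
      · have := hz N hxN; simp; exact this
      · simp
    linarith
  have ha01 : ∀ N, 0 ≤ a N ∧ a N ≤ 1 := fun N => by simp only [a]; split_ifs <;> simp
  have hUa : ∀ N, U N → x N = k - 1 := by
    intro N hU
    have h1 := hU (N+1) (by omega)
    have h2 := hDstep N
    by_contra hc
    have : a N = 0 := by simp only [a]; rw [if_neg hc]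
    omega
  have hIs : ∀ N, I (N+1) = I N + if U N then 1 else 0 := by
    intro N
    by_cases hU : U N
    · rw [if_pos hU, hIU N hU]
      have h1 := hU (m (N+1)) (by have := hm1 (N+1); omega)
      have h2 := hID (N+1) (N+1) le_rfl
      have := hDstep N; have := (ha01 N).2
      simp only [I] at *; omega
    · rw [if_neg hU, add_zero]
      simp only [U] at hU
      push Not at hU
      obtain ⟨l, hl1, hl2⟩ := hU
      apply le_antisymm
      · rcases eq_or_lt_of_le (hm1 N) with h1 | h1
        · have : I N = D N := by simp only [I]; rw [← h1]
          rw [this]; exact (hID (N+1) l hl1).trans hl2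
        · exact hID (N+1) (m N) h1
      · exact hID N (m (N+1)) (by have := hm1 (N+1); omega)
  let u : Seq := fun j => if x j < k - 1 then x j - 1 else if U j then k - 1 else k - 2
  have huU : ∀ j, u j = k - 1 ↔ U j := by
    intro j
    have := hxk j
    simp only [u]
    constructor
    · intro h1; by_contra hc; rw [if_neg hc] at h1
      split_ifs at h1 <;> omega
    · intro h1; rw [if_neg (by have := hUa j h1; omega), if_pos h1]
  have hus : InSigma k u := fun j => by
    simp only [u]; have := hxk j; split_ifs <;> omega
  have hux : ∀ j, lx k (u j) = x j := by
    intro j; have := hxk j; have := hx j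
    simp only [u, lx]; split_ifs <;> omega
  have huz : ∀ j, (lz k n (u j) : ℤ) = (n+1) * a j - (I (j+1) - I j) := by
    intro j; have := hxk j; have := hx j
    rw [hIs]
    by_cases hU : U j
    · rw [(huU j).2 hU, if_pos hU]
      have : a j = 1 := by simp only [a]; rw [if_pos (hUa j hU)]
      rw [this]
      unfold lz; rw [if_neg (by omega), if_neg (by omega)]; ring
    · rw [if_neg hU]
      by_cases hxj : x j = k - 1
      · have h1 : a j = 1 := by simp only [a]; rw [if_pos hxj]
        have h2 : u j = k - 2 := by simp only [u]; rw [if_neg (by omega), if_neg hU]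
        rw [h1, h2]; unfold lz; rw [if_neg (by omega), if_pos (by omega)]; push_cast; ring
      · have h1 : a j = 0 := by simp only [a]; rw [if_neg hxj]
        have h2 : u j = x j - 1 := by simp only [u]; rw [if_pos (by omega)]
        rw [h1, h2]; unfold lz; rw [if_pos (by omega)]; push_cast; ring
  rw [mem_DFw]
  refine ⟨u, ⟨hus, fun j => ?_⟩, ?_⟩
  · by_cases hU : U j
    swap
    · apply seqLe_of_head_lt
      rw [shift_iter, zero_add, hw0]
      have h1 := hus j
      have h2 : u j ≠ k - 1 := fun hc => hU ((huU j).1 hc)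
      omega
    · apply lam_le_rev hk (sigma_shift hus j)
      refine seqLe_trans ?_ (hX.2 (P j))
      rw [hv, hP, cc_shift hne, lamSub_cw]
      simp only [hr, shift_iter, hux]
      by_cases hall : ∀ i, lz k n (u (i + j)) = z (i + j)
      · right; simp only [hall]; simp only [add_comm]
      · push Not at hall
        have hl1 := Nat.find_spec hall
        have hl2 : ∀ i, i < Nat.find hall → lz k n (u (i + j)) = z (i + j) := fun i hi => by
          by_contra hc; exact Nat.find_min hall hi hc
        set l := Nat.find hall
        left
        have key : ∀ q, (∀ i, i < q → lz k n (u (i + j)) = z (i + j)) →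
            D (q + j) - D j = I (q + j) - I j := by
          intro q
          induction q with
          | zero => intro _; simp
          | succ q ih =>
            intro hq
            have e1 := ih fun i hi => hq i (by omega)
            have e2 := hDs (q + j)
            have e3 := huz (q + j)
            rw [hq q (by omega)] at e3
            rw [show q + 1 + j = q + j + 1 by omega]
            omega
        have e1 := key l hl2
        have e2 := hIU j hU
        have e3 := hID (l + j + 1) (l + j + 1) le_rfl
        have e4 := hDs (l + j)
        have e5 := huz (l + j)
        refine cc_lt (l := l) (fun i => Nat.pos_of_ne_zero (hx _)) (fun i hi => ?_) (Or.inr ?_)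
        · rw [hl2 i hi]; simp only [add_comm, and_self]
        · refine ⟨by simp only [add_comm], ?_⟩
          rw [add_comm j l]
          have : (z (l + j) : ℤ) ≤ lz k n (u (l + j)) := by omega
          omega
  · have hjP : Tendsto (fun j : ℕ => (j:ℝ) / (P j : ℝ)) atTop (𝓝 (1 - proj α 0)) := by
      have := (hfP 0 (by omega)).const_sub 1
      refine this.congr' ?_
      filter_upwards [hPne] with j hj
      have e : (P j : ℝ) = j + digitCount v 0 (P j) := by exact_mod_cast hPj j
      rw [eq_div_iff hj.ne', sub_mul, div_mul_cancel₀ _ hj.ne']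
      linarith
    have hconv : ∀ (f : ℕ → ℝ) (b : ℝ), Tendsto (fun j => f j / (P j : ℝ)) atTop (𝓝 b) →
        Tendsto (fun j : ℕ => f j / (j:ℝ)) atTop (𝓝 (b / (1 - proj α 0))) := by
      intro f b hf
      refine (hf.div hjP (by linarith)).congr' ?_
      filter_upwards [hPne] with j hj
      simp only [Pi.div_apply]
      rw [div_div_div_cancel_right₀ hj.ne']
    have hmt : Tendsto m atTop atTop := tendsto_atTop_mono hm1 tendsto_id
    have hIP : Tendsto (fun j => (I j : ℝ) / (P j : ℝ)) atTop (𝓝 γ) := by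
      refine tendsto_of_tendsto_of_tendsto_of_le_of_le' (hDP.comp hmt) hDP ?_ ?_
      · filter_upwards [hPne, (hDtop.comp hmt).eventually_ge_atTop 0] with j hj hj2
        simp only [Function.comp_apply, I] at *
        have h1 : (P j : ℝ) ≤ P (m j) := by exact_mod_cast hPm.monotone (hm1 j)
        have h2 : (0:ℝ) ≤ D (m j) := by exact_mod_cast hj2
        exact div_le_div_of_nonneg_left h2 hj h1
      · filter_upwards [hPne] with j hj
        have : (I j : ℝ) ≤ D j := by exact_mod_cast hID j j le_rfl
        gcongr
    have hcl : ∀ j, ((digitCount u (k-1) j : ℕ) : ℤ) = I j - I 0 := by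
      intro j
      induction j with
      | zero => simp [dc_zero]
      | succ j ih =>
        rw [dc_succ, hIs]; push_cast; rw [ih]
        simp only [huU]; ring
    have hcp : ∀ j, ((digitCount u (k-2) j : ℕ) : ℤ) + (digitCount u (k-1) j : ℕ)
        = (digitCount v (k-1) (P j) : ℕ) := by
      intro j
      rw [hA]
      induction j with
      | zero => simp [dc_zero]
      | succ j ih =>
        rw [dc_succ, dc_succ, Finset.sum_range_succ, ← ih]
        have : ((if u j = k - 2 then 1 else 0 : ℕ) : ℤ) + ((if u j = k - 1 then 1 else 0 : ℕ) : ℤ)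
            = a j := by
          have := hxk j; have := hx j
          simp only [u, a]
          split_ifs <;> first | omega | simp
        push_cast at *; linarith
    have hlast : Tendsto (fun j => (digitCount u (k-1) j : ℝ) / (P j : ℝ)) atTop (𝓝 γ) := by
      have := hIP.sub (Tendsto.const_div_atTop hPR (I 0 : ℝ))
      rw [sub_zero] at this
      refine this.congr fun j => ?_
      rw [← sub_div]; congr 1
      have := hcl j
      have h2 : (((digitCount u (k-1) j : ℕ) : ℤ) : ℝ) = ((I j - I 0 : ℤ) : ℝ) := by rw [this]
      push_cast at h2; linarith
    intro b hb
    rcases idx_cases2 hb with hb2 | rfl | rfl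
    · rw [Kmap_mid n α hb2]
      apply hconv
      refine (hfP (b+1) (by omega)).congr fun j => ?_
      congr 2
      rw [hdcpos _ (by omega)]
      induction j with
      | zero => simp [dc_zero]
      | succ j ih =>
        rw [dc_succ, Finset.sum_range_succ, ih]
        congr 1
        have := hxk j; have := hx j
        simp only [u]
        split_ifs <;> omega
    · rw [Kmap_pen hk]
      have e : proj α 0 - n * proj α (k-1) = proj α (k-1) - γ := by rw [hγ]; ring
      rw [e]
      apply hconv
      refine ((hfP (k-1) (by omega)).sub hlast).congr fun j => ?_
      rw [← sub_div]; congr 1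
      have h2 : (((digitCount u (k-2) j : ℕ) : ℤ) + (digitCount u (k-1) j : ℕ) : ℝ)
        = (digitCount v (k-1) (P j) : ℕ) := by exact_mod_cast hcp j
      push_cast at h2; linarith
    · rw [Kmap_last hk]
      exact hconv _ _ hlast

/-- (R) -/
lemma DF_R {k : ℕ} (hk : 3 ≤ k) (n : ℕ) {w : Seq} (hw : InSigma k w)
    (hw0 : w 0 = k - 1) {α : E k} (hα : α ∈ DFw k (lamSub k n w))
    (h : proj α 0 < ((n:ℝ)+1) * proj α (k-1)) : Kmap n α ∈ DFw k w := by
  rw [mem_DFw] at hα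
  obtain ⟨v, hX, hf⟩ := hα
  have hpos : 0 < proj α (k-1) := by
    have := proj_nonneg (freq_simplex hX.1 hf) 0
    by_contra hc
    have : ((n:ℝ)+1) * proj α (k-1) ≤ 0 :=
      mul_nonpos_of_nonneg_of_nonpos (by positivity) (not_lt.1 hc)
    linarith
  have hinf : ∀ t, ∃ s, t < s ∧ v s ≠ 0 := by
    intro t
    by_contra hc
    push Not at hc
    have hb : ∀ s, digitCount v (k-1) s ≤ t + 1 := by
      intro s
      induction s with
      | zero => simp [dc_zero]
      | succ s ih =>
        by_cases hs : t < s
        · rw [dc_succ, hc s hs, if_neg (by omega)]; omega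
        · have := dc_le v (k-1) (s+1); omega
    have h0 : Tendsto (fun s : ℕ => (digitCount v (k-1) s : ℝ) / (s:ℝ)) atTop (𝓝 0) := by
      refine squeeze_zero (fun s => by positivity) (fun s => ?_)
        (tendsto_const_div_atTop_nhds_zero_nat ((t:ℝ)+1))
      gcongr
      exact_mod_cast hb s
    have := tendsto_nhds_unique h0 (hf (k-1) (by omega))
    linarith
  obtain ⟨s0, _, hs0⟩ := hinf 0
  obtain ⟨x, z, hx, hv⟩ := block_decomp (v := shift^[s0] v) (by rw [shift_iter, zero_add]; exact hs0)
    (fun t => by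
      obtain ⟨s, h1, h2⟩ := hinf (t + s0)
      refine ⟨s - s0, by omega, ?_⟩
      rw [shift_iter, show s - s0 + s0 = s by omega]; exact h2)
  refine R_core hk n hw hw0 x z hx (α := α) ?_ ?_ h
  · rw [← hv]
    exact ⟨sigma_shift hX.1 _, fun r => by rw [shift_iter_add]; exact hX.2 _⟩
  · rw [← hv]; exact freq_shift hf s0

/-! ### Specification, closedness and continuity -/

def NoZ (M : ℕ) (w : Seq) : Prop := ∀ t, ∃ s, s < M ∧ w (t + s) ≠ 0

def Adm (k : ℕ) (w : Seq) (l : List ℕ) : Prop := (∀ s, s < l.length → l.getD s 0 < k) ∧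
  ∀ s q, s + q < l.length → (∀ i, i < q → l.getD (s + i) 0 = w i) → l.getD (s + q) 0 ≤ w q

lemma spec_X {k : ℕ} (hk : 3 ≤ k) {w : Seq} (hw0 : w 0 = k - 1) {M : ℕ} (hM : NoZ M w)
    {l : ℕ → List ℕ} (hl : ∀ i, Adm k w (l i)) :
    (cc fun i => l i ++ List.replicate M 0) ∈ Xset k w := by
  have hM0 : 0 < M := by obtain ⟨s, hs, _⟩ := hM 0; omega
  set r := fun i => l i ++ List.replicate M 0 with hr
  have hne : ∀ i, r i ≠ [] := fun i => by simp [hr]; omega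
  have hlen : ∀ i, (r i).length = (l i).length + M := fun i => by simp [hr]
  have hg1 : ∀ j s, s < (l j).length → cc r (cl r j + s) = (l j).getD s 0 := by
    intro j s hs
    rw [cc_spec hne j s (by rw [hlen]; omega)]
    simp only [hr]; rw [List.getD_append _ _ _ _ hs]
  have hg2 : ∀ j s, (l j).length ≤ s → s < (l j).length + M → cc r (cl r j + s) = 0 := by
    intro j s hs hs2
    rw [cc_spec hne j s (by rw [hlen]; omega)]
    simp only [hr]; rw [List.getD_append_right _ _ _ _ hs, List.getD_replicate]
    omega
  constructor
  · intro t
    obtain ⟨j, s, h1, rfl⟩ := exists_block hne t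
    rw [hlen] at h1
    by_cases hs : s < (l j).length
    · rw [hg1 j s hs]; exact (hl j).1 s hs
    · rw [hg2 j s (by omega) h1]; omega
  · intro t
    rw [seqLe_iff]
    intro q hq
    obtain ⟨j, s, h1, rfl⟩ := exists_block hne t
    rw [hlen] at h1
    have hq' : ∀ i, i < q → cc r (cl r j + (s + i)) = w i := fun i hi => by
      rw [← hq i hi, shift_iter]; congr 1; omega
    rw [shift_iter, show q + (cl r j + s) = cl r j + (s + q) by omega]
    by_cases hs : s < (l j).length
    · by_cases h2 : s + q < (l j).length
      · rw [hg1 j _ h2]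
        refine (hl j).2 s q h2 fun i hi => ?_
        rw [← hg1 j _ (by omega), hq' i hi]
      · by_cases h3 : s + q < (l j).length + M
        · rw [hg2 j _ (by omega) h3]; omega
        · exfalso
          obtain ⟨i, hi, hi2⟩ := hM ((l j).length - s)
          apply hi2
          rw [← hq' _ (by omega)]
          exact hg2 j _ (by omega) (by omega)
    · rcases Nat.eq_zero_or_pos q with rfl | hq0
      · rw [add_zero, hg2 j s (by omega) h1]; omega
      · exfalso
        have := hq' 0 hq0
        rw [add_zero, hg2 j s (by omega) h1, hw0] at this
        omega

def chunk (v : Seq) (c L : ℕ) : List ℕ := (List.range L).map fun i => v (c + i)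

lemma chunk_len (v : Seq) (c L : ℕ) : (chunk v c L).length = L := by simp [chunk]
lemma chunk_get (v : Seq) (c : ℕ) {L s : ℕ} (hs : s < L) : (chunk v c L).getD s 0 = v (c + s) := by
  simp [chunk, hs]
lemma chunk_count (v : Seq) (c L b : ℕ) :
    (chunk v c L).count b = digitCount (shift^[c] v) b L := by
  rw [← dc_list (chunk v c L) (shift^[c] v) b, chunk_len]
  intro s hs
  rw [chunk_len] at hs
  rw [chunk_get v c hs, shift_iter, add_comm]

lemma chunk_adm {k : ℕ} {w w' : Seq} {L : ℕ} (hww : ∀ i, i < L → w i = w' i) {v : Seq}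
    (hv : v ∈ Xset k w') (c : ℕ) : Adm k w (chunk v c L) := by
  constructor
  · intro s hs; rw [chunk_len] at hs; rw [chunk_get v c hs]; exact hv.1 _
  · intro s q hsq hq
    rw [chunk_len] at hsq
    rw [chunk_get v c hsq, hww q (by omega)]
    have := seqLe_iff.1 (hv.2 (c + s)) q ?_
    · rw [shift_iter] at this; convert this using 2; omega
    · intro i hi
      rw [shift_iter, ← hww i (by omega), ← hq i hi, chunk_get v c (by omega)]; congr 1; omega

lemma evec_proj (k i : ℕ) {j : ℕ} (hj : j < k) : proj (evec k i) j = if j = i then 1 else 0 := by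
  unfold evec; rw [proj_mk _ hj]

lemma simplex_norm {k : ℕ} {α : E k} (h : α ∈ simplex k) : ‖α‖ ≤ 1 := by
  rw [EuclideanSpace.norm_eq, Real.sqrt_le_one]
  rw [← h.2]
  refine Finset.sum_le_sum fun i _ => ?_
  have h1 : α i ≤ 1 := by
    rw [← h.2]; exact Finset.single_le_sum (fun i _ => h.1 i) (Finset.mem_univ i)
  rw [Real.norm_eq_abs, sq_abs]
  nlinarith [h.1 i]

lemma evec_simplex {k i : ℕ} (hi : i < k) : evec k i ∈ simplex k := by
  rw [simplex_iff]
  constructor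
  · intro j hj; rw [evec_proj k i hj]; split_ifs <;> norm_num
  · rw [Finset.sum_congr rfl (fun j hj => evec_proj k i (Finset.mem_range.1 hj))]
    simp [hi]

lemma proj_add {k : ℕ} (α β : E k) (i : ℕ) : proj (α + β) i = proj α i + proj β i := by
  unfold proj; split_ifs <;> simp
lemma proj_sub {k : ℕ} (α β : E k) (i : ℕ) : proj (α - β) i = proj α i - proj β i := by
  unfold proj; split_ifs <;> simp
lemma proj_smul {k : ℕ} (c : ℝ) (α : E k) (i : ℕ) : proj (c • α) i = c * proj α i := by
  unfold proj; split_ifs <;> simp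
lemma proj_abs_le {k : ℕ} (α : E k) (i : ℕ) : |proj α i| ≤ ‖α‖ := by
  unfold proj; split_ifs
  · rw [← Real.norm_eq_abs]; exact PiLp.norm_apply_le α _
  · simp

lemma lemC {k : ℕ} (hk : 3 ≤ k) {w w' : Seq} (hw0 : w 0 = k - 1) {M L : ℕ} (hM : NoZ M w)
    (hL : 0 < L) (hww : ∀ i, i < L → w i = w' i) {α : E k} (hα : α ∈ DFw k w') :
    ∃ β ∈ DFw k w, dist α β ≤ 2 * M / L := by
  obtain ⟨hαs, v, hv, hf⟩ := hα
  have hLM : (0:ℝ) < (L:ℝ) + M := by positivity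
  have hL' : (0:ℝ) < L := by exact_mod_cast hL
  set β : E k := ((L:ℝ) + M)⁻¹ • ((L:ℝ) • α + (M:ℝ) • evec k 0) with hβ
  refine ⟨β, mem_DFw.2 ⟨_, spec_X hk hw0 hM (l := fun j => chunk v (j * L) L)
    (fun j => chunk_adm hww hv _), ?_⟩, ?_⟩
  · set r : ℕ → List ℕ := fun j => chunk v (j * L) L ++ List.replicate M 0 with hr
    have hlen : ∀ i, (r i).length = L + M := fun i => by simp [hr, chunk_len]
    have hne : ∀ i, r i ≠ [] := fun i => List.ne_nil_of_length_pos (by rw [hlen]; omega)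
    have hcl : ∀ j, cl r j = j * (L + M) := fun j => by simp [cl, hlen]
    intro b hb
    have hcnt : ∀ j, digitCount (cc r) b (cl r j)
        = digitCount v b (j * L) + j * (if b = 0 then M else 0) := by
      intro j
      rw [dc_cc hne]
      induction j with
      | zero => simp [dc_zero]
      | succ j ih =>
        rw [Finset.sum_range_succ, ih, add_mul j 1 L, dc_add]
        simp only [hr, List.count_append, chunk_count, one_mul]
        have : List.count b (List.replicate M 0) = if b = 0 then M else 0 := by
          rw [List.count_replicate]; simp only [beq_iff_eq]; simp only [eq_comm]
        rw [this]; ring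
    apply freq_cc hne
    · have h1 : Tendsto (fun j : ℕ => (digitCount v b (j * L) : ℝ) / ((j * L : ℕ) : ℝ)) atTop
          (𝓝 (proj α b)) := (hf b hb).comp (tendsto_id.atTop_mul_const' hL)
      have h2 := ((h1.mul_const (L:ℝ)).add_const ((if b = 0 then M else 0 : ℕ):ℝ)).div_const
        ((L:ℝ)+M)
      have e : proj β b = (proj α b * L + ((if b = 0 then M else 0 : ℕ):ℝ)) / ((L:ℝ)+M) := by
        rw [hβ, proj_smul, proj_add, proj_smul, proj_smul, evec_proj k 0 hb, div_eq_inv_mul]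
        congr 1; split_ifs <;> push_cast <;> ring
      rw [e]
      refine h2.congr' ?_
      filter_upwards [eventually_gt_atTop 0] with j hj
      have hj' : (j:ℝ) ≠ 0 := by exact_mod_cast hj.ne'
      rw [hcnt, hcl]; push_cast
      field_simp
    · refine (tendsto_const_div_atTop_nhds_zero_nat (1:ℝ)).congr' ?_
      filter_upwards [eventually_gt_atTop 0] with j hj
      have hj' : (j:ℝ) ≠ 0 := by exact_mod_cast hj.ne'
      rw [hlen, hcl]; push_cast
      field_simp
  · have e : α - β = ((M:ℝ) / ((L:ℝ) + M)) • (α - evec k 0) := by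
      apply proj_ext
      intro i hi
      rw [hβ]
      simp only [proj_sub, proj_smul, proj_add]
      field_simp; ring
    rw [dist_eq_norm, e, norm_smul, Real.norm_of_nonneg (by positivity)]
    have h1 : ‖α - evec k 0‖ ≤ 2 := by
      refine (norm_sub_le _ _).trans ?_
      have := simplex_norm hαs; have := simplex_norm (evec_simplex (show 0 < k by omega))
      linarith
    calc (M:ℝ) / ((L:ℝ) + M) * ‖α - evec k 0‖ ≤ (M:ℝ) / L * 2 := by gcongr; simp
      _ = _ := by ring

lemma DF_closed {k : ℕ} (hk : 3 ≤ k) {w : Seq} (hw0 : w 0 = k - 1) {M : ℕ} (hM : NoZ M w) :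
    IsClosed (DFw k w) := by
  rw [← closure_subset_iff_isClosed]
  intro α hα
  rw [Metric.mem_closure_iff] at hα
  have h1 : ∀ N : ℕ, ∃ v ∈ Xset k w, ∃ T : ℕ, N + 1 ≤ T ∧ ∀ b, b < k →
      |(digitCount v b T : ℝ) / T - proj α b| ≤ 2 / ((N:ℝ)+1) := by
    intro N
    have hN : (0:ℝ) < 1 / ((N:ℝ)+1) := by positivity
    obtain ⟨β, hβ, hd⟩ := hα _ hN
    obtain ⟨_, v, hv, hf⟩ := hβ
    have h2 : ∀ᶠ T : ℕ in atTop, ∀ b ∈ Finset.range k,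
        |(digitCount v b T : ℝ) / T - proj β b| < 1 / ((N:ℝ)+1) := by
      rw [Finset.eventually_all]
      intro b hb
      have := Metric.tendsto_nhds.1 (hf b (Finset.mem_range.1 hb)) _ hN
      simpa only [Real.dist_eq] using this
    obtain ⟨T, hT1, hT2⟩ := (h2.and (eventually_ge_atTop (N+1))).exists
    refine ⟨v, hv, T, hT2, fun b hb => ?_⟩
    have h3 := hT1 b (Finset.mem_range.2 hb)
    have h4 := proj_abs_le (α - β) b
    rw [← dist_eq_norm, proj_sub, abs_sub_comm] at h4
    have h5 := abs_sub_le ((digitCount v b T : ℝ) / T) (proj β b) (proj α b)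
    have : 2 / ((N:ℝ)+1) = 1 / ((N:ℝ)+1) + 1 / ((N:ℝ)+1) := by ring
    linarith
  choose v hv T hT hb using h1
  let p : ℕ → List ℕ := fun N => chunk (v N) 0 (T N) ++ List.replicate M 0
  have hlen : ∀ N, (p N).length = T N + M := fun N => by simp [p, chunk_len]
  obtain ⟨φ, hφ⟩ := freq_conc p fun N =>
    List.ne_nil_of_length_pos (by rw [hlen]; have := hT N; omega)
  rw [mem_DFw]
  refine ⟨_, spec_X hk hw0 hM (l := fun i => chunk (v (φ i)) 0 (T (φ i)))
    (fun j => chunk_adm (fun _ _ => rfl) (hv _) _), fun b hbk => hφ b _ ?_⟩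
  have hTt : Tendsto T atTop atTop :=
    tendsto_atTop_mono (fun N => (Nat.le_succ N).trans (hT N)) tendsto_id
  have hTR : Tendsto (fun N => (T N : ℝ)) atTop atTop := tendsto_natCast_atTop_atTop.comp hTt
  have hlim : Tendsto (fun N => (digitCount (v N) b (T N) : ℝ) / T N) atTop (𝓝 (proj α b)) := by
    rw [tendsto_iff_dist_tendsto_zero]
    have := (tendsto_const_div_atTop_nhds_zero_nat (2:ℝ)).comp (tendsto_add_atTop_nat 1)
    refine squeeze_zero (g := fun N : ℕ => 2 / ((N:ℝ)+1)) (fun _ => dist_nonneg)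
      (fun N => by rw [Real.dist_eq]; exact hb N b hbk) ?_
    refine this.congr fun N => ?_
    simp
  have h2 := (hlim.add (hTR.const_div_atTop ((if b = 0 then M else 0 : ℕ):ℝ))).div
    ((hTR.const_div_atTop (M:ℝ)).const_add 1) (by norm_num)
  rw [add_zero, add_zero, div_one] at h2
  refine h2.congr fun N => ?_
  have hTN : (0:ℝ) < T N := by have := hT N; exact_mod_cast (by omega)
  simp only [Pi.div_apply]
  rw [hlen]
  have : (p N).count b = digitCount (v N) b (T N) + if b = 0 then M else 0 := by
    simp only [p, List.count_append, chunk_count]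
    congr 1
    rw [List.count_replicate]; simp only [beq_iff_eq]; simp only [eq_comm]
  rw [this]; push_cast
  field_simp

lemma lam_NoZ {k : ℕ} (hk : 3 ≤ k) (n : ℕ) (u : Seq) : NoZ (n+2) (lamSub k n u) := by
  intro t
  obtain ⟨s, h1, h2⟩ := lam_nozeros hk n u t
  exact ⟨s, by omega, h2⟩

/-! ### Beta expansions -/

lemma fb_mem (β x : ℝ) : 0 ≤ fbeta β x ∧ fbeta β x < 1 :=
  ⟨Int.fract_nonneg _, Int.fract_lt_one _⟩

lemma fbi_mem {β x : ℝ} (hx : x ∈ Set.Icc (0:ℝ) 1) (r : ℕ) :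
    (fbeta β)^[r] x ∈ Set.Icc (0:ℝ) 1 := by
  cases r with
  | zero => exact hx
  | succ r =>
    rw [Function.iterate_succ_apply']
    exact ⟨(fb_mem _ _).1, (fb_mem _ _).2.le⟩

lemma fb_step {β x : ℝ} (hβ : 0 < β) (hx : 0 ≤ x) : β * x = (⌊β * x⌋₊ : ℝ) + fbeta β x := by
  unfold fbeta
  have := Int.floor_add_fract (β * x)
  rw [natCast_floor_eq_intCast_floor (by positivity)]
  exact this.symm

lemma dbeta_shift (β x : ℝ) (r : ℕ) : shift^[r] (dbeta β x) = dbeta β ((fbeta β)^[r] x) := by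
  funext t
  rw [shift_iter]; unfold dbeta
  rw [← Function.iterate_add_apply]

lemma dbeta_mono {β x y : ℝ} (hβ : 0 < β) (hx : x ∈ Set.Icc (0:ℝ) 1) (hy : y ∈ Set.Icc (0:ℝ) 1)
    (hxy : x ≤ y) : seqLe (dbeta β x) (dbeta β y) := by
  rw [seqLe_iff]
  intro q hq
  have key : ∀ j, j ≤ q → (fbeta β)^[j] x ≤ (fbeta β)^[j] y := by
    intro j
    induction j with
    | zero => intro _; exact hxy
    | succ j ih =>
      intro hj
      have h1 := ih (by omega)
      have h2 := hq j (by omega)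
      unfold dbeta at h2
      have h3 := fb_step hβ (fbi_mem (β := β) hx j).1
      have h4 := fb_step hβ (fbi_mem (β := β) hy j).1
      rw [Function.iterate_succ_apply', Function.iterate_succ_apply']
      rw [h2] at h3
      have := mul_le_mul_of_nonneg_left h1 hβ.le
      linarith
  unfold dbeta
  exact Nat.floor_le_floor (mul_le_mul_of_nonneg_left (key q le_rfl) hβ.le)

lemma dbeta_sigma {k : ℕ} {β x : ℝ} (hβ : 0 < β) (hβk : β < k) (hx : x ∈ Set.Icc (0:ℝ) 1) :
    InSigma k (dbeta β x) := by
  intro r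
  unfold dbeta
  have := fbi_mem (β := β) hx r
  rw [Nat.floor_lt (mul_nonneg hβ.le this.1)]
  nlinarith [this.1, this.2]

lemma one_mem : (1:ℝ) ∈ Set.Icc (0:ℝ) 1 := ⟨zero_le_one, le_rfl⟩

lemma dbeta_X {k : ℕ} {β x : ℝ} (hβ : 0 < β) (hβk : β < k) (hx : x ∈ Set.Icc (0:ℝ) 1) :
    dbeta β x ∈ Xset k (dbeta β 1) := by
  refine ⟨dbeta_sigma hβ hβk hx, fun r => ?_⟩
  rw [dbeta_shift]
  exact dbeta_mono hβ (fbi_mem hx r) one_mem (fbi_mem hx r).2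

lemma d_head {k : ℕ} {β : ℝ} (hk : 3 ≤ k) (h1 : (k:ℝ) - 1 < β) (h2 : β < k) :
    dbeta β 1 0 = k - 1 := by
  unfold dbeta
  simp only [Function.iterate_zero, id, mul_one]
  rw [Nat.floor_eq_iff (by have : (3:ℝ) ≤ k := by exact_mod_cast hk
                           linarith)]
  have : (((k - 1 : ℕ)) : ℝ) = k - 1 := by push_cast [Nat.cast_sub (show 1 ≤ k by omega)]; ring
  rw [this]
  exact ⟨h1.le, by linarith⟩

lemma d_gt {k : ℕ} {β : ℝ} (hk : 3 ≤ k) (h1 : (k:ℝ) - 1 < β) (h2 : β < k) :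
    seqLt (baseSeq k) (dbeta β 1) := by
  rcases base_le (d_head hk h1 h2) with h | h
  · exact h
  · exfalso
    have h3 : (3:ℝ) ≤ k := by exact_mod_cast hk
    have hβ : 0 < β := by linarith
    have hs := fb_step hβ (x := 1) zero_le_one
    have hd := d_head hk h1 h2
    unfold dbeta at hd
    simp only [Function.iterate_zero, id] at hd
    have : (((k - 1 : ℕ)) : ℝ) = k - 1 := by push_cast [Nat.cast_sub (show 1 ≤ k by omega)]; ring
    rw [hd, this] at hs
    have hx1 : 0 < fbeta β 1 := by linarith
    have key : ∀ j, (fbeta β)^[j+1] 1 = β^j * fbeta β 1 := by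
      intro j
      induction j with
      | zero => simp
      | succ j ih =>
        have e := fb_step hβ (fbi_mem (β := β) one_mem (j+1)).1
        have e2 : dbeta β 1 (j+1) = 0 := by rw [← h]; unfold baseSeq; rw [if_neg (by omega)]
        unfold dbeta at e2
        rw [e2] at e
        rw [Function.iterate_succ_apply']
        push_cast at e
        rw [zero_add, ih] at e
        rw [ih, ← e]; ring
    obtain ⟨j, hj⟩ := pow_unbounded_of_one_lt (1 / fbeta β 1) (show 1 < β by linarith)
    have h5 := (fbi_mem (β := β) one_mem (j+1)).2
    rw [key, ← le_div_iff₀ hx1] at h5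
    linarith

/-- value of a digit sequence, in terms of `b = 1/β` -/
noncomputable def Vb (b : ℝ) (v : Seq) : ℝ := ∑' i, (v i : ℝ) * b^(i+1)

lemma V_summable {k : ℕ} {b : ℝ} (hb0 : 0 < b) (hb1 : b < 1) {v : Seq} (hv : InSigma k v) :
    Summable fun i => (v i : ℝ) * b^(i+1) := by
  refine Summable.of_nonneg_of_le (fun i => by positivity) (fun i => ?_)
    (((summable_geometric_of_lt_one hb0.le hb1).mul_right b).mul_left (k:ℝ))
  rw [pow_succ]
  have : (v i : ℝ) ≤ k := by exact_mod_cast (hv i).le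
  gcongr

lemma V_split {k : ℕ} {b : ℝ} (hb0 : 0 < b) (hb1 : b < 1) {v : Seq} (hv : InSigma k v) (q : ℕ) :
    Vb b v = ∑ i ∈ Finset.range q, (v i : ℝ) * b^(i+1) + b^q * Vb b (shift^[q] v) := by
  unfold Vb
  rw [← (V_summable hb0 hb1 hv).sum_add_tsum_nat_add q, ← tsum_mul_left]
  congr 1
  refine tsum_congr fun i => ?_
  rw [shift_iter]; ring

lemma V_nonneg {b : ℝ} (hb0 : 0 < b) (v : Seq) : 0 ≤ Vb b v :=
  tsum_nonneg fun i => by positivity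

lemma V_le {k : ℕ} {b : ℝ} (hb0 : 0 < b) (hb1 : b < 1) : ∃ B, 0 ≤ B ∧ ∀ v, InSigma k v → Vb b v ≤ B := by
  refine ⟨∑' i, (k : ℝ) * (b^i * b), tsum_nonneg fun i => by positivity, fun v hv => ?_⟩
  unfold Vb
  refine (V_summable hb0 hb1 hv).tsum_le_tsum (fun i => ?_)
    (((summable_geometric_of_lt_one hb0.le hb1).mul_right b).mul_left (k:ℝ))
  rw [pow_succ]
  have : (v i : ℝ) ≤ k := by exact_mod_cast (hv i).le
  gcongr

lemma V_partial {k : ℕ} {b : ℝ} (hb0 : 0 < b) (hb1 : b < 1) {v : Seq} (hv : InSigma k v) (q : ℕ) :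
    ∑ i ∈ Finset.range q, (v i : ℝ) * b^(i+1) ≤ Vb b v := by
  rw [V_split hb0 hb1 hv q]
  have := V_nonneg hb0 (shift^[q] v)
  have : 0 ≤ b^q * Vb b (shift^[q] v) := by positivity
  linarith

lemma V_partial_lt {k M : ℕ} {b : ℝ} (hb0 : 0 < b) (hb1 : b < 1) {v : Seq} (hv : InSigma k v)
    (hM : NoZ M v) (q : ℕ) :
    ∑ i ∈ Finset.range q, (v i : ℝ) * b^(i+1) < Vb b v := by
  obtain ⟨s, _, hs⟩ := hM q
  refine lt_of_lt_of_le ?_ (V_partial hb0 hb1 hv (q+s+1))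
  rw [Finset.sum_range_succ]
  have h1 : ∑ i ∈ Finset.range q, (v i : ℝ) * b^(i+1)
      ≤ ∑ i ∈ Finset.range (q+s), (v i : ℝ) * b^(i+1) :=
    Finset.sum_le_sum_of_subset_of_nonneg (Finset.range_subset_range.2 (by omega))
      fun i _ _ => by positivity
  have h2 : (0:ℝ) < v (q+s) := by exact_mod_cast Nat.pos_of_ne_zero hs
  have : 0 < (v (q+s) : ℝ) * b^(q+s+1) := by positivity
  linarith

/-- comparison at the first difference -/
lemma V_cmp {k : ℕ} {b : ℝ} (hb0 : 0 < b) (hb1 : b < 1) {v e : Seq} (hv : InSigma k v)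
    (h : seqLt v e) : ∃ q, Vb b v ≤ ∑ i ∈ Finset.range (q+1), (e i : ℝ) * b^(i+1)
      + b^(q+1) * (Vb b (shift^[q+1] v) - 1) := by
  obtain ⟨q, h1, h2⟩ := h
  refine ⟨q, ?_⟩
  rw [V_split hb0 hb1 hv (q+1), Finset.sum_range_succ, Finset.sum_range_succ,
    Finset.sum_congr rfl (fun i hi => by rw [h1 i (Finset.mem_range.1 hi)])]
  have h3 : (v q : ℝ) + 1 ≤ e q := by exact_mod_cast h2
  have : (v q : ℝ) * b^(q+1) + b^(q+1) ≤ e q * b^(q+1) := by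
    rw [← add_one_mul]; gcongr
  linarith

def Refb (b : ℝ) (e : Seq) : Prop := ∀ s, ∑ i ∈ Finset.range s, (e i : ℝ) * b^(i+1) ≤ 1

lemma V_le_one {k : ℕ} {b : ℝ} (hb0 : 0 < b) (hb1 : b < 1) {v e : Seq} (hv : InSigma k v)
    (he : Refb b e) (h : ∀ r, seqLe (shift^[r] v) e) (r : ℕ) : Vb b (shift^[r] v) ≤ 1 := by
  obtain ⟨B, hB0, hB⟩ := V_le (k := k) hb0 hb1
  have hest : ∀ N r, Vb b (shift^[r] v) ≤ 1 + b^N * B := by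
    intro N
    induction N with
    | zero => intro r; have := hB _ (sigma_shift hv r); simp; linarith
    | succ N ih =>
      intro r
      rcases h r with h1 | h1
      · obtain ⟨q, hq⟩ := V_cmp hb0 hb1 (sigma_shift hv r) h1
        refine hq.trans ?_
        have h2 := he (q+1)
        have h3 := ih (r + (q+1))
        rw [← shift_iter_add] at h3
        have h4 : b^(q+1) ≤ b := by
          calc b^(q+1) ≤ b^1 := pow_le_pow_of_le_one hb0.le hb1.le (by omega)
            _ = b := pow_one b
        have h5 : b^(q+1) * (Vb b (shift^[q+1] (shift^[r] v)) - 1) ≤ b^(q+1) * (b^N * B) := by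
          gcongr; linarith
        have h6 : b^(q+1) * (b^N * B) ≤ b * (b^N * B) := by gcongr
        have e7 : b^(N+1) * B = b * (b^N * B) := by ring
        linarith
      · have h2 : Vb b (shift^[r] v) ≤ 1 := by
          have hs := V_summable hb0 hb1 (sigma_shift hv r)
          unfold Vb
          refine le_of_tendsto' hs.hasSum.tendsto_sum_nat fun s => ?_
          rw [h1]; exact he s
        have : 0 ≤ b^(N+1) * B := by positivity
        linarith
  have ht : Tendsto (fun N : ℕ => 1 + b^N * B) atTop (𝓝 (1 + 0 * B)) :=
    ((tendsto_pow_atTop_nhds_zero_of_lt_one hb0.le hb1).mul_const B).const_add 1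
  rw [zero_mul, add_zero] at ht
  exact ge_of_tendsto' ht fun N => hest N r

lemma V_lt_one {k M : ℕ} {b : ℝ} (hb0 : 0 < b) (hb1 : b < 1) {v e : Seq} (hv : InSigma k v)
    (hes : InSigma k e) (hM : NoZ M e) (hV : Vb b e ≤ 1)
    (h : ∀ r, seqLe (shift^[r] v) e) {r : ℕ} (hr : seqLt (shift^[r] v) e) :
    Vb b (shift^[r] v) < 1 := by
  have he : Refb b e := fun s => (V_partial hb0 hb1 hes s).trans hV
  obtain ⟨q, hq⟩ := V_cmp hb0 hb1 (sigma_shift hv r) hr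
  have h1 := V_partial_lt hb0 hb1 hes hM (q+1)
  have h2 := V_le_one hb0 hb1 hv he h (r + (q+1))
  rw [← shift_iter_add] at h2
  have : b^(q+1) * (Vb b (shift^[q+1] (shift^[r] v)) - 1) ≤ 0 :=
    mul_nonpos_of_nonneg_of_nonpos (by positivity) (by linarith)
  linarith

lemma expand {k : ℕ} {β : ℝ} (hβ : 1 < β) {v : Seq} (hv : InSigma k v)
    (h : ∀ r, Vb β⁻¹ (shift^[r+1] v) < 1) : dbeta β (Vb β⁻¹ v) = v := by
  have hb0 : 0 < β⁻¹ := by positivity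
  have hb1 : β⁻¹ < 1 := inv_lt_one_of_one_lt₀ hβ
  have hstep : ∀ r, β * Vb β⁻¹ (shift^[r] v) = v r + Vb β⁻¹ (shift^[r+1] v) := by
    intro r
    rw [V_split hb0 hb1 (sigma_shift hv r) 1, shift_iter_add]
    simp only [Finset.sum_range_one, shift_iter, zero_add, pow_one]
    field_simp
  have hfl : ∀ r, ⌊β * Vb β⁻¹ (shift^[r] v)⌋₊ = v r := by
    intro r
    rw [hstep]
    have := V_nonneg hb0 (shift^[r+1] v)
    rw [Nat.floor_eq_iff (by positivity)]
    exact ⟨by linarith, by linarith [h r]⟩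
  have hit : ∀ r, (fbeta β)^[r] (Vb β⁻¹ v) = Vb β⁻¹ (shift^[r] v) := by
    intro r
    induction r with
    | zero => rfl
    | succ r ih =>
      rw [Function.iterate_succ_apply', ih]
      have e := fb_step (β := β) (by linarith) (V_nonneg hb0 (shift^[r] v))
      rw [hfl, hstep] at e
      linarith
  funext r
  unfold dbeta
  rw [hit, hfl]

lemma d_ref {β : ℝ} (hβ : 1 < β) : Refb β⁻¹ (dbeta β 1) := by
  have hβ0 : 0 < β := by linarith
  intro s
  have key : ∑ i ∈ Finset.range s, (dbeta β 1 i : ℝ) * β⁻¹^(i+1) = 1 - β⁻¹^s * (fbeta β)^[s] 1 := by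
    induction s with
    | zero => simp
    | succ s ih =>
      rw [Finset.sum_range_succ, ih]
      have e := fb_step hβ0 (fbi_mem (β := β) one_mem s).1
      rw [Function.iterate_succ_apply']
      have e2 : (dbeta β 1 s : ℝ) = β * (fbeta β)^[s] 1 - fbeta β ((fbeta β)^[s] 1) := by
        unfold dbeta; linarith
      rw [e2, pow_succ]
      field_simp
      ring
  rw [key]
  have := (fbi_mem (β := β) one_mem s).1
  have : 0 ≤ β⁻¹^s * (fbeta β)^[s] 1 := by positivity
  linarith

lemma lemA {k M : ℕ} {β : ℝ} (hβ : 1 < β) {v z : Seq} (hv : InSigma k v)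
    (hz : InSigma k z) (hzm : IsMaximal z) (hM : NoZ M z) (hzd : seqLe z (dbeta β 1))
    (h : ∀ r, seqLt (shift^[r] v) z) {α : E k} (hf : HasDigitFreq k v α) : α ∈ DFbeta k β := by
  have hb0 : 0 < β⁻¹ := by positivity
  have hb1 : β⁻¹ < 1 := inv_lt_one_of_one_lt₀ hβ
  have hVz : Vb β⁻¹ z ≤ 1 :=
    V_le_one hb0 hb1 hz (d_ref hβ) (fun r => seqLe_trans (hzm r) hzd) 0
  have hlt := fun r => V_lt_one hb0 hb1 hv hz hM hVz (fun r => Or.inl (h r)) (h r)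
  have he := expand hβ hv fun r => hlt (r+1)
  refine ⟨freq_simplex hv hf, Vb β⁻¹ v, ⟨V_nonneg hb0 v, (hlt 0).le⟩, ?_⟩
  rw [he]; exact hf

lemma DFbeta_sub {k : ℕ} {β : ℝ} (hβ : 0 < β) (hβk : β < k) :
    DFbeta k β ⊆ DFw k (dbeta β 1) := by
  rintro α ⟨h1, x, hx, hf⟩
  exact ⟨h1, _, dbeta_X hβ hβk hx, hf⟩

lemma d_max {k : ℕ} {β : ℝ} (hβ : 0 < β) (hβk : β < k) : IsMaximal (dbeta β 1) :=
  (dbeta_X hβ hβk one_mem).2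

lemma DFbeta_eq {k M : ℕ} {β : ℝ} (hβ : 1 < β) (hβk : β < k) (hM : NoZ M (dbeta β 1)) :
    DFbeta k β = DFw k (dbeta β 1) := by
  have hβ0 : 0 < β := by linarith
  refine Set.Subset.antisymm (DFbeta_sub hβ0 hβk) ?_
  rintro α ⟨h1, v, hv, hf⟩
  by_cases hex : ∃ r, shift^[r] v = dbeta β 1
  · obtain ⟨r, hr⟩ := hex
    refine ⟨h1, 1, one_mem, ?_⟩
    rw [← hr]; exact freq_shift hf r
  · push Not at hex
    exact lemA hβ hv.1 (dbeta_sigma hβ0 hβk one_mem) (d_max hβ0 hβk) hM (seqLe_refl _)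
      (fun r => (hv.2 r).resolve_right (hex r)) hf

lemma realize {k M : ℕ} (hk : 3 ≤ k) {w : Seq} (hw : InSigma k w) (hw0 : w 0 = k - 1)
    (hM : NoZ M w) (hm : IsMaximal w) (hper : ∀ r, shift^[r+1] w ≠ w) :
    ∃ β : ℝ, (k:ℝ) - 1 < β ∧ β < k ∧ dbeta β 1 = w := by
  have hk3 : (3:ℝ) ≤ k := by exact_mod_cast hk
  have hk1 : (((k - 1 : ℕ)) : ℝ) = k - 1 := by push_cast [Nat.cast_sub (show 1 ≤ k by omega)]; ring
  have hkk : (0:ℝ) < (k:ℝ) - 1 := by linarith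
  have hcont : ContinuousOn (fun b => Vb b w) (Set.Icc (k:ℝ)⁻¹ ((k:ℝ)-1)⁻¹) := by
    unfold Vb
    refine continuousOn_tsum (u := fun i => (k:ℝ) * (((k:ℝ)-1)⁻¹^i * ((k:ℝ)-1)⁻¹))
      (fun i => by fun_prop)
      (((summable_geometric_of_lt_one (by positivity)
        (inv_lt_one_of_one_lt₀ (by linarith))).mul_right _).mul_left _) ?_
    intro i b hb
    have hb0 : 0 ≤ b := le_trans (by positivity) hb.1
    rw [Real.norm_of_nonneg (by positivity), ← pow_succ]
    have : (w i : ℝ) ≤ k := by exact_mod_cast (hw i).le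
    have := hb.2
    gcongr
  have hlow : Vb (k:ℝ)⁻¹ w < 1 := by
    have hb0 : (0:ℝ) < (k:ℝ)⁻¹ := by positivity
    have hb1 : (k:ℝ)⁻¹ < 1 := inv_lt_one_of_one_lt₀ (by linarith)
    have hs := ((summable_geometric_of_lt_one hb0.le hb1).mul_right (k:ℝ)⁻¹).mul_left ((k:ℝ)-1)
    have hsum : ∑' i : ℕ, ((k:ℝ)-1) * ((k:ℝ)⁻¹^i * (k:ℝ)⁻¹) = 1 := by
      rw [tsum_mul_left, tsum_mul_right, tsum_geometric_of_lt_one hb0.le hb1]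
      field_simp
    rw [← hsum]
    have hle : ∀ i, (w i : ℝ) ≤ (k:ℝ) - 1 := fun i => by
      rw [← hk1]; have := hw i; exact_mod_cast (by omega)
    have hex : ∃ i, w i ≠ k - 1 := by
      by_contra hc
      push Not at hc
      apply hper 0
      funext t
      rw [shift_iter, hc, hc]
    obtain ⟨i, hi⟩ := hex
    refine Summable.tsum_lt_tsum (i := i) (fun j => ?_) ?_ (V_summable hb0 hb1 hw) hs
    · rw [pow_succ]; have := hle j; gcongr
    · rw [pow_succ]
      have : (w i : ℝ) < (k:ℝ) - 1 := by
        rw [← hk1]; have := hw i; exact_mod_cast (by omega)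
      gcongr
  have hhigh : 1 < Vb ((k:ℝ)-1)⁻¹ w := by
    have := V_partial_lt (b := ((k:ℝ)-1)⁻¹) (by positivity)
      (inv_lt_one_of_one_lt₀ (by linarith)) hw hM 1
    simp only [Finset.sum_range_one, hw0, hk1, zero_add, pow_one] at this
    rwa [mul_inv_cancel₀ hkk.ne'] at this
  have hle : (k:ℝ)⁻¹ ≤ ((k:ℝ)-1)⁻¹ := by gcongr; linarith
  obtain ⟨b, hb, hVb⟩ := intermediate_value_Icc hle hcont ⟨hlow.le, hhigh.le⟩
  have hVb : Vb b w = 1 := hVb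
  have hb0 : 0 < b := lt_of_lt_of_le (by positivity) hb.1
  have hblo : (k:ℝ)⁻¹ < b := lt_of_le_of_ne hb.1 (by rintro rfl; linarith)
  have hbhi : b < ((k:ℝ)-1)⁻¹ := lt_of_le_of_ne hb.2 (by rintro rfl; linarith)
  have hb1 : b < 1 := hbhi.trans (inv_lt_one_of_one_lt₀ (by linarith))
  refine ⟨b⁻¹, ?_, ?_, ?_⟩
  · rw [lt_inv_comm₀ hkk hb0]; exact hbhi
  · rw [inv_lt_comm₀ hb0 (by linarith)]; exact hblo
  · have := expand (k := k) (β := b⁻¹) ((one_lt_inv₀ hb0).2 hb1) hw ?_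
    · rwa [inv_inv, hVb] at this
    · intro r
      rw [inv_inv]
      exact V_lt_one hb0 hb1 hw hw hM hVb.le hm ((hm (r+1)).resolve_right (hper r))

/-! ### Non-periodicity of `S(n)` -/

lemma lam_period {k : ℕ} (hk : 3 ≤ k) (a : ℕ) {u : Seq} (hu : InSigma k u) (hu0 : u 0 = k - 1)
    {r : ℕ} (hr : 0 < r) (h : shift^[r] (lamSub k a u) = lamSub k a u) :
    ∃ j, 0 < j ∧ j + a ≤ r ∧ shift^[j] u = u := by
  have hne : ∀ i, (fun r => lamWord k a (u r)) i ≠ [] := fun i => lamWord_ne _ _ _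
  obtain ⟨j, s, h1, rfl⟩ := exists_block hne r
  have hs : s = 0 := by
    by_contra hs
    have h2 := congrFun h 0
    rw [shift_iter, zero_add, lam_head hk a hu0, lamSub_eq, cc_spec hne j s h1, lamWord_cw,
      cw_pos _ _ _ (by omega)] at h2
    omega
  subst hs
  rw [add_zero] at *
  have hj : 0 < j := by
    by_contra hc
    obtain rfl : j = 0 := by omega
    simp [cl_zero] at hr
  refine ⟨j, hj, ?_, ?_⟩
  · obtain ⟨i, rfl⟩ : ∃ i, j = 1 + i := ⟨j - 1, by omega⟩
    rw [cl_add, cl_succ, cl_zero, hu0, lw_len_last hk]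
    have := le_cl (r := fun t => lamWord k a (u (1+t))) (fun i => lamWord_ne _ _ _) i
    omega
  · rw [lam_shift] at h
    exact lam_inj hk (sigma_shift hu j) hu h

def InfBig (n : ℕ → ℕ) : Prop := ∀ N, ∃ i, N ≤ i ∧ 2 ≤ n i

lemma S_nonper {k : ℕ} (hk : 3 ≤ k) {n : ℕ → ℕ} (hn : InfBig n) (r : ℕ) :
    shift^[r+1] (Sseq k n) ≠ Sseq k n := by
  intro h
  have h1 : ∀ R, ∃ j, 0 < j ∧ j + ∑ l ∈ Finset.range R, n l ≤ r + 1 ∧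
      shift^[j] (Sseq k fun i => n (R+i)) = Sseq k fun i => n (R+i) := by
    intro R
    induction R with
    | zero => exact ⟨r+1, by omega, by simp, by simpa using h⟩
    | succ R ih =>
      obtain ⟨j, hj0, hj1, hj2⟩ := ih
      rw [S_succ hk] at hj2
      obtain ⟨j', h3, h4, h5⟩ := lam_period hk _ (S_sigma hk _) (S_head hk _) hj0 hj2
      refine ⟨j', h3, ?_, ?_⟩
      · rw [Finset.sum_range_succ]; simp only [add_zero] at h4; omega
      · have e : (fun i => n (R + 1 + i)) = fun i => n (R + (i + 1)) := by
          funext i; congr 1; omega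
        rw [e]; exact h5
  have h2 : ∀ B, ∃ R, B ≤ ∑ l ∈ Finset.range R, n l := by
    intro B
    induction B with
    | zero => exact ⟨0, by simp⟩
    | succ B ih =>
      obtain ⟨R, hR⟩ := ih
      obtain ⟨i, hi1, hi2⟩ := hn R
      refine ⟨i+1, ?_⟩
      rw [Finset.sum_range_succ]
      have : ∑ l ∈ Finset.range R, n l ≤ ∑ l ∈ Finset.range i, n l :=
        Finset.sum_le_sum_of_subset (Finset.range_subset_range.2 hi1)
      omega
  obtain ⟨R, hR⟩ := h2 (r+1)
  obtain ⟨j, hj0, hj1, _⟩ := h1 R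
  omega

lemma S_NoZ {k : ℕ} (hk : 3 ≤ k) (n : ℕ → ℕ) : NoZ (n 0 + 2) (Sseq k n) := by
  rw [S_succ hk]; exact lam_NoZ hk _ _

lemma S_realize {k : ℕ} (hk : 3 ≤ k) {n : ℕ → ℕ} (hn : InfBig n) :
    ∃ β : ℝ, (k:ℝ) - 1 < β ∧ β < k ∧ dbeta β 1 = Sseq k n :=
  realize hk (S_sigma hk n) (S_head hk n) (S_NoZ hk n) (S_max hk n) (S_nonper hk hn)

noncomputable def up {k : ℕ} : List ℕ → E k → E k
  | [], x => x
  | a :: t, x => Kinv a (up t x)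

lemma up_append {k : ℕ} (g h : List ℕ) (x : E k) : up (g ++ h) x = up g (up h x) := by
  induction g with
  | nil => rfl
  | cons a t ih => simp only [List.cons_append, up, ih]

lemma up_simplex {k : ℕ} (hk : 3 ≤ k) (g : List ℕ) {x : E k} (hx : x ∈ simplex k) :
    up g x ∈ simplex k := by
  induction g with
  | nil => exact hx
  | cons a t ih => exact Kinv_simplex hk a ih

lemma proj_cont {k : ℕ} (i : ℕ) : Continuous fun x : E k => proj x i := by
  unfold proj
  split_ifs <;> fun_prop

lemma cont_of_proj {k : ℕ} {s : Set (E k)} {f : E k → E k}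
    (h : ∀ i, i < k → ContinuousOn (fun x => proj (f x) i) s) : ContinuousOn f s := by
  have h1 : ContinuousOn (fun x => (WithLp.equiv 2 (Fin k → ℝ)) (f x)) s := by
    refine continuousOn_pi.2 fun i => ?_
    have := h i i.2
    simp only [proj_fin] at this
    exact this
  have h2 : Continuous (fun y : Fin k → ℝ => (WithLp.toLp 2 y : E k)) := PiLp.continuous_toLp 2 _
  exact h2.comp_continuousOn h1

lemma Kinv_cont {k : ℕ} (hk : 3 ≤ k) (a : ℕ) : ContinuousOn (Kinv (k := k) a) (simplex k) := by
  have hd : ContinuousOn (fun x : E k => kden a x) (simplex k) := by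
    unfold kden
    have := proj_cont (k := k) (k-1)
    have := proj_cont (k := k) (k-2)
    fun_prop
  have hd0 : ∀ x ∈ simplex k, kden a x ≠ 0 := fun x hx => by
    have := kden_pos a hx; linarith
  refine cont_of_proj fun b hb => ?_
  have h1 := proj_cont (k := k) (k-1)
  have h2 := proj_cont (k := k) (k-2)
  rcases idx_cases hk hb with rfl | ⟨i, hi, rfl⟩ | rfl
  · simp only [Kinv_zero hk]
    exact ContinuousOn.div (by fun_prop) hd hd0
  · simp only [Kinv_mid _ _ hi]
    exact ContinuousOn.div (proj_cont i).continuousOn hd hd0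
  · simp only [Kinv_last hk]
    exact ContinuousOn.div (by fun_prop) hd hd0

lemma up_cont {k : ℕ} (hk : 3 ≤ k) (g : List ℕ) : ContinuousOn (up (k := k) g) (simplex k) := by
  induction g with
  | nil => exact continuousOn_id
  | cons a t ih => exact (Kinv_cont hk a).comp ih fun x hx => up_simplex hk t hx

lemma simplex_compact (k : ℕ) : IsCompact (simplex k) := by
  refine Metric.isCompact_of_isClosed_isBounded ?_ ?_
  · have : simplex k = (⋂ i : Fin k, {α : E k | 0 ≤ α i}) ∩ {α : E k | ∑ i, α i = 1} := by
      ext α; simp [simplex]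
    rw [this]
    refine IsClosed.inter (isClosed_iInter fun i => isClosed_le continuous_const (by fun_prop)) ?_
    exact isClosed_eq (by fun_prop) continuous_const
  · exact (Metric.isBounded_closedBall (x := (0 : E k)) (r := 1)).subset fun x hx => by
      simpa using simplex_norm hx

lemma Kmap_Kinv {k : ℕ} (hk : 3 ≤ k) (a : ℕ) {x : E k} (hx : x ∈ simplex k) :
    Kmap a (Kinv a x) = x := by
  have hd := kden_pos a hx
  have hd0 : kden a x ≠ 0 := by linarith
  have h1 : 1 - proj (Kinv a x) 0 = 1 / kden a x := by
    rw [Kinv_zero hk]; field_simp; unfold kden; ring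
  refine proj_ext fun b hb => ?_
  rcases idx_cases2 hb with hi | rfl | rfl
  · rw [Kmap_mid _ _ hi, h1, Kinv_mid _ _ hi]; field_simp
  · rw [Kmap_pen hk, h1, Kinv_zero hk, Kinv_last hk]; field_simp; ring
  · rw [Kmap_last hk, h1, Kinv_zero hk, Kinv_last hk]; field_simp; ring

lemma Kinv_Kmap {k : ℕ} (hk : 3 ≤ k) (a : ℕ) {x : E k} (hx : proj x 0 < 1) :
    Kinv a (Kmap a x) = x := by
  have hD : 1 - proj x 0 ≠ 0 := by linarith
  have h1 : kden a (Kmap a x) = 1 / (1 - proj x 0) := by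
    unfold kden; rw [Kmap_pen hk, Kmap_last hk]; field_simp; ring
  refine proj_ext fun b hb => ?_
  rcases idx_cases hk hb with rfl | ⟨i, hi, rfl⟩ | rfl
  · rw [Kinv_zero hk, h1, Kmap_pen hk, Kmap_last hk]; field_simp; ring
  · rw [Kinv_mid _ _ hi, h1, Kmap_mid _ _ hi]; field_simp
  · rw [Kinv_last hk, h1, Kmap_pen hk, Kmap_last hk]; field_simp; ring

lemma mem_simplex' {k : ℕ} {x : E k} : x ∈ simplex' k ↔ x ∈ simplex k ∧ 0 < proj x (k-1) := by
  constructor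
  · rintro ⟨h1, h2⟩
    exact ⟨h1, lt_of_le_of_ne (proj_nonneg h1 _) fun h => h2 ⟨h1, h.symm⟩⟩
  · rintro ⟨h1, h2⟩
    exact ⟨h1, fun h => by rw [h.2] at h2; exact lt_irrefl _ h2⟩

lemma head_lt_one {k : ℕ} (hk : 3 ≤ k) {x : E k} (h : x ∈ simplex k) (h2 : 0 < proj x (k-1)) :
    proj x 0 < 1 := by
  have := (simplex_iff.1 h).2
  rw [sum_split_ends hk] at this
  have : 0 ≤ ∑ i ∈ Finset.range (k-2), proj x (i+1) :=
    Finset.sum_nonneg fun i _ => proj_nonneg h _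
  linarith

lemma Kmap_simplex {k : ℕ} (hk : 3 ≤ k) {a : ℕ} {x : E k} (hx : x ∈ simplex k)
    (h0 : proj x 0 < 1)
    (h1 : a * proj x (k-1) ≤ proj x 0) (h2 : proj x 0 ≤ (a+1) * proj x (k-1)) :
    Kmap a x ∈ simplex k := by
  have hD : 0 < 1 - proj x 0 := by linarith
  have hs := (simplex_iff.1 hx).2
  rw [sum_split_ends hk] at hs
  rw [simplex_iff]
  constructor
  · intro b hb
    rcases idx_cases2 hb with hi | rfl | rfl
    · rw [Kmap_mid _ _ hi]; exact div_nonneg (proj_nonneg hx _) hD.le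
    · rw [Kmap_pen hk]; exact div_nonneg (by linarith) hD.le
    · rw [Kmap_last hk]; exact div_nonneg (by linarith) hD.le
  · rw [sum_split_last hk, Kmap_pen hk, Kmap_last hk]
    rw [Finset.sum_congr rfl fun i hi => Kmap_mid a x (by have := Finset.mem_range.1 hi; omega),
      ← Finset.sum_div, ← add_div, ← add_div, div_eq_one_iff_eq hD.ne']
    linarith

lemma J_Kinv {k : ℕ} (hk : 3 ≤ k) (a : ℕ) {y : E k} (hy : y ∈ simplex k)
    (h : 0 < proj y (k-1)) : Jfun (Kinv a y) = a := by
  have hd : 0 < kden a y := by have := kden_pos a hy; linarith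
  have hp := proj_nonneg hy (k-2)
  unfold Jfun
  rw [Kinv_zero hk, Kinv_last hk, div_div_div_cancel_right₀ hd.ne']
  have hpq : 0 < proj y (k-2) + proj y (k-1) := by linarith
  rw [Nat.floor_eq_iff (by positivity)]
  constructor
  · rw [le_div_iff₀ hpq]; nlinarith
  · rw [div_lt_iff₀ hpq]; nlinarith

lemma Kinv_last_pos {k : ℕ} (hk : 3 ≤ k) (a : ℕ) {y : E k} (hy : y ∈ simplex k)
    (h : 0 < proj y (k-1)) : 0 < proj (Kinv a y) (k-1) := by
  have hd : 0 < kden a y := by have := kden_pos a hy; linarith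
  have hp := proj_nonneg hy (k-2)
  rw [Kinv_last hk]; positivity

lemma step_simplex' {k : ℕ} (hk : 3 ≤ k) {x : E k} (hx : x ∈ simplex' k) :
    Kstep x ∈ simplex' k ∧ x = Kinv (Jfun x) (Kstep x) := by
  rw [mem_simplex'] at hx ⊢
  have h0 := head_lt_one hk hx.1 hx.2
  have hq := Nat.floor_le (div_nonneg (proj_nonneg hx.1 0) hx.2.le)
  have hq2 := Nat.lt_floor_add_one (proj x 0 / proj x (k-1))
  change ((Jfun x : ℕ) : ℝ) ≤ _ at hq
  change _ < ((Jfun x : ℕ) : ℝ) + 1 at hq2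
  rw [le_div_iff₀ hx.2] at hq
  rw [div_lt_iff₀ hx.2] at hq2
  refine ⟨⟨Kmap_simplex hk hx.1 h0 hq hq2.le, ?_⟩, (Kinv_Kmap hk _ h0).symm⟩
  unfold Kstep
  rw [Kmap_last hk]
  exact div_pos (by linarith) (by linarith)

/-- Complete irrationality. -/
def Irr {k : ℕ} (α : E k) : Prop := ∀ c : Fin k → ℤ, (∃ i, c i ≠ 0) → ∑ i, (c i : ℝ) * α i ≠ 0

lemma irr_iff {k : ℕ} {α : E k} : Irr α ↔ ∀ c : ℕ → ℤ, (∃ i, i < k ∧ c i ≠ 0) →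
    ∑ i ∈ Finset.range k, (c i : ℝ) * proj α i ≠ 0 := by
  constructor
  · rintro h c ⟨i, hi, hc⟩ h2
    refine h (fun i => c i) ⟨⟨i, hi⟩, hc⟩ ?_
    rw [Finset.sum_range] at h2
    simpa only [proj_fin] using h2
  · rintro h c ⟨i, hc⟩ h2
    refine h (fun i => if h : i < k then c ⟨i, h⟩ else 0) ⟨i, i.2, by simpa using hc⟩ ?_
    rw [Finset.sum_range]
    simpa [proj_fin] using h2

lemma irr_pos {k : ℕ} {y : E k} (hy : y ∈ simplex k) (h : Irr y) {i : ℕ} (hi : i < k) :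
    0 < proj y i := by
  refine lt_of_le_of_ne (proj_nonneg hy _) fun h2 => ?_
  refine irr_iff.1 h (fun j => if j = i then 1 else 0) ⟨i, hi, by simp⟩ ?_
  rw [Finset.sum_eq_single i]
  · simp [← h2]
  · intro j _ hj; simp [hj]
  · intro h3; exact absurd (Finset.mem_range.2 hi) h3

lemma irr_Kinv {k : ℕ} (hk : 3 ≤ k) {a : ℕ} {y : E k} (hy : y ∈ simplex k)
    (h : Irr (Kinv a y)) : Irr y := by
  rw [irr_iff] at h ⊢
  rintro c ⟨i, hi, hc⟩ h2
  have hd : 0 < kden a y := by have := kden_pos a hy; linarith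
  let c' : ℕ → ℤ := fun j => if j = 0 then c (k-2) - c (k-1) else
    if j = k - 1 then c (k-1) - a * (c (k-2) - c (k-1)) else c (j-1)
  have e0 : c' 0 = c (k-2) - c (k-1) := by simp [c']
  have el : c' (k-1) = c (k-1) - a * (c (k-2) - c (k-1)) := by
    simp only [c']; rw [if_neg (by omega)]; simp
  have em : ∀ j, j + 2 < k → c' (j+1) = c j := by
    intro j hj; simp only [c']; rw [if_neg (by omega), if_neg (by omega)]; simp
  refine h c' ?_ ?_
  · by_contra hn
    push Not at hn
    have h0 := hn 0 (by omega)
    have hl := hn (k-1) (by omega)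
    rw [e0] at h0
    rw [el, h0] at hl
    rcases idx_cases2 hi with hi | rfl | rfl
    · exact hc ((em i hi).symm.trans (hn _ (by omega)))
    · apply hc; linarith
    · apply hc; linarith
  · rw [sum_split_last hk] at h2
    rw [sum_split_ends hk, e0, el, Kinv_zero hk, Kinv_last hk]
    have : ∑ i ∈ Finset.range (k-2), (c' (i+1) : ℝ) * proj (Kinv a y) (i+1)
        = (∑ i ∈ Finset.range (k-2), (c i : ℝ) * proj y i) / kden a y := by
      rw [Finset.sum_div]
      refine Finset.sum_congr rfl fun i hi => ?_
      have := Finset.mem_range.1 hi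
      rw [em i (by omega), Kinv_mid _ _ (by omega), mul_div_assoc]
    rw [this]
    push_cast
    field_simp
    linear_combination h2

lemma fiber_step {k : ℕ} (hk : 3 ≤ k) {n : ℕ → ℕ} {α : E k} (hα : α ∈ simplex k) (hi : Irr α)
    (h : ∀ r, α ∈ up (pre n r) '' simplex k) :
    Jfun α = n 0 ∧ Kstep α ∈ simplex k ∧ Irr (Kstep α) ∧
      ∀ r, Kstep α ∈ up (pre (fun i => n (i+1)) r) '' simplex k := by
  have key : ∀ r, ∃ y ∈ simplex k, Kinv (n 0) (up (pre (fun i => n (i+1)) r) y) = α := by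
    intro r
    obtain ⟨y, hy, h1⟩ := h (r+1)
    rw [pre_succ'] at h1
    exact ⟨y, hy, h1⟩
  obtain ⟨y, hy, h1⟩ := key 0
  change Kinv (n 0) y = α at h1
  have hiy : Irr y := irr_Kinv hk hy (h1.symm ▸ hi)
  have hJ : Jfun α = n 0 := by rw [← h1]; exact J_Kinv hk _ hy (irr_pos hy hiy (by omega))
  have hK : Kstep α = y := by
    unfold Kstep; rw [hJ, ← h1, Kmap_Kinv hk _ hy]
  refine ⟨hJ, hK ▸ hy, hK ▸ hiy, fun r => ?_⟩
  obtain ⟨z, hz, h2⟩ := key r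
  refine ⟨z, hz, ?_⟩
  unfold Kstep; rw [hJ, ← h2, Kmap_Kinv hk _ (up_simplex hk _ hz)]

lemma fiber_Phi {k : ℕ} (hk : 3 ≤ k) (r : ℕ) : ∀ {n : ℕ → ℕ} {α : E k}, α ∈ simplex k → Irr α →
    (∀ r, α ∈ up (pre n r) '' simplex k) → Phi α r = n r := by
  induction r with
  | zero => intro n α h1 h2 h3; exact (fiber_step hk h1 h2 h3).1
  | succ r ih =>
    intro n α h1 h2 h3
    obtain ⟨_, h5, h6, h7⟩ := fiber_step hk h1 h2 h3
    have := ih h5 h6 h7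
    unfold Phi at this ⊢
    rw [Function.iterate_succ_apply]; exact this

lemma fiber_conv {k : ℕ} (hk : 3 ≤ k) (r : ℕ) : ∀ {n : ℕ → ℕ} {x : E k}, x ∈ simplex' k →
    Phi x = n → x ∈ up (pre n r) '' simplex k := by
  induction r with
  | zero => intro n x h1 h2; exact ⟨x, h1.1, rfl⟩
  | succ r ih =>
    intro n x h1 h2
    obtain ⟨h3, h4⟩ := step_simplex' hk h1
    obtain ⟨y, hy, h5⟩ := ih (n := fun i => n (i+1)) h3 (by
      subst h2; funext i; unfold Phi; rw [Function.iterate_succ_apply])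
    refine ⟨y, hy, ?_⟩
    rw [pre_succ']
    change Kinv (n 0) (up _ y) = x
    rw [h5, ← h2]; exact h4.symm

lemma fiber_eq {k : ℕ} (hk : 3 ≤ k) {n : ℕ → ℕ} {α : E k} (hα : α ∈ simplex k) (hi : Irr α)
    (h : ∀ r, α ∈ up (pre n r) '' simplex k)
    (hu : ∀ x, (∀ r, x ∈ up (pre n r) '' simplex k) → x = α) : PhiFiber k n = {α} := by
  ext x
  constructor
  · rintro ⟨h1, h2⟩
    exact hu x fun r => fiber_conv hk r h1 h2
  · rintro rfl
    exact ⟨mem_simplex'.2 ⟨hα, irr_pos hα hi (by omega)⟩, funext fun r => fiber_Phi hk r hα hi h⟩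

lemma up_mono {k : ℕ} (hk : 3 ≤ k) (g h : List ℕ) :
    up (g ++ h) '' simplex k ⊆ up g '' simplex k := by
  rintro _ ⟨y, hy, rfl⟩
  exact ⟨up h y, up_simplex hk h hy, (up_append _ _ _).symm⟩

lemma nested {k : ℕ} (hk : 3 ≤ k) (n : ℕ → ℕ) : ∃ α ∈ simplex k, ∀ r, α ∈ up (pre n r) '' simplex k := by
  have hc : ∀ r, IsCompact (up (pre n r) '' simplex k) := fun r =>
    (simplex_compact k).image_of_continuousOn (up_cont hk _)
  obtain ⟨α, hα⟩ := IsCompact.nonempty_iInter_of_sequence_nonempty_isCompact_isClosed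
    (fun r => up (pre n r) '' simplex k) (fun r => by rw [pre_succ]; exact up_mono hk _ _)
    (fun r => ⟨_, evec k 0, evec_simplex (by omega), rfl⟩) (hc 0) (fun r => (hc r).isClosed)
  rw [Set.mem_iInter] at hα
  obtain ⟨y, hy, h⟩ := hα 0
  exact ⟨α, h ▸ hy, hα⟩

/-- The linear form with coefficients `c`. -/
noncomputable def LF {k : ℕ} (c : ℕ → ℤ) (x : E k) : ℝ := ∑ i ∈ Finset.range k, (c i : ℝ) * proj x i

lemma LF_cont {k : ℕ} (c : ℕ → ℤ) : Continuous fun x : E k => LF c x := by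
  unfold LF
  exact continuous_finsetSum _ fun i _ => (proj_cont i).const_mul _

lemma LF_pull {k : ℕ} (hk : 3 ≤ k) (a : ℕ) {c : ℕ → ℤ} (hc : ∃ i, i < k ∧ c i ≠ 0) :
    ∃ c' : ℕ → ℤ, (∃ i, i < k ∧ c' i ≠ 0) ∧
      ∀ y : E k, y ∈ simplex k → LF c (Kinv a y) = 0 → LF c' y = 0 := by
  let c' : ℕ → ℤ := fun j => if j + 2 < k then c (j+1) else
    if j + 2 = k then (a+1) * c 0 + c (k-1) else a * c 0 + c (k-1)
  have em : ∀ j, j + 2 < k → c' j = c (j+1) := by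
    intro j hj; simp only [c']; rw [if_pos hj]
  have ep : c' (k-2) = (a+1) * c 0 + c (k-1) := by
    simp only [c']; rw [if_neg (by omega), if_pos (by omega)]
  have el : c' (k-1) = a * c 0 + c (k-1) := by
    simp only [c']; rw [if_neg (by omega), if_neg (by omega)]
  refine ⟨c', ?_, ?_⟩
  · by_contra hn
    push Not at hn
    obtain ⟨i, hi, hci⟩ := hc
    have h1 := hn (k-2) (by omega)
    have h2 := hn (k-1) (by omega)
    rw [ep] at h1
    rw [el] at h2
    have h0 : c 0 = 0 := by linarith
    rw [h0] at h2
    rcases idx_cases hk hi with rfl | ⟨i, hi2, rfl⟩ | rfl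
    · exact hci h0
    · exact hci ((em i hi2).symm.trans (hn _ (by omega)))
    · apply hci; linarith
  · intro y hy h2
    have hd : 0 < kden a y := by have := kden_pos a hy; linarith
    unfold LF at h2 ⊢
    rw [sum_split_ends hk, Kinv_zero hk, Kinv_last hk] at h2
    rw [sum_split_last hk, ep, el]
    have : ∑ i ∈ Finset.range (k-2), (c (i+1) : ℝ) * proj (Kinv a y) (i+1)
        = (∑ i ∈ Finset.range (k-2), (c' i : ℝ) * proj y i) / kden a y := by
      rw [Finset.sum_div]
      refine Finset.sum_congr rfl fun i hi => ?_
      have := Finset.mem_range.1 hi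
      rw [em i (by omega), Kinv_mid _ _ (by omega), mul_div_assoc]
    rw [this] at h2
    push_cast
    field_simp at h2
    linear_combination h2

lemma LF_pull_list {k : ℕ} (hk : 3 ≤ k) (g : List ℕ) : ∀ {c : ℕ → ℤ}, (∃ i, i < k ∧ c i ≠ 0) →
    ∃ c' : ℕ → ℤ, (∃ i, i < k ∧ c' i ≠ 0) ∧
      ∀ y : E k, y ∈ simplex k → LF c (up g y) = 0 → LF c' y = 0 := by
  induction g with
  | nil => intro c hc; exact ⟨c, hc, fun y _ h => h⟩
  | cons a t ih =>
    intro c hc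
    obtain ⟨c1, h1, h2⟩ := LF_pull hk a hc
    obtain ⟨c2, h3, h4⟩ := ih h1
    exact ⟨c2, h3, fun y hy h => h4 y hy (h2 _ (up_simplex hk t hy) h)⟩

lemma LF_evec {k i : ℕ} (hi : i < k) (c : ℕ → ℤ) : LF c (evec k i) = c i := by
  unfold LF
  rw [Finset.sum_eq_single i]
  · rw [evec_proj k i hi]; simp
  · intro j hj hji; rw [evec_proj k i (Finset.mem_range.1 hj)]; simp [hji]
  · intro h3; exact absurd (Finset.mem_range.2 hi) h3

lemma Kinv_evec {k : ℕ} (hk : 3 ≤ k) {i : ℕ} (hi : i + 2 < k) : Kinv 0 (evec k i) = evec k (i+1) := by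
  have hd : kden 0 (evec k i) = 1 := by
    unfold kden; rw [evec_proj k i (by omega), evec_proj k i (by omega)]
    rw [if_neg (by omega), if_neg (by omega)]; simp
  refine proj_ext fun b hb => ?_
  rw [evec_proj k _ hb]
  rcases idx_cases hk hb with rfl | ⟨j, hj, rfl⟩ | rfl
  · rw [Kinv_zero hk, hd, evec_proj k i (by omega), evec_proj k i (by omega),
      if_neg (by omega), if_neg (by omega), if_neg (by omega)]; simp
  · rw [Kinv_mid _ _ hj, hd, evec_proj k i (by omega)]; simp
  · rw [Kinv_last hk, hd, evec_proj k i (by omega), evec_proj k i (by omega)]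
    by_cases h : i + 2 = k - 1 + 1
    · omega
    · rw [if_neg (by omega), if_neg (by omega), if_neg (by omega)]; simp

lemma up_rep_evec {k : ℕ} (hk : 3 ≤ k) (j : ℕ) (hj : j + 2 ≤ k) :
    up (List.replicate j 0) (evec k 0) = evec k j := by
  induction j with
  | zero => rfl
  | succ j ih =>
    rw [List.replicate_succ]
    change Kinv 0 (up _ _) = _
    rw [ih (by omega), Kinv_evec hk (by omega)]

lemma LF_rep {k : ℕ} (hk : 3 ≤ k) {c : ℕ → ℤ} (hc : ∃ i, i < k ∧ c i ≠ 0) :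
    ∃ j, LF c (up (List.replicate j 0) (evec k 0)) ≠ 0 := by
  by_contra hn
  push Not at hn
  have h1 : ∀ j, j + 2 ≤ k → c j = 0 := by
    intro j hj
    have := hn j
    rw [up_rep_evec hk j hj, LF_evec (by omega)] at this
    exact_mod_cast this
  have h2 := hn (k-1)
  obtain ⟨i, hi, hci⟩ := hc
  by_cases hik : i + 2 ≤ k
  · exact hci (h1 i hik)
  · obtain rfl : i = k - 1 := by omega
    have e : k - 1 = (k - 2) + 1 := by omega
    rw [e, List.replicate_succ] at h2
    change LF c (Kinv 0 (up _ _)) = 0 at h2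
    rw [up_rep_evec hk _ (by omega)] at h2
    unfold LF at h2
    have hl := Kinv_last hk 0 (evec k (k-2))
    rw [evec_proj k _ (by omega), evec_proj k _ (by omega), if_pos rfl, if_neg (by omega)] at hl
    rw [sum_split_last hk, Finset.sum_eq_zero (fun i hi => ?_), h1 (k-2) (by omega), hl] at h2
    · have hd := kden_pos 0 (evec_simplex (k := k) (i := k-2) (by omega))
      have : (0:ℝ) < kden 0 (evec k (k-2)) := by linarith
      apply hci
      have h3 : (c (k-1) : ℝ) = 0 := by
        field_simp at h2
        simpa using h2
      exact_mod_cast h3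
    · have := Finset.mem_range.1 hi
      rw [h1 i (by omega)]; simp

lemma norm_le_sum {k : ℕ} (x : E k) : ‖x‖ ≤ ∑ i, |x i| := by
  rw [EuclideanSpace.norm_eq]
  have h0 : 0 ≤ ∑ i, |x i| := Finset.sum_nonneg fun i _ => abs_nonneg _
  refine Real.sqrt_le_iff.2 ⟨h0, ?_⟩
  rw [sq, Finset.sum_mul]
  refine Finset.sum_le_sum fun i hi => ?_
  rw [Real.norm_eq_abs, sq]
  exact mul_le_mul_of_nonneg_left
    (Finset.single_le_sum (f := fun i => |x i|) (fun i _ => abs_nonneg _) hi) (abs_nonneg _)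

lemma dist_e0 {k : ℕ} (hk : 3 ≤ k) {z : E k} (hz : z ∈ simplex k) :
    dist z (evec k 0) ≤ 2 * (1 - proj z 0) := by
  rw [dist_eq_norm]
  refine (norm_le_sum _).trans ?_
  have h1 : ∑ i, |(z - evec k 0) i| = ∑ i ∈ Finset.range k, |proj z i - proj (evec k 0) i| := by
    rw [Finset.sum_range]
    exact Finset.sum_congr rfl fun i _ => by rw [proj_fin, proj_fin]; rfl
  have hs := (simplex_iff.1 hz).2
  obtain ⟨m, rfl⟩ : ∃ m, k = m + 1 := ⟨k - 1, by omega⟩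
  rw [h1, Finset.sum_range_succ']
  rw [Finset.sum_range_succ'] at hs
  have h2 : ∑ i ∈ Finset.range m, |proj z (i+1) - proj (evec (m+1) 0) (i+1)|
      = ∑ i ∈ Finset.range m, proj z (i+1) := by
    refine Finset.sum_congr rfl fun i hi => ?_
    have := Finset.mem_range.1 hi
    rw [evec_proj _ _ (by omega), if_neg (by omega), sub_zero, abs_of_nonneg (proj_nonneg hz _)]
  have h3 : 0 ≤ ∑ i ∈ Finset.range m, proj z (i+1) := Finset.sum_nonneg fun i _ => proj_nonneg hz _
  rw [h2, evec_proj _ _ (by omega), if_pos rfl, abs_of_nonpos (by linarith)]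
  linarith

lemma rep_pos {k : ℕ} (hk : 3 ≤ k) {x : E k} (hx : x ∈ simplex k) (j : ℕ) :
    ∃ i, i < k ∧ 0 < proj (up (List.replicate j 0) x) i ∧ (j ≤ i ∨ i = k - 1) := by
  induction j with
  | zero =>
    by_contra hn
    push Not at hn
    have h1 := (simplex_iff.1 hx).2
    rw [Finset.sum_eq_zero fun i hi => ?_] at h1
    · norm_num at h1
    · by_contra hne
      have h2 : 0 < proj x i := lt_of_le_of_ne (proj_nonneg hx _) (Ne.symm hne)
      have := hn i (Finset.mem_range.1 hi) h2
      omega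
  | succ j ih =>
    obtain ⟨i, hi, h1, h2⟩ := ih
    have hy := up_simplex hk (List.replicate j 0) hx
    have hd := kden_pos 0 hy
    rw [List.replicate_succ]
    change ∃ i, i < k ∧ 0 < proj (Kinv 0 (up _ x)) i ∧ _
    have p1 := proj_nonneg hy (k-1)
    have p2 := proj_nonneg hy (k-2)
    rcases idx_cases2 hi with hi | rfl | rfl
    · refine ⟨i+1, by omega, ?_, by omega⟩
      rw [Kinv_mid _ _ hi]; exact div_pos h1 (by linarith)
    · refine ⟨k-1, by omega, ?_, by omega⟩
      rw [Kinv_last hk]; exact div_pos (by linarith) (by linarith)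
    · refine ⟨k-1, by omega, ?_, by omega⟩
      rw [Kinv_last hk]; exact div_pos (by linarith) (by linarith)

lemma rep_bound {k : ℕ} (hk : 3 ≤ k) : ∃ δ : ℝ, 0 < δ ∧ ∀ x ∈ simplex k,
    δ ≤ proj (up (List.replicate k 0) x) (k-1) := by
  have hc : ContinuousOn (fun x : E k => proj (up (List.replicate k 0) x) (k-1)) (simplex k) :=
    (proj_cont (k-1)).comp_continuousOn (up_cont hk _)
  obtain ⟨x, hx, hm⟩ := (simplex_compact k).exists_isMinOn ⟨_, evec_simplex (by omega : 0 < k)⟩ hc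
  refine ⟨_, ?_, fun y hy => hm hy⟩
  obtain ⟨i, h1, h2, h3⟩ := rep_pos hk hx k
  obtain rfl : i = k - 1 := by omega
  exact h2

lemma ext_word {k : ℕ} (hk : 3 ≤ k) (g : List ℕ) {c : ℕ → ℤ} (hc : ∃ i, i < k ∧ c i ≠ 0)
    {ε : ℝ} (hε : 0 < ε) : ∃ h : List ℕ,
      (∀ x ∈ simplex k, ∀ y ∈ simplex k, dist (up (g ++ h) x) (up (g ++ h) y) < ε) ∧
      ∀ x : E k, x ∈ simplex k → LF c (up (g ++ h) x) ≠ 0 := by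
  obtain ⟨c', hc', hcc⟩ := LF_pull_list hk g hc
  obtain ⟨j, hj⟩ := LF_rep hk hc'
  have he0 := evec_simplex (by omega : 0 < k)
  have hne : LF c (up (g ++ List.replicate j 0) (evec k 0)) ≠ 0 := by
    rw [up_append]; intro h; exact hj (hcc _ (up_simplex hk _ he0) h)
  set f : E k → E k := up (g ++ List.replicate j 0) with hf
  have hfc : ContinuousWithinAt f (simplex k) (evec k 0) := up_cont hk _ _ he0
  have h1 : ∀ᶠ x in 𝓝[simplex k] (evec k 0), dist (f x) (f (evec k 0)) < ε/2 :=
    hfc (Metric.ball_mem_nhds _ (by positivity))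
  have h2 : ∀ᶠ x in 𝓝[simplex k] (evec k 0), LF c (f x) ≠ 0 :=
    ((LF_cont c).continuousAt.comp_continuousWithinAt hfc).eventually_ne hne
  obtain ⟨δ, hδ, hb⟩ := Metric.mem_nhdsWithin_iff.1 (h1.and h2)
  obtain ⟨η, hη, hr⟩ := rep_bound hk
  obtain ⟨N, hN⟩ := exists_nat_gt (2 / (η * δ))
  have key : ∀ x ∈ simplex k, Kinv N (up (List.replicate k 0) x) ∈ Metric.ball (evec k 0) δ ∩ simplex k := by
    intro x hx
    have hy := up_simplex hk (List.replicate k 0) hx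
    refine ⟨?_, Kinv_simplex hk _ hy⟩
    set y := up (List.replicate k 0) x with hyd
    have hyl : η ≤ proj y (k-1) := hr x hx
    have hyp := proj_nonneg hy (k-2)
    have hd := kden_pos N hy
    have hN0 : (0:ℝ) < N := lt_of_le_of_lt (by positivity) hN
    have hd2 : N * η ≤ kden N y := by
      unfold kden
      have : (N:ℝ) * η ≤ N * proj y (k-1) := by gcongr
      have : 0 ≤ ((N:ℝ)+1) * proj y (k-2) := by positivity
      linarith
    have h1 : 1 - proj (Kinv N y) 0 = 1 / kden N y := by
      rw [Kinv_zero hk]; field_simp; unfold kden; ring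
    rw [Metric.mem_ball]
    refine lt_of_le_of_lt (dist_e0 hk (Kinv_simplex hk _ hy)) ?_
    rw [h1]
    have : 1 / kden N y ≤ 1 / (N * η) := one_div_le_one_div_of_le (by positivity) hd2
    have h3 : 2 * (1 / (N * η)) < δ := by
      rw [div_lt_iff₀ (by positivity)] at hN
      rw [mul_one_div, div_lt_iff₀ (by positivity)]
      linarith
    linarith
  have e : ∀ x : E k, up (g ++ (List.replicate j 0 ++ N :: List.replicate k 0)) x
      = f (Kinv N (up (List.replicate k 0) x)) := by
    intro x
    rw [← List.append_assoc, up_append, hf]; rfl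
  refine ⟨List.replicate j 0 ++ N :: List.replicate k 0, ?_, ?_⟩
  · intro x hx y hy
    rw [e, e]
    have a1 := (hb (key x hx)).1
    have a2 := (hb (key y hy)).1
    have := dist_triangle_right (f (Kinv N (up (List.replicate k 0) x)))
      (f (Kinv N (up (List.replicate k 0) y))) (f (evec k 0))
    linarith
  · intro x hx
    rw [e]
    exact (hb (key x hx)).2

/-- Index set of the countably many conditions. -/
abbrev Idx (k : ℕ) : Type := ℕ × {c : Fin k → ℤ // ∃ i, c i ≠ 0}

def VV {k : ℕ} (p : Idx k) (g : List ℕ) : Prop :=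
  p.1 + 1 ≤ g.length ∧
  (∀ x ∈ simplex k, ∀ y ∈ simplex k, dist (up g x) (up g y) < 1 / ((p.1 : ℝ) + 1)) ∧
  ∀ x ∈ simplex k, ∑ i, (p.2.1 i : ℝ) * (up g x) i ≠ 0

lemma VV_mk {k : ℕ} (hk : 3 ≤ k) {p : Idx k} {g t : List ℕ} (h0 : p.1 + 1 ≤ (g ++ t).length)
    (h1 : ∀ x ∈ simplex k, ∀ y ∈ simplex k, dist (up g x) (up g y) < 1 / ((p.1 : ℝ) + 1))
    (h2 : ∀ x ∈ simplex k, ∑ i, (p.2.1 i : ℝ) * (up g x) i ≠ 0) : VV p (g ++ t) := by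
  refine ⟨h0, ?_, ?_⟩
  · intro x hx y hy
    rw [up_append, up_append]
    exact h1 _ (up_simplex hk t hx) _ (up_simplex hk t hy)
  · intro x hx
    rw [up_append]
    exact h2 _ (up_simplex hk t hx)

lemma VV_ext {k : ℕ} (hk : 3 ≤ k) {p : Idx k} {g : List ℕ} (h : VV p g) (t : List ℕ) :
    VV p (g ++ t) :=
  VV_mk hk (by rw [List.length_append]; have := h.1; omega) h.2.1 h.2.2

lemma VV_exists {k : ℕ} (hk : 3 ≤ k) (p : Idx k) (g : List ℕ) :
    ∃ t : List ℕ, VV p (g ++ t ++ [2]) := by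
  obtain ⟨i, hi⟩ := p.2.2
  obtain ⟨h, h1, h2⟩ := ext_word hk g (c := fun i => if h : i < k then p.2.1 ⟨i, h⟩ else 0)
    ⟨i, i.2, by simpa using hi⟩ (ε := 1 / ((p.1 : ℝ) + 1)) (by positivity)
  have h3 : ∀ x ∈ simplex k, ∑ i, (p.2.1 i : ℝ) * (up (g ++ h) x) i ≠ 0 := by
    intro x hx h4
    refine h2 x hx ?_
    unfold LF
    rw [Finset.sum_range]
    simpa [proj_fin] using h4
  refine ⟨h ++ List.replicate (p.1 + 1) 0, ?_⟩
  have e : g ++ (h ++ List.replicate (p.1+1) 0) ++ [2]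
      = (g ++ h) ++ (List.replicate (p.1+1) 0 ++ [2]) := by simp
  rw [e]
  refine VV_mk hk ?_ h1 h3
  simp only [List.length_append, List.length_replicate]
  omega

lemma chain {ι : Type*} (G : ι → List ℕ) (hp : ∀ p q, G p <+: G q ∨ G q <+: G p)
    (hl : ∀ N, ∃ p, N ≤ (G p).length) : ∃ n : ℕ → ℕ, ∀ p, pre n (G p).length = G p := by
  choose P hP using fun i => hl (i+1)
  refine ⟨fun i => (G (P i)).getD i 0, fun p => ?_⟩
  refine List.ext_getElem (by rw [pre_length]) fun i h1 h2 => ?_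
  have h3 := hP i
  simp only [pre, List.getElem_map, List.getElem_range]
  rw [List.getD_eq_getElem _ _ (by omega)]
  rcases hp (P i) p with h | h
  · exact h.getElem (by omega)
  · exact (h.getElem h2).symm

def Good (k : ℕ) (n : ℕ → ℕ) : Prop := InfBig n ∧ ∀ p : Idx k, ∃ r, VV p (pre n r)

instance idx_ne {k : ℕ} [NeZero k] : Nonempty (Idx k) := ⟨(0, ⟨fun _ => 1, 0, by simp⟩)⟩

lemma good_exists {k : ℕ} (hk : 3 ≤ k) (g : List ℕ) :
    ∃ n : ℕ → ℕ, pre n g.length = g ∧ Good k n := by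
  have : NeZero k := ⟨by omega⟩
  obtain ⟨e, he⟩ := exists_surjective_nat (Idx k)
  choose T hT using fun (p : Idx k) (g : List ℕ) => VV_exists hk p g
  let G : ℕ → List ℕ := fun j => Nat.rec g (fun j l => l ++ T (e j) l ++ [2]) j
  have G0 : G 0 = g := rfl
  have GS : ∀ j, G (j+1) = G j ++ T (e j) (G j) ++ [2] := fun j => rfl
  have hmono : ∀ i d, G i <+: G (i + d) := by
    intro i d
    induction d with
    | zero => exact List.prefix_rfl
    | succ d ih =>
      rw [← add_assoc, GS, List.append_assoc]
      exact ih.trans (List.prefix_append _ _)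
  have hlen : ∀ j, j ≤ (G j).length := by
    intro j
    induction j with
    | zero => omega
    | succ j ih => rw [GS]; simp; omega
  obtain ⟨n, hn⟩ := chain G (fun p q => by
    rcases le_total p q with h | h
    · obtain ⟨d, rfl⟩ := Nat.exists_eq_add_of_le h; exact Or.inl (hmono _ _)
    · obtain ⟨d, rfl⟩ := Nat.exists_eq_add_of_le h; exact Or.inr (hmono _ _))
    (fun N => ⟨N, hlen N⟩)
  refine ⟨n, hn 0, ?_, ?_⟩
  · intro N
    have h1 := hn (N+1)
    have h2 : (G (N+1)).length = (G N ++ T (e N) (G N)).length + 1 := by rw [GS, List.length_append]; rfl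
    rw [h2, pre_succ, GS] at h1
    have h3 := List.append_inj_right h1 (by rw [pre_length])
    refine ⟨_, ?_, (List.cons.inj h3).1.symm.le⟩
    have := hlen N
    rw [List.length_append]; omega
  · intro p
    obtain ⟨j, rfl⟩ := he p
    refine ⟨(G (j+1)).length, ?_⟩
    rw [hn (j+1), GS]; exact hT _ _

def Iw (k : ℕ) (g : List ℕ) (d : Seq) : Prop :=
  seqLe (lamList k g (baseSeq k)) d ∧ seqLe d (lamList k g (topSeq k))

lemma base_head (k : ℕ) : baseSeq k 0 = k - 1 := by unfold baseSeq; simp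

lemma comparable_aux {k : ℕ} (hk : 3 ≤ k) (g : List ℕ) : ∀ g' : List ℕ,
    seqLe (lamList k g (baseSeq k)) (lamList k g' (topSeq k)) →
    seqLe (lamList k g' (baseSeq k)) (lamList k g (topSeq k)) → g <+: g' ∨ g' <+: g := by
  induction g with
  | nil => intro g' _ _; exact Or.inl (⟨_, rfl⟩)
  | cons a t ih =>
    intro g' h1 h2
    cases g' with
    | nil => exact Or.inr (⟨_, rfl⟩)
    | cons b t' =>
      change seqLe (lamSub k a (lamList k t (baseSeq k))) (lamSub k b (lamList k t' (topSeq k))) at h1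
      change seqLe (lamSub k b (lamList k t' (baseSeq k))) (lamSub k a (lamList k t (topSeq k))) at h2
      have hb := fun g => ll_head hk g (base_head k)
      have ht := fun g => ll_head hk g (w := topSeq k) rfl
      rcases lt_trichotomy a b with hab | rfl | hab
      · exact absurd (lam_lt_index hk hab (hb t) (ht t')) (not_lt_of_seqLe h1)
      · have h1' := lam_le_rev hk (ll_sigma hk t (base_sigma hk)) h1
        have h2' := lam_le_rev hk (ll_sigma hk t' (base_sigma hk)) h2
        rcases ih t' h1' h2' with h | h
        · exact Or.inl ((List.prefix_cons_inj a).2 h)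
        · exact Or.inr ((List.prefix_cons_inj a).2 h)
      · exact absurd (lam_lt_index hk hab (hb t') (ht t)) (not_lt_of_seqLe h2)

lemma Iw_comparable {k : ℕ} (hk : 3 ≤ k) {g g' : List ℕ} {d : Seq} (h : Iw k g d)
    (h' : Iw k g' d) : g <+: g' ∨ g' <+: g :=
  comparable_aux hk g g' (seqLe_trans h.1 h'.2) (seqLe_trans h'.1 h.2)

lemma squeeze {u v d : Seq} (h1 : seqLe u d) (h2 : seqLe d v) {i : ℕ}
    (h : ∀ j, j ≤ i → u j = v j) : ∀ j, j ≤ i → d j = v j := by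
  intro j
  induction j using Nat.strong_induction_on with
  | _ j ih =>
    intro hj
    rw [seqLe_iff] at h1 h2
    have a1 := h2 j fun l hl => ih l hl (by omega)
    have a2 := h1 j fun l hl => by rw [ih l hl (by omega), h l (by omega)]
    rw [h j hj] at a2
    omega

lemma S_of_Iw {k : ℕ} (hk : 3 ≤ k) {n : ℕ → ℕ} {d : Seq}
    (h : ∀ N, ∃ r, N ≤ r ∧ Iw k (pre n r) d) : d = Sseq k n := by
  funext i
  obtain ⟨r, hr, h1, h2⟩ := h (k * i + 1)
  rw [S_agree hk n (top_sigma hk) rfl hr]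
  refine squeeze h1 h2 (fun j hj => ?_) i le_rfl
  refine ll_agree hk (base_sigma hk) (top_sigma hk) (base_head k) rfl ?_
  rw [pre_length]
  have : k * j ≤ k * i := Nat.mul_le_mul_left _ hj
  omega

lemma freq_ll {k : ℕ} (hk : 3 ≤ k) (g : List ℕ) {u : Seq} (hu : InSigma k u) {y : E k}
    (h : HasDigitFreq k u y) : HasDigitFreq k (lamList k g u) (up g y) := by
  induction g with
  | nil => exact h
  | cons a t ih => exact freq_lam hk a (ll_sigma hk t hu) ih

lemma freq_const (k j : ℕ) : HasDigitFreq k (fun _ => j) (evec k j) := by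
  intro i hi
  rw [evec_proj k j hi]
  split_ifs with h
  · subst h
    refine tendsto_const_nhds.congr' ?_
    filter_upwards [eventually_gt_atTop 0] with r hr
    have : digitCount (fun _ => i) i r = r := by simp [digitCount]
    rw [this, div_self]
    exact_mod_cast hr.ne'
  · refine tendsto_const_nhds.congr fun r => ?_
    have : digitCount (fun _ => j) i r = 0 := by simp [digitCount, Ne.symm h]
    rw [this]; simp

lemma ll_top_NoZ {k : ℕ} (hk : 3 ≤ k) (g : List ℕ) : ∃ M, NoZ M (lamList k g (topSeq k)) := by
  cases g with
  | nil => exact ⟨1, fun t => ⟨0, by omega, by change k - 1 ≠ 0; omega⟩⟩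
  | cons a t => exact ⟨_, lam_NoZ hk a _⟩

lemma Iw_of_O {k : ℕ} (hk : 3 ≤ k) {g : List ℕ} {β : ℝ} (hb : (k:ℝ) - 1 < β) (hβk : β < k)
    (h1 : ¬ DFbeta k β ⊆ closure (DFw k (lamList k g (baseSeq k))))
    (h2 : up g (Kinv 1 (evec k (k-1))) ∉ DFbeta k β) : Iw k g (dbeta β 1) := by
  have hk3 : (3:ℝ) ≤ k := by exact_mod_cast hk
  constructor
  · refine seqLe_of_not_lt fun h => h1 ?_
    exact ((DFbeta_sub (by linarith) hβk).trans (DFw_mono (Or.inl h))).trans subset_closure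
  · refine seqLe_of_not_lt fun h => h2 ?_
    obtain ⟨M, hM⟩ := ll_top_NoZ hk g
    have hs : InSigma k (lamSub k 1 (topSeq k)) := lam_sigma hk _ _
    have hmax := ll_max hk g hs (lam_head hk 1 rfl) (lam_max hk 1 (top_sigma hk) rfl (top_max k))
    have hlt : seqLt (lamSub k 1 (topSeq k)) (topSeq k) := by
      have := lam_lt_index hk (show 0 < 1 by omega) (u := topSeq k) (u' := topSeq k) rfl rfl
      rwa [lam_top hk] at this
    refine lemA (v := lamList k g (lamSub k 1 (topSeq k))) (by linarith) (ll_sigma hk g hs)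
      (ll_sigma hk g (top_sigma hk)) (ll_max hk g (top_sigma hk) rfl (top_max k)) hM (Or.inl h)
      (fun r => seqLt_of_le_of_lt (hmax r) (ll_lt hk g (top_sigma hk) hlt)) ?_
    exact freq_ll hk g hs (freq_lam hk 1 (top_sigma hk) (freq_const k (k-1)))

lemma good_fiber {k : ℕ} (hk : 3 ≤ k) {n : ℕ → ℕ} (h : ∀ p : Idx k, ∃ r, VV p (pre n r)) :
    ∃ α ∈ simplex k, Irr α ∧ (∀ r, α ∈ up (pre n r) '' simplex k) ∧ PhiFiber k n = {α} := by
  obtain ⟨α, hα, hn⟩ := nested hk n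
  have hi : Irr α := by
    intro c hc
    obtain ⟨r, hr⟩ := h (0, ⟨c, hc⟩)
    obtain ⟨y, hy, rfl⟩ := hn r
    exact hr.2.2 y hy
  refine ⟨α, hα, hi, hn, fiber_eq hk hα hi hn fun x hx => ?_⟩
  have : NeZero k := ⟨by omega⟩
  obtain ⟨p0⟩ := idx_ne (k := k)
  refine dist_le_zero.1 (le_of_forall_pos_le_add fun ε hε => ?_)
  obtain ⟨m, hm⟩ := exists_nat_one_div_lt hε
  obtain ⟨r, hr⟩ := h (m, p0.2)
  obtain ⟨y, hy, rfl⟩ := hn r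
  obtain ⟨z, hz, rfl⟩ := hx r
  have := hr.2.1 z hz y hy
  simp only at this
  linarith

lemma base_last {k : ℕ} (hk : 3 ≤ k) {α : E k} (h : α ∈ DFw k (baseSeq k)) : proj α (k-1) = 0 := by
  obtain ⟨_, v, hv, hf⟩ := h
  have key : ∀ t s, v t = k - 1 → v (t + (s+1)) = 0 := by
    intro t s
    induction s using Nat.strong_induction_on with
    | _ s ih =>
      intro ht
      have h1 := (seqLe_iff.1 (hv.2 t)) (s+1) ?_
      · rw [shift_iter] at h1
        unfold baseSeq at h1
        rw [if_neg (by omega)] at h1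
        rw [add_comm] at h1
        omega
      · intro i hi
        rw [shift_iter]
        unfold baseSeq
        rcases Nat.eq_zero_or_pos i with rfl | hi0
        · simpa using ht
        · rw [if_neg (by omega)]
          have := ih (i-1) (by omega) ht
          rw [show i - 1 + 1 = i by omega, add_comm] at this
          exact this
  have hc : ∀ r, digitCount v (k-1) r ≤ 1 := by
    intro r
    unfold digitCount
    rw [Finset.card_le_one]
    intro a ha b hb
    rw [Finset.mem_filter] at ha hb
    rcases lt_trichotomy a b with h | h | h
    · have := key a (b - a - 1) ha.2
      rw [show a + (b - a - 1 + 1) = b by omega, hb.2] at this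
      omega
    · exact h
    · have := key b (a - b - 1) hb.2
      rw [show b + (a - b - 1 + 1) = a by omega, ha.2] at this
      omega
  refine tendsto_nhds_unique (hf (k-1) (by omega)) ?_
  refine squeeze_zero (fun r => by positivity) (g := fun r : ℕ => 1 / (r:ℝ)) (fun r => ?_)
    tendsto_one_div_atTop_nhds_zero_nat
  gcongr
  exact_mod_cast hc r

lemma Kinv_strict {k : ℕ} (hk : 3 ≤ k) (a : ℕ) {y : E k} (hy : y ∈ simplex k)
    (h : 0 < proj y (k-1)) : proj (Kinv a y) 0 < ((a:ℝ)+1) * proj (Kinv a y) (k-1) := by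
  have hd : 0 < kden a y := by have := kden_pos a hy; linarith
  rw [Kinv_zero hk, Kinv_last hk, ← mul_div_assoc]
  gcongr
  linarith

lemma not_base {k : ℕ} (hk : 3 ≤ k) (r : ℕ) : ∀ {n : ℕ → ℕ} {α : E k}, α ∈ simplex k → Irr α →
    (∀ r, α ∈ up (pre n r) '' simplex k) → α ∉ DFw k (lamList k (pre n r) (baseSeq k)) := by
  induction r with
  | zero =>
    intro n α h1 h2 _ h
    have h3 := base_last hk h
    have := irr_pos h1 h2 (i := k-1) (by omega)
    linarith
  | succ r ih =>
    intro n α h1 h2 h3 h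
    obtain ⟨h4, h5, h6, h7⟩ := fiber_step hk h1 h2 h3
    rw [pre_succ'] at h
    have h8 := (step_simplex' hk (mem_simplex'.2 ⟨h1, irr_pos h1 h2 (by omega)⟩)).2
    refine ih h5 h6 h7 ?_
    have h9 := Kinv_strict hk (Jfun α) h5 (irr_pos h5 h6 (by omega))
    rw [← h8, h4] at h9
    have := DF_R hk (n 0) (ll_sigma hk _ (base_sigma hk)) (ll_head hk _ (base_head k)) h h9
    unfold Kstep
    rw [h4]; exact this

lemma e0_DF {k : ℕ} (hk : 3 ≤ k) {w : Seq} (hw0 : w 0 = k - 1) : evec k 0 ∈ DFw k w := by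
  rw [mem_DFw]
  refine ⟨fun _ => 0, ⟨fun r => by change 0 < k; omega, fun r => ?_⟩, freq_const k 0⟩
  refine seqLe_of_head_lt ?_
  rw [shift_iter, hw0]; omega

lemma DF_S_list {k : ℕ} (hk : 3 ≤ k) (g : List ℕ) {w : Seq} (hw : InSigma k w) (hw0 : w 0 = k - 1)
    {y : E k} (h : y ∈ DFw k w) : up g y ∈ DFw k (lamList k g w) := by
  induction g with
  | nil => exact h
  | cons a t ih => exact DF_S hk a (ll_sigma hk t hw) (ll_head hk t hw0) ih

lemma alpha_mem {k : ℕ} (hk : 3 ≤ k) {n : ℕ → ℕ} (h : ∀ p : Idx k, ∃ r, VV p (pre n r)) {α : E k}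
    (hn : ∀ r, α ∈ up (pre n r) '' simplex k) : α ∈ DFw k (Sseq k n) := by
  have hcl := DF_closed hk (S_head hk n) (S_NoZ hk n)
  rw [← hcl.closure_eq, Metric.mem_closure_iff]
  intro ε hε
  have : NeZero k := ⟨by omega⟩
  obtain ⟨p0⟩ := idx_ne (k := k)
  obtain ⟨m, hm⟩ := exists_nat_one_div_lt hε
  obtain ⟨r, hr⟩ := h (m, p0.2)
  obtain ⟨y, hy, rfl⟩ := hn r
  refine ⟨up (pre n r) (evec k 0), ?_, ?_⟩
  · rw [S_add hk n r]
    exact DF_S_list hk _ (S_sigma hk _) (S_head hk _) (e0_DF hk (S_head hk _))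
  · have := hr.2.1 y hy _ (evec_simplex (by omega : 0 < k))
    simp only at this
    linarith

lemma half_last {k : ℕ} (hk : 3 ≤ k) :
    proj (Kinv 1 (evec k (k-1))) 0 = 1/2 ∧ proj (Kinv 1 (evec k (k-1))) (k-1) = 1/2 := by
  rw [Kinv_zero hk, Kinv_last hk]
  unfold kden
  rw [evec_proj k _ (by omega), evec_proj k _ (by omega), if_neg (by omega), if_pos rfl]
  norm_num

lemma up_last_pos {k : ℕ} (hk : 3 ≤ k) (g : List ℕ) {y : E k} (hy : y ∈ simplex k)
    (h : 0 < proj y (k-1)) : 0 < proj (up g y) (k-1) := by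
  induction g with
  | nil => exact h
  | cons a t ih => exact Kinv_last_pos hk a (up_simplex hk t hy) ih

lemma not_half {k : ℕ} (hk : 3 ≤ k) (r : ℕ) : ∀ {n : ℕ → ℕ}, 2 ≤ n r →
    up (pre n r) (Kinv 1 (evec k (k-1))) ∉ DFw k (Sseq k n) := by
  obtain ⟨e1, e2⟩ := half_last hk
  have hs := Kinv_simplex hk 1 (evec_simplex (by omega : k - 1 < k))
  induction r with
  | zero =>
    intro n hn h
    change Kinv 1 (evec k (k-1)) ∈ _ at h
    have hn2 : (2:ℝ) ≤ n 0 := by exact_mod_cast hn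
    rw [S_succ hk] at h
    have h1 := DF_R hk (n 0) (S_sigma hk _) (S_head hk _) h (by rw [e1, e2]; linarith)
    have h2 := proj_nonneg h1.1 (k-2)
    rw [Kmap_pen hk, e1, e2] at h2
    norm_num at h2
    linarith
  | succ r ih =>
    intro n hn h
    refine ih (n := fun i => n (i+1)) hn ?_
    rw [S_succ hk, pre_succ'] at h
    change Kinv (n 0) (up _ _) ∈ _ at h
    set y := up (pre (fun i => n (i+1)) r) (Kinv 1 (evec k (k-1))) with hy
    have hys : y ∈ simplex k := up_simplex hk _ hs
    have h1 := DF_R hk (n 0) (S_sigma hk _) (S_head hk _) h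
      (Kinv_strict hk _ hys (up_last_pos hk _ hs (by rw [e2]; norm_num)))
    rwa [Kmap_Kinv hk _ hys] at h1

lemma DF_top {k : ℕ} (hk : 3 ≤ k) {x : E k} (hx : x ∈ simplex k) : x ∈ DFw k (topSeq k) := by
  rw [simplex_iff] at hx
  obtain ⟨u, hu, hf⟩ := exists_freq hk (fun i => proj x i) hx.1 hx.2
  rw [mem_DFw]
  exact ⟨u, ⟨hu, fun r => le_top (fun t => by rw [shift_iter]; exact hu _)⟩, hf⟩

lemma gap_base {k : ℕ} (hk : 3 ≤ k) (a : ℕ) :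
    DFw k (lamSub k a (baseSeq k)) ⊆ DFw k (lamSub k (a+1) (topSeq k)) := by
  intro α hα
  have hs : α ∈ simplex k := hα.1
  have h0 : 0 ≤ proj α (k-1) := proj_nonneg hs _
  have h1 : ((a:ℝ)+1) * proj α (k-1) ≤ proj α 0 := by
    by_contra hc
    push Not at hc
    have h2 := base_last hk (DF_R hk a (base_sigma hk) (base_head k) hα hc)
    rw [Kmap_last hk] at h2
    have hpos : 0 < proj α (k-1) := by
      rcases h0.lt_or_eq with h | h
      · exact h
      · rw [← h] at hc
        have := proj_nonneg hs 0
        linarith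
    have hl := head_lt_one hk hs hpos
    have : 0 < ((a+1) * proj α (k - 1) - proj α 0) / (1 - proj α 0) :=
      div_pos (by linarith) (by linarith)
    linarith
  by_cases h2 : (((a+1:ℕ):ℝ)+1) * proj α (k-1) ≤ proj α 0
  · exact DF_T hk (a+1) rfl hs h2
  · push Not at h2
    have hpos : 0 < proj α (k-1) := by
      rcases h0.lt_or_eq with h | h
      · exact h
      · rw [← h] at h2
        have := proj_nonneg hs 0
        linarith
    have hl := head_lt_one hk hs hpos
    have h3 : Kmap (a+1) α ∈ simplex k := by
      refine Kmap_simplex hk hs hl ?_ h2.le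
      push_cast; linarith
    have := DF_S hk (a+1) (top_sigma hk) rfl (DF_top hk h3)
    rwa [Kinv_Kmap hk _ hl] at this

lemma gap_list {k : ℕ} (hk : 3 ≤ k) (g : List ℕ) (a : ℕ) :
    DFw k (lamList k (g ++ [a]) (baseSeq k)) ⊆ DFw k (lamList k (g ++ [a+1]) (topSeq k)) := by
  induction g with
  | nil => exact gap_base hk a
  | cons b t ih =>
    intro α hα
    have hα' : α ∈ DFw k (lamSub k b (lamList k (t ++ [a]) (baseSeq k))) := hα
    change α ∈ DFw k (lamSub k b (lamList k (t ++ [a+1]) (topSeq k)))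
    have hs : α ∈ simplex k := hα.1
    by_cases h : ((b:ℝ)+1) * proj α (k-1) ≤ proj α 0
    · exact DF_T hk b (ll_head hk _ rfl) hs h
    · push Not at h
      have h0 : 0 ≤ proj α (k-1) := proj_nonneg hs _
      have hpos : 0 < proj α (k-1) := by
        rcases h0.lt_or_eq with h' | h'
        · exact h'
        · rw [← h'] at h
          have := proj_nonneg hs 0
          linarith
      have hl := head_lt_one hk hs hpos
      have h1 := ih (DF_R hk b (ll_sigma hk _ (base_sigma hk)) (ll_head hk _ (base_head k)) hα' h)
      have := DF_S hk b (ll_sigma hk _ (top_sigma hk)) (ll_head hk _ rfl) h1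
      rwa [Kinv_Kmap hk _ hl] at this

lemma ll_pfx {k : ℕ} (g : List ℕ) {u u' : Seq} {m : ℕ} (h : ∀ i, i < m → u i = u' i) :
    ∀ i, i < m → lamList k g u i = lamList k g u' i := by
  induction g with
  | nil => exact h
  | cons a t ih => exact lam_pfx ih

def Gap (k : ℕ) (h : List ℕ) (a : ℕ) (d : Seq) : Prop :=
  seqLe (lamList k (h ++ [a+1]) (topSeq k)) d ∧ seqLe d (lamList k (h ++ [a]) (baseSeq k))

lemma Iw_step {k : ℕ} (hk : 3 ≤ k) {d : Seq} (hb : seqLt (baseSeq k) d) {g : List ℕ}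
    (hg : Iw k g d) : (∃ c, Iw k (g ++ [c]) d) ∨ ∃ h a, Gap k h a d := by
  rcases hg.1 with hlt | heq
  · obtain ⟨r, hag, hr⟩ := hlt
    have hex : ∃ a, seqLe (lamList k (g ++ [a]) (baseSeq k)) d := by
      refine ⟨r, Or.inl ⟨r, ?_, ?_⟩⟩
      all_goals
        have hp : ∀ i, i < r + 1 → lamList k (g ++ [r]) (baseSeq k) i
            = lamList k g (baseSeq k) i := by
          rw [lamList_append]
          apply ll_pfx
          intro i hi
          change lamSub k r (baseSeq k) i = _
          rcases Nat.eq_zero_or_pos i with h0 | h0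
          · subst h0
            rw [lam_head hk r (base_head k), base_head]
          · rw [(lam_digits hk r (base_head k)).1 i h0 (by omega)]
            unfold baseSeq
            rw [if_neg (by omega)]
      · intro s hs
        rw [hp s (by omega)]; exact hag s hs
      · rw [hp r (by omega)]; exact hr
    have h1 := Nat.find_spec hex
    have h2 := fun m => @Nat.find_min _ _ hex m
    generalize Nat.find hex = a at h1 h2
    cases a with
    | zero =>
      left
      refine ⟨0, h1, ?_⟩
      rw [lamList_append]
      change seqLe d (lamList k g (lamSub k 0 (topSeq k)))
      rw [lam_top hk]
      exact hg.2
    | succ b =>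
      by_cases h3 : seqLe d (lamList k (g ++ [b+1]) (topSeq k))
      · exact Or.inl ⟨b+1, h1, h3⟩
      · right
        refine ⟨g, b, ?_, ?_⟩
        · exact seqLe_of_not_lt fun h => h3 (Or.inl h)
        · exact seqLe_of_not_lt fun h => h2 b (by omega) (Or.inl h)
  · right
    rcases List.eq_nil_or_concat' g with h | ⟨g', a, h⟩
    · subst h
      have : baseSeq k = d := heq
      rw [← this] at hb
      exact absurd hb (seqLt_irrefl _)
    · subst h
      refine ⟨g', a, ?_, Or.inr heq.symm⟩
      rw [← heq, lamList_append, lamList_append]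
      apply ll_le hk
      · exact ll_sigma hk _ (base_sigma hk)
      · exact Or.inl (lam_lt_index hk (Nat.lt_succ_self a) (base_head k) rfl)

lemma cases_d {k : ℕ} (hk : 3 ≤ k) {d : Seq} (hb : seqLt (baseSeq k) d) (hd : InSigma k d) :
    (∃ n, d = Sseq k n) ∨ ∃ h a, Gap k h a d := by
  by_cases hgap : ∃ h a, Gap k h a d
  · exact Or.inr hgap
  left
  have hst : ∀ g, Iw k g d → ∃ c, Iw k (g ++ [c]) d := fun g hg =>
    (Iw_step hk hb hg).resolve_right hgap
  have h0 : Iw k [] d := ⟨Or.inl hb, le_top hd⟩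
  choose! c hc using hst
  let G : ℕ → List ℕ := fun j => Nat.rec [] (fun _ g => g ++ [c g]) j
  have hG : ∀ j, G (j+1) = G j ++ [c (G j)] := fun j => rfl
  have hI : ∀ j, Iw k (G j) d := by
    intro j
    induction j with
    | zero => exact h0
    | succ j ih => rw [hG]; exact hc _ ih
  have hl : ∀ j, (G j).length = j := by
    intro j
    induction j with
    | zero => rfl
    | succ j ih => rw [hG, List.length_append, ih]; rfl
  obtain ⟨n, hn⟩ := chain G (fun p q => Iw_comparable hk (hI p) (hI q))
    (fun N => ⟨N, (hl N).ge⟩)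
  refine ⟨n, S_of_Iw hk fun N => ⟨N, le_rfl, ?_⟩⟩
  have := hn N
  rw [hl] at this
  rw [this]; exact hI N

lemma exists_L (c : ℕ) {ε : ℝ} (hε : 0 < ε) : ∃ L : ℕ, 0 < L ∧ 2 * ((c + 2 : ℕ) : ℝ) / L ≤ ε := by
  obtain ⟨L, hL⟩ := exists_nat_gt (2 * ((c + 2 : ℕ) : ℝ) / ε)
  have hp : (0:ℝ) < 2 * ((c + 2 : ℕ) : ℝ) / ε := by positivity
  have hL0 : (0:ℝ) < L := hp.trans hL
  refine ⟨L, by exact_mod_cast hL0, ?_⟩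
  rw [div_le_iff₀ hL0]
  rw [div_lt_iff₀ hε] at hL
  linarith

lemma beta_one {k : ℕ} (hk : 3 ≤ k) {β : ℝ} (h : (k:ℝ) - 1 < β) : 1 < β := by
  have : (3:ℝ) ≤ k := by exact_mod_cast hk
  linarith

lemma pre_head {n : ℕ → ℕ} {r c : ℕ} {t : List ℕ} (h : pre n r = c :: t) : n 0 = c := by
  cases r with
  | zero => simp [pre] at h
  | succ r => rw [pre_succ'] at h; exact (List.cons.inj h).1

lemma approx {k : ℕ} (hk : 3 ≤ k) {β : ℝ} (hb : (k:ℝ) - 1 < β) (hβk : β < k) {ε : ℝ} (hε : 0 < ε) :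
    ∃ n, Good k n ∧ (∀ x ∈ DFbeta k β, ∃ y ∈ DFw k (Sseq k n), dist x y ≤ ε) ∧
      ∀ y ∈ DFw k (Sseq k n), ∃ x ∈ DFbeta k β, dist y x ≤ ε := by
  have hb1 := beta_one hk hb
  have hb0 : 0 < β := by linarith
  rcases cases_d hk (d_gt hk hb hβk) (dbeta_sigma hb0 hβk one_mem) with ⟨n, hn⟩ | ⟨g, a, hz, hd⟩
  · have hC : DFbeta k β = DFw k (Sseq k n) := by
      rw [DFbeta_eq hb1 hβk (M := n 0 + 2) (by rw [hn]; exact S_NoZ hk n), hn]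
    obtain ⟨L, hL, hLe⟩ := exists_L (n 0) hε
    obtain ⟨m, hm, hg⟩ := good_exists hk (pre n (k * L + 1 + 1))
    rw [pre_length] at hm
    have h0 : m 0 = n 0 := by
      rw [pre_succ' n] at hm
      exact pre_head hm
    have hag : ∀ i, i < L → Sseq k m i = Sseq k n i := by
      intro i hi
      have : k * i + 1 ≤ k * L + 1 + 1 := by
        have := Nat.mul_le_mul_left k hi.le
        omega
      rw [S_agree hk m (top_sigma hk) rfl this, S_agree hk n (top_sigma hk) rfl this, hm]
    refine ⟨m, hg, ?_, ?_⟩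
    · intro x hx
      rw [hC] at hx
      have hM := S_NoZ hk m
      rw [h0] at hM
      obtain ⟨y, hy, hxy⟩ := lemC hk (S_head hk m) hM hL hag hx
      exact ⟨y, hy, hxy.trans hLe⟩
    · intro x hx
      rw [hC]
      obtain ⟨y, hy, hxy⟩ := lemC hk (S_head hk n) (S_NoZ hk n) hL (fun i hi => (hag i hi).symm) hx
      exact ⟨y, hy, hxy.trans hLe⟩
  · obtain ⟨c, t, hct⟩ : ∃ c t, g ++ [a+1] = c :: t := by
      cases g with
      | nil => exact ⟨_, _, rfl⟩
      | cons b t => exact ⟨_, _, rfl⟩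
    obtain ⟨L, hL, hLe⟩ := exists_L c hε
    obtain ⟨m, hm, hg⟩ := good_exists hk ((g ++ [a+1]) ++ List.replicate (k * L + 1) 0)
    have hrep : ∀ j, lamList k (List.replicate j 0) (topSeq k) = topSeq k := by
      intro j
      induction j with
      | zero => rfl
      | succ j ih =>
        rw [List.replicate_succ]
        change lamSub k 0 (lamList k (List.replicate j 0) (topSeq k)) = _
        rw [ih, lam_top hk]
    have h0 : m 0 = c := by
      rw [hct] at hm
      exact pre_head (r := _) (t := t ++ List.replicate (k * L + 1) 0) (by rw [hm]; rfl)
    have hpre : pre m (g ++ [a+1]).length = g ++ [a+1] := by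
      rw [List.length_append (as := g ++ [a+1]), pre_add] at hm
      exact List.append_inj_left hm (by rw [pre_length])
    set z := lamList k (g ++ [a+1]) (topSeq k) with hzdef
    have hzs : InSigma k z := ll_sigma hk _ (top_sigma hk)
    have hz' : z = lamList k (pre m ((g ++ [a+1]) ++ List.replicate (k * L + 1) 0).length)
        (topSeq k) := by
      rw [hm, lamList_append, hrep]
    have hag : ∀ i, i < L → Sseq k m i = z i := by
      intro i hi
      have : k * i + 1 ≤ ((g ++ [a+1]) ++ List.replicate (k * L + 1) 0).length := by
        have := Nat.mul_le_mul_left k hi.le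
        rw [List.length_append, List.length_replicate]
        omega
      rw [S_agree hk m (top_sigma hk) rfl this, hz']
    have hlt : seqLt (Sseq k m) z := by
      rw [S_add hk m (g ++ [a+1]).length, hpre, hzdef]
      apply ll_lt hk _ (top_sigma hk)
      rcases le_top (S_sigma hk fun i => m ((g ++ [a+1]).length + i)) with h | h
      · exact h
      · exfalso
        have hI : InfBig fun i => m ((g ++ [a+1]).length + i) := by
          intro N
          obtain ⟨i, hi, h2⟩ := hg.1 ((g ++ [a+1]).length + N)
          refine ⟨i - (g ++ [a+1]).length, by omega, ?_⟩
          have : (g ++ [a+1]).length + (i - (g ++ [a+1]).length) = i := by omega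
          simpa only [this] using h2
        apply S_nonper hk hI 0
        rw [h]
        rfl
    refine ⟨m, hg, ?_, ?_⟩
    · intro x hx
      have hx1 : x ∈ DFw k z := gap_list hk g a (DFw_mono hd (DFbeta_sub hb0 hβk hx))
      have hM := S_NoZ hk m
      rw [h0] at hM
      obtain ⟨y, hy, hxy⟩ := lemC hk (S_head hk m) hM hL hag hx1
      exact ⟨y, hy, hxy.trans hLe⟩
    · intro y hy
      refine ⟨y, ?_, by rw [dist_self]; exact hε.le⟩
      rw [mem_DFw] at hy
      obtain ⟨v, hv, hf⟩ := hy
      obtain ⟨M, hM⟩ := ll_top_NoZ hk (g ++ [a+1])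
      exact lemA hb1 hv.1 hzs (ll_max hk _ (top_sigma hk) rfl (top_max k)) hM hz
        (fun r => seqLt_of_le_of_lt (hv.2 r) hlt) hf

/-- The basic open sets of `Dopen k`. -/
def OO (k : ℕ) (g : List ℕ) : Set ↥(Dopen k) :=
  {C | ¬ ((C : TopologicalSpace.NonemptyCompacts (E k)) : Set (E k)) ⊆
      closure (DFw k (lamList k g (baseSeq k))) ∧
    up g (Kinv 1 (evec k (k-1))) ∉ ((C : TopologicalSpace.NonemptyCompacts (E k)) : Set (E k))}

lemma OO_open (k : ℕ) (g : List ℕ) : IsOpen (OO k g) := by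
  have h1 := (TopologicalSpace.NonemptyCompacts.isClosed_subsets_of_isClosed
    (isClosed_closure (s := DFw k (lamList k g (baseSeq k))))).isOpen_compl
  have h2 := TopologicalSpace.NonemptyCompacts.isOpen_subsets_of_isOpen
    (isOpen_compl_singleton (x := (up g (Kinv 1 (evec k (k-1))) : E k)))
  have h3 := (h1.inter h2).preimage (continuous_subtype_val (p := fun C => C ∈ Dopen k))
  convert h3 using 1
  ext C
  simp [OO, Set.subset_compl_singleton_iff]

def GG (k : ℕ) : Set ↥(Dopen k) := ⋂ p : Idx k, ⋃ g ∈ {g : List ℕ | VV p g}, OO k g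

lemma GG_Gd (k : ℕ) : IsGδ (GG k) :=
  IsGδ.iInter_of_isOpen fun _ => isOpen_biUnion fun g _ => OO_open k g

lemma GG_mem {k : ℕ} (hk : 3 ≤ k) {C : ↥(Dopen k)} (hC : C ∈ GG k) : ∃ n : ℕ → ℕ,
        ((C : TopologicalSpace.NonemptyCompacts (E k)) : Set (E k)) = DFn k n ∧
        ∃ α : E k, PhiFiber k n = {α} ∧
          ¬ ∃ c : Fin k → ℤ, (∃ i, c i ≠ 0) ∧ ∑ i, (c i : ℝ) * α i = 0 := by
  have : NeZero k := ⟨by omega⟩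
  obtain ⟨C, β, hb, hβk, hCb⟩ := C
  have hb1 := beta_one hk hb
  have hex : ∀ p : Idx k, ∃ g, VV p g ∧ Iw k g (dbeta β 1) := by
    intro p
    have h := Set.mem_iInter.1 hC p
    rw [Set.mem_iUnion₂] at h
    obtain ⟨g, hg, h1, h2⟩ := h
    refine ⟨g, hg, Iw_of_O hk hb hβk ?_ ?_⟩
    · rw [← hCb]; exact h1
    · rw [← hCb]; exact h2
  choose G hV hI using hex
  obtain ⟨p0⟩ : Nonempty (Idx k) := idx_ne
  have hlen : ∀ N, N ≤ (G (N, p0.2)).length := fun N => by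
    have := (hV (N, p0.2)).1
    simp only at this
    omega
  obtain ⟨n, hn⟩ := chain G (fun p q => Iw_comparable hk (hI p) (hI q))
    (fun N => ⟨_, hlen N⟩)
  have hd : dbeta β 1 = Sseq k n := S_of_Iw hk fun N =>
    ⟨_, hlen N, by rw [hn]; exact hI _⟩
  obtain ⟨α, hα, hirr, -, hfib⟩ := good_fiber hk (n := n)
    (fun p => ⟨(G p).length, by rw [hn]; exact hV p⟩)
  refine ⟨n, ?_, α, hfib, ?_⟩
  · change (C : Set (E k)) = DFw k (Sseq k n)
    rw [hCb, DFbeta_eq hb1 hβk (M := n 0 + 2) (by rw [hd]; exact S_NoZ hk n), hd]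
  · rintro ⟨c, hc, h0⟩
    exact hirr c hc h0

lemma good_mem {k : ℕ} (hk : 3 ≤ k) {n : ℕ → ℕ} (hg : Good k n) :
    ∃ C ∈ GG k, ((C : TopologicalSpace.NonemptyCompacts (E k)) : Set (E k)) = DFw k (Sseq k n) := by
  obtain ⟨β, hb, hβk, hd⟩ := S_realize hk hg.1
  have hb1 := beta_one hk hb
  have hcl : IsClosed (DFw k (Sseq k n)) := DF_closed hk (S_head hk n) (S_NoZ hk n)
  have hcomp : IsCompact (DFw k (Sseq k n)) :=
    (simplex_compact k).of_isClosed_subset hcl fun x hx => hx.1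
  let K : TopologicalSpace.NonemptyCompacts (E k) :=
    ⟨⟨DFw k (Sseq k n), hcomp⟩, ⟨_, e0_DF hk (S_head hk n)⟩⟩
  have hK : (K : Set (E k)) = DFw k (Sseq k n) := rfl
  refine ⟨⟨K, β, hb, hβk, ?_⟩, ?_, hK⟩
  · rw [hK, DFbeta_eq hb1 hβk (M := n 0 + 2) (by rw [hd]; exact S_NoZ hk n), hd]
  · refine Set.mem_iInter.2 fun p => ?_
    obtain ⟨r0, hr0⟩ := hg.2 p
    obtain ⟨r, hr, h2⟩ := hg.1 (r0 + 1)
    rw [Set.mem_iUnion₂]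
    refine ⟨pre n r, ?_, ?_, ?_⟩
    · have : r = r0 + (r - r0) := by omega
      rw [this, pre_add]
      exact VV_ext hk hr0 _
    · obtain ⟨α, hα, hirr, him, -⟩ := good_fiber hk hg.2
      intro hsub
      have h1 : α ∈ closure (DFw k (lamList k (pre n r) (baseSeq k))) :=
        hsub (alpha_mem hk hg.2 him)
      obtain ⟨s, rfl⟩ : ∃ s, r = s + 1 := ⟨r - 1, by omega⟩
      have hc2 : IsClosed (DFw k (lamList k (pre n (s+1)) (baseSeq k))) := by
        refine DF_closed hk (ll_head hk _ (base_head k)) (M := n 0 + 2) ?_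
        rw [pre_succ']
        exact lam_NoZ hk _ _
      rw [hc2.closure_eq] at h1
      exact not_base hk (s+1) hα hirr him h1
    · exact not_half hk r h2

lemma GG_dense {k : ℕ} (hk : 3 ≤ k) : Dense (GG k) := by
  intro C
  rw [Metric.mem_closure_iff]
  intro ε hε
  obtain ⟨C, β, hb, hβk, hCb⟩ := C
  obtain ⟨n, hg, h1, h2⟩ := approx hk hb hβk (half_pos hε)
  obtain ⟨B, hB, hBs⟩ := good_mem hk hg
  refine ⟨B, hB, ?_⟩
  rw [Subtype.dist_eq, Metric.NonemptyCompacts.dist_eq]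
  refine lt_of_le_of_lt (Metric.hausdorffDist_le_of_mem_dist (half_pos hε).le ?_ ?_) (half_lt_self hε)
  · rw [hBs]; rw [hCb]; exact h1
  · rw [hBs]; rw [hCb]; exact h2

theorem final (k : ℕ) (hk : 3 ≤ k) :
    ∃ G : Set ↥(Dopen k), Dense G ∧ IsGδ G ∧
      ∀ C ∈ G, ∃ n : ℕ → ℕ,
        ((C : TopologicalSpace.NonemptyCompacts (E k)) : Set (E k)) = DFn k n ∧
        ∃ α : E k, PhiFiber k n = {α} ∧
          ¬ ∃ c : Fin k → ℤ, (∃ i, c i ≠ 0) ∧ ∑ i, (c i : ℝ) * α i = 0 :=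
  ⟨GG k, GG_dense hk, GG_Gd k, fun _ hC => GG_mem hk hC⟩

/-- `D` contains a dense `G_δ` subset all of whose elements are `DF(n)` for
regular `n` whose unique fiber point is completely irrational. -/
theorem stmt17 (k : ℕ) (hk : 3 ≤ k) :
    ∃ G : Set ↥(Dopen k), Dense G ∧ IsGδ G ∧
      ∀ C ∈ G, ∃ n : ℕ → ℕ,
        ((C : TopologicalSpace.NonemptyCompacts (E k)) : Set (E k)) = DFn k n ∧
        ∃ α : E k, PhiFiber k n = {α} ∧
          ¬ ∃ c : Fin k → ℤ, (∃ i, c i ≠ 0) ∧ ∑ i, (c i : ℝ) * α i = 0 := by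
  exact final k hk

end BetaDF
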